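/- Let 0 < a < ω_{d+1}/2 and ε ∈ (0,1]. There is a constant β̄ > 0 depending only on a and d (explicitly one may take β̄ := 2·min{ binom(d+1,2)·sin^{d+1}(α₀)·(ω_{d+1}/(2π·ω_d))^{2d} / (d + d·binom(d+1,2)·(π/2)²·tan^{−d}(α₀)) , (2/π)^{d+1}·ω_{d+1}^d/(d·(2π·ω_d)^d) }, where α₀ is the radius of a spherical cap of volume a) such that every K ∈ 𝒦_s^d with σ_d(K) ≥ a, σ_d(K) ≤ (ω_{d+1}/2)·(1 − ε/π) and Δ₂(K) ≥ ε satisfies U₁(K) ≥ (1 + β̄·ε^{2(d+1)})·U₁(B_a), where B_a is a spherical cap of volume a. -/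

import Mathlib

open Real MeasureTheory Filter
open scoped RealInnerProductSpace ENNReal NNReal Topology

noncomputable section

/-- The ambient Euclidean space `ℝ^{d+1}`. -/
abbrev Esp (d : ℕ) : Type := EuclideanSpace ℝ (Fin (d + 1))

/-- The unit sphere `S^d ⊂ ℝ^{d+1}`. -/
def uSphere (d : ℕ) : Set (Esp d) := Metric.sphere 0 1

/-- The spherical Lebesgue measure `σ_d` (d-dimensional Hausdorff measure restricted
to the unit sphere). -/
def sigmaMeas (d : ℕ) : Measure (Esp d) := (μH[(d : ℝ)]).restrict (uSphere d)

/-- `ω_{d+1} = σ_d(S^d)`, the total surface area of the unit sphere in `ℝ^{d+1}`. -/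
def omegaTot (d : ℕ) : ℝ := (sigmaMeas d (uSphere d)).toReal

/-- `ω_d`, the `(d-1)`-dimensional measure of the unit sphere `S^{d-1} ⊂ ℝ^d`. -/
def omegaSm (d : ℕ) : ℝ :=
  (μH[((d : ℝ) - 1)] (Metric.sphere (0 : EuclideanSpace ℝ (Fin d)) 1)).toReal

/-- `κ_d`, the volume of the unit ball in `ℝ^d`. -/
def kappaVol (d : ℕ) : ℝ :=
  (volume (Metric.ball (0 : EuclideanSpace ℝ (Fin d)) 1)).toReal

/-- The geodesic (angular) distance `d_s(x,y) = arccos ⟨x,y⟩` on the unit sphere. -/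
def geo {d : ℕ} (x y : Esp d) : ℝ := Real.arccos ⟪x, y⟫

/-- The spherical ball (cap) `B(e,α)` of radius `α` centred at `e`. -/
def cap {d : ℕ} (e : Esp d) (α : ℝ) : Set (Esp d) := {x ∈ uSphere d | geo x e ≤ α}

/-- `K ∈ 𝒦̄_s^d`: a spherically convex body, i.e. the intersection of the unit sphere
with a closed convex cone `C ≠ {0}` which is not a linear subspace. -/
def IsSphConvBody (d : ℕ) (K : Set (Esp d)) : Prop :=
  ∃ C : Set (Esp d), IsClosed C ∧ Convex ℝ C ∧
    (∀ x ∈ C, ∀ t : ℝ, 0 ≤ t → t • x ∈ C) ∧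
    C ≠ {0} ∧ (∀ L : Submodule ℝ (Esp d), C ≠ (L : Set (Esp d))) ∧
    K = C ∩ uSphere d

/-- `K ∈ 𝒦_s^d`: a proper spherically convex body, i.e. the intersection of the unit
sphere with a line-free closed convex cone `C ≠ {0}`. -/
def IsProperSphConvBody (d : ℕ) (K : Set (Esp d)) : Prop :=
  ∃ C : Set (Esp d), IsClosed C ∧ Convex ℝ C ∧
    (∀ x ∈ C, ∀ t : ℝ, 0 ≤ t → t • x ∈ C) ∧
    C ≠ {0} ∧ (∀ x ∈ C, x ≠ 0 → -x ∉ C) ∧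
    K = C ∩ uSphere d

/-- The spherical mean width functional
`U₁(K) = (1/(2 ω_{d+1})) σ_d({x ∈ S^d : x^⊥ ∩ K ≠ ∅})`. -/
def U1 (d : ℕ) (K : Set (Esp d)) : ℝ :=
  (1 / (2 * omegaTot d)) * (sigmaMeas d {x | ∃ y ∈ K, ⟪x, y⟫ = 0}).toReal

/-- `D(x) = ∫₀^x sin^{d-1} t dt`. -/
def Dfun (d : ℕ) (x : ℝ) : ℝ := ∫ t in (0:ℝ)..x, Real.sin t ^ (d - 1)

/-- `S_e = S^d ∩ e^⊥`, the great subsphere orthogonal to `e`. -/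
def equator {d : ℕ} (e : Esp d) : Set (Esp d) := uSphere d ∩ {x | ⟪x, e⟫ = 0}

/-- The rotation invariant probability measure `σ⁰_{d-1}` on the great subsphere `S_e`. -/
def sigma0 (d : ℕ) (e : Esp d) : Measure (Esp d) :=
  (μH[((d : ℝ) - 1)] (equator e))⁻¹ • (μH[((d : ℝ) - 1)]).restrict (equator e)

/-- The spherical radial function `α_{K,e}(u)`: the geodesic distance from `e` to the
boundary of `K` along the great circle through `e` in direction `u ∈ S_e`. -/
def sphRadial {d : ℕ} (K : Set (Esp d)) (e u : Esp d) : ℝ :=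
  sSup {t : ℝ | 0 ≤ t ∧ t ≤ π / 2 ∧ (Real.cos t) • e + (Real.sin t) • u ∈ K}

/-- The set `-int(K*)`: points `e` of the sphere such that `K` is contained in the
open hemisphere centred at `e`. -/
def negIntPolar (d : ℕ) (K : Set (Esp d)) : Set (Esp d) :=
  {e ∈ uSphere d | ∀ x ∈ K, 0 < ⟪e, x⟫}

/-- Points `e` of the sphere such that `K ⊆ {x : ⟨x,e⟩ ≥ 0}` (closed hemisphere). -/
def hemiCenters (d : ℕ) (K : Set (Esp d)) : Set (Esp d) :=
  {e ∈ uSphere d | ∀ x ∈ K, 0 ≤ ⟪x, e⟫}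

/-- The `σ⁰_{d-1}`-average of `D ∘ α_{K,e}` over `S_e`. -/
def avgD (d : ℕ) (K : Set (Esp d)) (e : Esp d) : ℝ :=
  ∫ u, Dfun d (sphRadial K e u) ∂(sigma0 d e)

/-- The `L²(S_e, σ⁰_{d-1})`-deviation of `D ∘ α_{K,e}` from its average. -/
def L2dev (d : ℕ) (K : Set (Esp d)) (e : Esp d) : ℝ :=
  Real.sqrt (∫ u, (Dfun d (sphRadial K e u) - avgD d K e) ^ 2 ∂(sigma0 d e))

/-- `Δ₂(K)`: infimum of the `L²` deviations over `e ∈ -int(K*)`. -/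
def Delta2 (d : ℕ) (K : Set (Esp d)) : ℝ :=
  sInf (L2dev d K '' negIntPolar d K)

/-- `Δ₂*(K)`: infimum of the `L²` deviations over all `e` with
`K ⊆ {x : ⟨x,e⟩ ≥ 0}`. -/
def Delta2Star (d : ℕ) (K : Set (Esp d)) : ℝ :=
  sInf (L2dev d K '' hemiCenters d K)

/-- The centred spherical inradius `r_e(K) = max{r ≥ 0 : B(e,r) ⊆ K}`. -/
def rcent (d : ℕ) (K : Set (Esp d)) (e : Esp d) : ℝ :=
  sSup {r : ℝ | 0 ≤ r ∧ cap e r ⊆ K}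

/-- The centred spherical circumradius `R_e(K) = min{r ≥ 0 : K ⊆ B(e,r)}`. -/
def Rcent (d : ℕ) (K : Set (Esp d)) (e : Esp d) : ℝ :=
  sInf {r : ℝ | 0 ≤ r ∧ K ⊆ cap e r}

/-- The spherical inradius `Σ_r(K) = max{r_e(K) : e ∈ K}`. -/
def SigmaR (d : ℕ) (K : Set (Esp d)) : ℝ :=
  sSup (rcent d K '' K)

/-- The deviation functional `ϑ_r(K) = min{R_e(K) - r_e(K) : e ∈ K, r_e(K) = Σ_r(K)}`. -/
def thetaR (d : ℕ) (K : Set (Esp d)) : ℝ :=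
  sInf ((fun e => Rcent d K e - rcent d K e) '' {e ∈ K | rcent d K e = SigmaR d K})

/-- `Ũ_e(K) = σ_d({x ∈ S^d : (x-e)^⊥ ∩ K ≠ ∅})`. -/
def Utilde (d : ℕ) (e : Esp d) (K : Set (Esp d)) : ℝ :=
  (sigmaMeas d {x | ∃ y ∈ K, ⟪x - e, y⟫ = 0}).toReal

/-- The spherical Hausdorff distance `δ_s`, based on the geodesic metric. -/
def sphHausdorff (d : ℕ) (K L : Set (Esp d)) : ℝ :=
  max (⨆ x ∈ K, ⨅ y ∈ L, geo x y) (⨆ y ∈ L, ⨅ x ∈ K, geo x y)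

/-- Continuity of a functional on `𝒦̄_s^d` with respect to the spherical Hausdorff
metric `δ_s`. -/
def SphContinuous (d : ℕ) (F : Set (Esp d) → ℝ) : Prop :=
  ∀ K, IsSphConvBody d K → ∀ ε > (0:ℝ), ∃ δ > (0:ℝ), ∀ L, IsSphConvBody d L →
    sphHausdorff d K L < δ → |F K - F L| < ε

/-- A hitting functional: continuous, nonnegative, vanishing exactly on one-pointed
sets. -/
def IsHittingFunctional (d : ℕ) (Φ : Set (Esp d) → ℝ) : Prop :=
  SphContinuous d Φ ∧ (∀ K, IsSphConvBody d K → 0 ≤ Φ K) ∧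
    (∀ K, IsSphConvBody d K → (Φ K = 0 ↔ ∃ p, K = {p}))

/-- A size functional: continuous, nonnegative, not identically zero, vanishing on
one-pointed sets. -/
def IsSizeFunctional (d : ℕ) (S : Set (Esp d) → ℝ) : Prop :=
  SphContinuous d S ∧ (∀ K, IsSphConvBody d K → 0 ≤ S K) ∧
    (∃ K, IsSphConvBody d K ∧ S K ≠ 0) ∧
    (∀ p ∈ uSphere d, S ({p} : Set (Esp d)) = 0)

/-- The isoperimetric constant `τ(Φ,Σ,a) = inf{Φ(K) : K ∈ 𝒦̄_s^d, Σ(K) ≥ a}`. -/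
def tauConst (d : ℕ) (Φ S : Set (Esp d) → ℝ) (a : ℝ) : ℝ :=
  sInf (Φ '' {K | IsSphConvBody d K ∧ a ≤ S K})

/-- The spherical convex hull of a set `V ⊆ S^d`: the intersection of the sphere with
the closed convex cone generated by `V`. -/
def sphConvHull (d : ℕ) (V : Set (Esp d)) : Set (Esp d) :=
  {x ∈ uSphere d | ∃ y ∈ convexHull ℝ V, ∃ t : ℝ, 0 < t ∧ x = t • y}

/-- A spherical polytope: the intersection of the sphere with a finitely generated
(polyhedral) cone, which is also a spherically convex body. -/
def IsSphPolytope (d : ℕ) (P : Set (Esp d)) : Prop :=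
  IsSphConvBody d P ∧ ∃ V : Finset (Esp d),
    (V : Set (Esp d)) ⊆ uSphere d ∧ P = sphConvHull d (V : Set (Esp d))

/-- The vertices (extreme points) of a spherical polytope. -/
def sphExtremePoints (d : ℕ) (P : Set (Esp d)) : Set (Esp d) :=
  {x ∈ P | x ∉ sphConvHull d (P \ {x})}

/-- The boundary of `K` relative to the sphere. -/
def sphFrontier (d : ℕ) (K : Set (Esp d)) : Set (Esp d) :=
  {x ∈ K | ∀ ε > (0:ℝ), ∃ y ∈ uSphere d, y ∉ K ∧ dist y x < ε}

/-- The functions `h_m(t) = (-1)^{m+1} e^{-t} + 2 ∑_{i=0}^{⌊m/2⌋} t^{m-2i}/(m-2i)!`. -/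
def hFun (m : ℕ) (t : ℝ) : ℝ :=
  (-1 : ℝ) ^ (m + 1) * Real.exp (-t) +
    2 * ∑ i ∈ Finset.range (m / 2 + 1), t ^ (m - 2 * i) / (Nat.factorial (m - 2 * i) : ℝ)

open scoped Pointwise in
theorem volume_add_le_of_midpoint_mem_of_isCompact {A B C : Set ℝ} (hA : IsCompact A)
    (hB : IsCompact B) (hA0 : A.Nonempty) (hB0 : B.Nonempty)
    (h : ∀ a ∈ A, ∀ b ∈ B, (a + b) / 2 ∈ C) :
    volume A + volume B ≤ 2 * volume C := by
  obtain ⟨p, hpA, hp⟩ := hA.exists_isGreatest hA0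
  obtain ⟨q, hqB, hq⟩ := hB.exists_isLeast hB0
  have hscale : ∀ (S : Set ℝ) (c : ℝ),
      2 * volume ((fun x => c + (1 / 2 : ℝ) * x) '' S) = volume S := by
    intro S c
    have : (fun x => c + (1 / 2 : ℝ) * x) '' S = (fun x => c + x) '' ((1 / 2 : ℝ) • S) := by
      rw [← Set.image_smul, Set.image_image]; simp only [smul_eq_mul]
    rw [this, Set.image_add_left, measure_preimage_add, Measure.addHaar_smul]
    simp only [Module.finrank_self, pow_one]
    rw [← mul_assoc, abs_of_pos (by norm_num : (0:ℝ) < 1 / 2),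
      show (2 : ℝ≥0∞) = ENNReal.ofReal 2 by simp, ← ENNReal.ofReal_mul (by norm_num)]
    norm_num
  set A' := (fun x => q / 2 + (1 / 2 : ℝ) * x) '' A with hA'
  set B' := (fun x => p / 2 + (1 / 2 : ℝ) * x) '' B with hB'
  have hsub : A' ∪ B' ⊆ C := by
    rintro y (⟨x, hx, rfl⟩ | ⟨x, hx, rfl⟩)
    · convert h x hx q hqB using 1; ring
    · convert h p hpA x hx using 1; ring
  have hmeas : MeasurableSet B' := (hB.image (by fun_prop)).measurableSet
  have hdisj : AEDisjoint volume A' B' := by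
    refine measure_mono_null (t := {(p + q) / 2}) ?_ (by simp)
    rintro y ⟨⟨x, hx, rfl⟩, ⟨z, hz, hzx⟩⟩
    have h1 := hp hx
    have h2 := hq hz
    simp only at hzx
    simp only [Set.mem_singleton_iff]
    linarith
  calc volume A + volume B = 2 * volume A' + 2 * volume B' := by rw [hscale, hscale]
    _ = 2 * volume (A' ∪ B') := by
        rw [measure_union₀ hmeas.nullMeasurableSet hdisj, mul_add]
    _ ≤ 2 * volume C := by gcongr

/-- One-dimensional Brunn–Minkowski inequality. -/
theorem volume_add_le_of_midpoint_mem {A B C : Set ℝ} (hA : MeasurableSet A)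
    (hB : MeasurableSet B) (hA0 : A.Nonempty) (hB0 : B.Nonempty)
    (h : ∀ a ∈ A, ∀ b ∈ B, (a + b) / 2 ∈ C) :
    volume A + volume B ≤ 2 * volume C := by
  obtain ⟨p, hp⟩ := hA0
  obtain ⟨q, hq⟩ := hB0
  rw [hA.measure_eq_iSup_isCompact, hB.measure_eq_iSup_isCompact]
  simp only [iSup_and']
  refine ENNReal.biSup_add_biSup_le' ⟨∅, by simp⟩ ⟨∅, by simp⟩ ?_
  rintro K ⟨hKA, hK⟩ L ⟨hLB, hL⟩
  calc volume K + volume L ≤ volume (insert p K) + volume (insert q L) := by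
        gcongr <;> exact Set.subset_insert _ _
    _ ≤ _ := volume_add_le_of_midpoint_mem_of_isCompact (hK.insert p) (hL.insert q)
        (Set.insert_nonempty _ _) (Set.insert_nonempty _ _) (fun a ha b hb => h a
          (Set.insert_subset hp hKA ha) b (Set.insert_subset hq hLB hb))

theorem lintegral_add_le_of_normalized {f g h : ℝ → ℝ} (hf : Measurable f) (hg : Measurable g)
    (hh : Measurable h) (f0 : 0 ≤ f) (g0 : 0 ≤ g) (h0 : 0 ≤ h) (f1 : ∀ x, f x ≤ 1)
    (g1 : ∀ x, g x ≤ 1) (f2 : ∀ t < 1, ∃ x, t < f x) (g2 : ∀ t < 1, ∃ x, t < g x)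
    (H : ∀ a b, f a * g b ≤ h ((a + b) / 2) ^ 2) :
    (∫⁻ x, ENNReal.ofReal (f x)) + ∫⁻ x, ENNReal.ofReal (g x)
      ≤ 2 * ∫⁻ x, ENNReal.ofReal (h x) := by
  rw [lintegral_eq_lintegral_meas_lt _ (ae_of_all _ f0) hf.aemeasurable,
    lintegral_eq_lintegral_meas_lt _ (ae_of_all _ g0) hg.aemeasurable,
    lintegral_eq_lintegral_meas_lt _ (ae_of_all _ h0) hh.aemeasurable,
    ← lintegral_const_mul' _ _ (by simp), ← lintegral_add_left]
  · refine setLIntegral_mono' measurableSet_Ioi fun t ht => ?_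
    have ht : 0 < t := ht
    by_cases h1 : t < 1
    · refine volume_add_le_of_midpoint_mem (measurableSet_lt measurable_const hf)
        (measurableSet_lt measurable_const hg) (f2 t h1) (g2 t h1) fun a ha b hb => ?_
      have ha : t < f a := ha
      have hb : t < g b := hb
      have : t ^ 2 < h ((a + b) / 2) ^ 2 := lt_of_lt_of_le (by nlinarith) (H a b)
      exact lt_of_pow_lt_pow_left₀ 2 (h0 _) this
    · have e1 : {a | t < f a} = ∅ := by
        ext a; simpa using (f1 a).trans (not_lt.1 h1)
      have e2 : {a | t < g a} = ∅ := by
        ext a; simpa using (g1 a).trans (not_lt.1 h1)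
      simp [e1, e2]
  · exact Antitone.measurable fun s t hst => measure_mono fun x hx => lt_of_le_of_lt hst hx

theorem lintegral_mul_le_sq_of_bounded {f g h : ℝ → ℝ} (hf : Measurable f) (hg : Measurable g)
    (hh : Measurable h) (f0 : 0 ≤ f) (g0 : 0 ≤ g) (h0 : 0 ≤ h)
    (f1 : BddAbove (Set.range f)) (g1 : BddAbove (Set.range g))
    (H : ∀ a b, f a * g b ≤ h ((a + b) / 2) ^ 2) :
    (∫⁻ x, ENNReal.ofReal (f x)) * ∫⁻ x, ENNReal.ofReal (g x)
      ≤ (∫⁻ x, ENNReal.ofReal (h x)) ^ 2 := by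
  by_cases hfz : ∀ x, f x ≤ 0
  · simp [fun x => ENNReal.ofReal_of_nonpos (hfz x)]
  by_cases hgz : ∀ x, g x ≤ 0
  · simp [fun x => ENNReal.ofReal_of_nonpos (hgz x)]
  push Not at hfz hgz
  obtain ⟨x0, hx0⟩ := hfz
  obtain ⟨y0, hy0⟩ := hgz
  set M := ⨆ x, f x with hM
  set N := ⨆ x, g x with hN
  have hM0 : 0 < M := hx0.trans_le (le_ciSup f1 x0)
  have hN0 : 0 < N := hy0.trans_le (le_ciSup g1 y0)
  set k := √(M * N) with hk
  have hk0 : 0 < k := Real.sqrt_pos.2 (by positivity)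
  have hk2 : k ^ 2 = M * N := Real.sq_sqrt (by positivity)
  have key := lintegral_add_le_of_normalized (f := fun x => M⁻¹ * f x) (g := fun x => N⁻¹ * g x)
    (h := fun x => k⁻¹ * h x) (by fun_prop) (by fun_prop) (by fun_prop)
    (fun x => mul_nonneg (by positivity) (f0 x)) (fun x => mul_nonneg (by positivity) (g0 x))
    (fun x => mul_nonneg (by positivity) (h0 x))
    (fun x => by rw [inv_mul_le_iff₀ hM0, mul_one]; exact le_ciSup f1 x)
    (fun x => by rw [inv_mul_le_iff₀ hN0, mul_one]; exact le_ciSup g1 x)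
    (fun t ht => by
      obtain ⟨x, hx⟩ := exists_lt_of_lt_ciSup (show M * t < ⨆ x, f x by nlinarith)
      exact ⟨x, by rwa [lt_inv_mul_iff₀ hM0]⟩)
    (fun t ht => by
      obtain ⟨x, hx⟩ := exists_lt_of_lt_ciSup (show N * t < ⨆ x, g x by nlinarith)
      exact ⟨x, by rwa [lt_inv_mul_iff₀ hN0]⟩)
    (fun a b => by
      have := H a b
      rw [mul_pow, inv_pow, hk2, show M⁻¹ * f a * (N⁻¹ * g b) = (M * N)⁻¹ * (f a * g b) by
        rw [mul_inv]; ring]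
      gcongr)
  simp only [ENNReal.ofReal_mul (inv_nonneg.2 hM0.le), ENNReal.ofReal_mul (inv_nonneg.2 hN0.le),
    ENNReal.ofReal_mul (inv_nonneg.2 hk0.le)] at key
  rw [lintegral_const_mul' _ _ (by simp), lintegral_const_mul' _ _ (by simp),
    lintegral_const_mul' _ _ (by simp)] at key
  generalize (∫⁻ x, ENNReal.ofReal (f x)) = I at key ⊢
  generalize (∫⁻ x, ENNReal.ofReal (g x)) = J at key ⊢
  generalize (∫⁻ x, ENNReal.ofReal (h x)) = L at key ⊢
  by_cases hL : L = ⊤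
  · simp [hL]
  have hfin : ENNReal.ofReal M⁻¹ * I + ENNReal.ofReal N⁻¹ * J < ⊤ :=
    key.trans_lt (by finiteness)
  have hpos : ∀ r : ℝ, 0 < r → ENNReal.ofReal r⁻¹ ≠ 0 := fun r hr => by
    simpa using hr
  have hI : I ≠ ⊤ := fun h => by
    rw [h, ENNReal.mul_top (hpos M hM0)] at hfin; simp at hfin
  have hJ : J ≠ ⊤ := fun h => by
    rw [h, ENNReal.mul_top (hpos N hN0)] at hfin; simp at hfin
  lift I to ℝ≥0 using hI
  lift J to ℝ≥0 using hJ
  lift L to ℝ≥0 using hL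
  have key' : M⁻¹ * I + N⁻¹ * J ≤ 2 * (k⁻¹ * L) := by
    have := ENNReal.toReal_mono (by finiteness) key
    rw [ENNReal.toReal_add (by finiteness) (by finiteness)] at this
    simpa [hM0.le, hN0.le, hk0.le] using this
  have : (I : ℝ) * J ≤ L ^ 2 := by
    have e1 : (I : ℝ) * J = k ^ 2 * ((M⁻¹ * I) * (N⁻¹ * J)) := by rw [hk2]; field_simp
    have e2 : (L : ℝ) ^ 2 = k ^ 2 * (k⁻¹ * L) ^ 2 := by field_simp
    rw [e1, e2]
    have a1 : 0 ≤ M⁻¹ * (I : ℝ) := by positivity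
    have a2 : 0 ≤ N⁻¹ * (J : ℝ) := by positivity
    gcongr
    nlinarith [sq_nonneg (M⁻¹ * (I : ℝ) - N⁻¹ * J)]
  exact_mod_cast this

/-- One-dimensional Prékopa–Leindler inequality (for the geometric mean). -/
theorem lintegral_mul_le_sq_of_midpoint {f g : ℝ → ℝ≥0∞} {h : ℝ → ℝ} (hf : Measurable f)
    (hg : Measurable g) (hh : Measurable h) (h0 : 0 ≤ h)
    (H : ∀ a b, f a * g b ≤ ENNReal.ofReal (h ((a + b) / 2) ^ 2)) :
    (∫⁻ x, f x) * ∫⁻ x, g x ≤ (∫⁻ x, ENNReal.ofReal (h x)) ^ 2 := by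
  have hsup : ∀ k : ℝ → ℝ≥0∞, Measurable k →
      ∫⁻ x, k x = ⨆ n : ℕ, ∫⁻ x, min (k x) n := by
    intro k hk
    rw [← lintegral_iSup (fun n => by fun_prop)]
    · congr with x
      rw [← inf_iSup_eq, ENNReal.iSup_natCast, inf_top_eq]
    · intro m n hmn x
      exact min_le_min_left _ (by exact_mod_cast hmn)
  rw [hsup f hf, hsup g hg, ENNReal.iSup_mul]
  refine iSup_le fun m => ?_
  rw [ENNReal.mul_iSup]
  refine iSup_le fun n => ?_
  have fin : ∀ (k : ℝ → ℝ≥0∞) (n : ℕ) x, min (k x) n ≠ ⊤ := fun k n x =>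
    ((min_le_right _ _).trans_lt (ENNReal.natCast_lt_top n)).ne
  have bdd : ∀ (k : ℝ → ℝ≥0∞) (n : ℕ), BddAbove (Set.range fun x => (min (k x) n).toReal) := by
    rintro k n
    refine ⟨n, ?_⟩
    rintro _ ⟨x, rfl⟩
    exact ENNReal.toReal_le_of_le_ofReal (by positivity) (by simp)
  have := lintegral_mul_le_sq_of_bounded (f := fun x => (min (f x) m).toReal)
    (g := fun x => (min (g x) n).toReal) (h := h) (by fun_prop) (by fun_prop) hh
    (fun x => ENNReal.toReal_nonneg) (fun x => ENNReal.toReal_nonneg) h0 (bdd f m) (bdd g n)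
    (fun a b => by
      rw [← ENNReal.toReal_mul]
      refine ENNReal.toReal_le_of_le_ofReal (by positivity) ((mul_le_mul' ?_ ?_).trans (H a b))
      · exact min_le_left _ _
      · exact min_le_left _ _)
  simpa only [ENNReal.ofReal_toReal (fin _ _ _)] using this

theorem lintegral_Ioi_eq_lintegral_comp_exp (f : ℝ → ℝ≥0∞) :
    ∫⁻ s in Set.Ioi (0 : ℝ), f s = ∫⁻ x, ENNReal.ofReal (exp x) * f (exp x) := by
  have := lintegral_image_eq_lintegral_abs_deriv_mul (s := Set.univ) (f := exp) (f' := exp)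
    MeasurableSet.univ (fun x _ => (Real.hasDerivAt_exp x).hasDerivWithinAt)
    Real.exp_injective.injOn f
  simpa [Set.image_univ, Real.range_exp] using this

theorem lintegral_exp_mul_exp_neg_sq (c : ℝ) (hc : 0 ≤ c) :
    ∫⁻ x : ℝ, ENNReal.ofReal (c * (exp x * exp (-exp x ^ 2 / 2)))
      = ENNReal.ofReal (c * √(π / 2)) := by
  have h1 := lintegral_Ioi_eq_lintegral_comp_exp (fun s => ENNReal.ofReal (exp (-(1 / 2) * s ^ 2)))
  simp only [ENNReal.ofReal_mul hc]
  rw [lintegral_const_mul' _ _ (by simp)]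
  congr 1
  have h2 : ∀ x : ℝ, ENNReal.ofReal (exp x * exp (-exp x ^ 2 / 2)) =
      ENNReal.ofReal (exp x) * ENNReal.ofReal (exp (-(1 / 2) * exp x ^ 2)) := fun x => by
    rw [← ENNReal.ofReal_mul (exp_pos x).le]; ring_nf
  simp only [h2]
  rw [← h1, ← ofReal_integral_eq_lintegral_ofReal]
  · rw [integral_gaussian_Ioi]
    congr 1
    rw [show (π / (1 / 2)) = (π / 2) * 2 ^ 2 by ring, Real.sqrt_mul (by positivity),
      Real.sqrt_sq (by norm_num)]
    ring
  · exact (integrable_exp_neg_mul_sq (by norm_num)).integrableOn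
  · exact ae_of_all _ fun x => (exp_pos _).le

/-- Functions on the half line that are dual with respect to `exp (-s t)`. -/
theorem lintegral_Ioi_mul_le_of_dual {f g : ℝ → ℝ≥0∞} (hf : Measurable f)
    (hg : Measurable g) {K : ℝ} (hK : 0 ≤ K)
    (H : ∀ s t, 0 < s → 0 < t → f s * g t ≤ ENNReal.ofReal (K * exp (-(s * t)))) :
    (∫⁻ s in Set.Ioi (0 : ℝ), f s) * ∫⁻ t in Set.Ioi (0 : ℝ), g t ≤
      ENNReal.ofReal (K * (π / 2)) := by
  rw [lintegral_Ioi_eq_lintegral_comp_exp f, lintegral_Ioi_eq_lintegral_comp_exp g]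
  refine (lintegral_mul_le_sq_of_midpoint (h := fun x => √K * (exp x * exp (-exp x ^ 2 / 2)))
    (by fun_prop) (by fun_prop) (by fun_prop) (fun x => by positivity) fun a b => ?_).trans_eq ?_
  · calc _ = ENNReal.ofReal (exp a * exp b) * (f (exp a) * g (exp b)) := by
          rw [ENNReal.ofReal_mul (exp_pos a).le]; ring
      _ ≤ ENNReal.ofReal (exp a * exp b) * ENNReal.ofReal (K * exp (-(exp a * exp b))) := by
          gcongr; exact H _ _ (exp_pos a) (exp_pos b)
      _ = _ := by
          rw [← ENNReal.ofReal_mul (by positivity)]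
          congr 1
          have e : exp ((a + b) / 2) ^ 2 = exp a * exp b := by
            rw [← Real.exp_nat_mul, ← Real.exp_add]; congr 1; push_cast; ring
          rw [mul_pow, mul_pow, Real.sq_sqrt hK, e, ← Real.exp_nat_mul]
          push_cast
          rw [show (2 : ℝ) * (-(exp a * exp b) / 2) = -(exp a * exp b) by ring]
          ring
  · rw [lintegral_exp_mul_exp_neg_sq _ (by positivity), ← ENNReal.ofReal_pow (by positivity),
      mul_pow, Real.sq_sqrt hK, Real.sq_sqrt (by positivity)]

/-- The functional Blaschke–Santaló inequality on `ℝⁿ`, for functions one of which has barycentre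
at the origin. -/
def SantaloHolds (n : ℕ) : Prop :=
  ∀ (K : ℝ) (f : (Fin n → ℝ) → ℝ≥0∞) (g : (Fin n → ℝ) → ℝ), 0 ≤ K → Measurable f →
    Measurable g → 0 ≤ g → Integrable g → (∀ i, Integrable fun x => x i * g x) →
    (∀ i, ∫ x, x i * g x = 0) →
    (∀ x y, f x * ENNReal.ofReal (g y) ≤ ENNReal.ofReal (K * exp (-(x ⬝ᵥ y)))) →
    (∫⁻ x, f x) * ∫⁻ x, ENNReal.ofReal (g x) ≤ ENNReal.ofReal (K * (2 * π) ^ n)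

theorem restrict_fst_mem_eq {V : Type*} [MeasureSpace V] [SFinite (volume : Measure V)]
    (s : Set ℝ) :
    (volume : Measure (ℝ × V)).restrict {p | p.1 ∈ s} =
      ((volume : Measure ℝ).restrict s).prod volume := by
  rw [← Measure.restrict_univ (μ := (volume : Measure V)), Measure.prod_restrict]
  congr 1
  ext p; simp

theorem restrict_fst_Iic_eq {V : Type*} [MeasureSpace V] [SFinite (volume : Measure V)] (c : ℝ) :
    (volume : Measure (ℝ × V)).restrict {p | p.1 ∈ Set.Iic c} =
      (volume : Measure (ℝ × V)).restrict {p | p.1 ∈ Set.Iio c} := by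
  rw [restrict_fst_mem_eq, restrict_fst_mem_eq, Measure.restrict_congr_set Iio_ae_eq_Iic]

theorem santalo_half {n : ℕ} (ih : SantaloHolds n) {K : ℝ} (hK : 0 ≤ K)
    {f : ℝ × (Fin n → ℝ) → ℝ} {g : ℝ × (Fin n → ℝ) → ℝ≥0∞} (hf : Measurable f)
    (hg : Measurable g) (f0 : 0 ≤ f) (hfi : IntegrableOn f {p | p.1 ∈ Set.Ioi 0})
    (hfm : ∀ i, IntegrableOn (fun p => p.2 i * f p) {p | p.1 ∈ Set.Ioi 0})
    (hfz : ∀ i, ∫ p in {p | p.1 ∈ Set.Ioi 0}, p.2 i * f p = 0)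
    (H : ∀ s x t y, 0 < s → 0 < t → ENNReal.ofReal (f (s, x)) * g (t, y) ≤
      ENNReal.ofReal (K * exp (-(x ⬝ᵥ y)) * exp (-(s * t)))) :
    ENNReal.ofReal (∫ p in {p | p.1 ∈ Set.Ioi 0}, f p) * ∫⁻ p in {p | p.1 ∈ Set.Ioi 0}, g p
      ≤ ENNReal.ofReal (K * (π / 2) * (2 * π) ^ n) := by
  simp only [IntegrableOn, restrict_fst_mem_eq] at *
  set μ := (volume : Measure ℝ).restrict (Set.Ioi 0) with hμ
  set F : (Fin n → ℝ) → ℝ := fun x => ∫ s, f (s, x) ∂μ with hF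
  set G : (Fin n → ℝ) → ℝ≥0∞ := fun x => ∫⁻ s, g (s, x) ∂μ with hG
  have hFle : ∀ x, ENNReal.ofReal (F x) ≤ ∫⁻ s, ENNReal.ofReal (f (s, x)) ∂μ := by
    intro x
    by_cases h : Integrable (fun s => f (s, x)) μ
    · exact (ofReal_integral_eq_lintegral_ofReal h (ae_of_all _ fun s => f0 _)).le
    · simp [hF, integral_undef h]
  have hF0 : 0 ≤ F := fun x => integral_nonneg fun s => f0 _
  have hFi : Integrable F := hfi.integral_prod_right
  have hmom : ∀ i x, x i * F x = ∫ s, x i * f (s, x) ∂μ := fun i x => by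
    rw [hF, integral_const_mul]
  have := ih (K * (π / 2)) G F (by positivity) hg.lintegral_prod_left'
    hf.stronglyMeasurable.integral_prod_left'.measurable hF0 hFi
    (fun i => by simp only [hmom]; exact (hfm i).integral_prod_right)
    (fun i => by
      simp only [hmom]
      rw [← hfz i, integral_prod_symm _ (hfm i)])
    (fun x y => by
      rw [mul_comm]
      calc ENNReal.ofReal (F y) * G x ≤ (∫⁻ s, ENNReal.ofReal (f (s, y)) ∂μ) * G x := by
            gcongr; exact hFle y
        _ ≤ _ := lintegral_Ioi_mul_le_of_dual (f := fun s => ENNReal.ofReal (f (s, y)))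
            (g := fun t => g (t, x)) (by fun_prop) (by fun_prop)
            (K := K * exp (-(y ⬝ᵥ x))) (by positivity) fun s t hs ht => H s y t x hs ht
        _ = _ := by rw [dotProduct_comm y x]; congr 1; ring)
  rw [← ofReal_integral_eq_lintegral_ofReal hFi (ae_of_all _ hF0), mul_comm] at this
  rwa [integral_prod_symm _ hfi, lintegral_prod_symm _ hg.aemeasurable]

theorem santalo_of_balanced {n : ℕ} (ih : SantaloHolds n) {K : ℝ} (hK : 0 ≤ K)
    {f : ℝ × (Fin n → ℝ) → ℝ} {g : ℝ × (Fin n → ℝ) → ℝ≥0∞} (hf : Measurable f)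
    (hg : Measurable g) (f0 : 0 ≤ f) (hfi : Integrable f)
    (hfm : ∀ i, Integrable (fun p => p.2 i * f p))
    {m : ℝ} (h1 : ∫ p in {p | p.1 ∈ Set.Ioi 0}, f p = m / 2)
    (h2 : ∫ p in {p | p.1 ∈ Set.Iio 0}, f p = m / 2)
    (hz1 : ∀ i, ∫ p in {p | p.1 ∈ Set.Ioi 0}, p.2 i * f p = 0)
    (hz2 : ∀ i, ∫ p in {p | p.1 ∈ Set.Iio 0}, p.2 i * f p = 0)
    (H : ∀ s x t y, ENNReal.ofReal (f (s, x)) * g (t, y) ≤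
      ENNReal.ofReal (K * exp (-(s * t + x ⬝ᵥ y)))) :
    ENNReal.ofReal m * ∫⁻ p, g p ≤ ENNReal.ofReal (K * (2 * π) ^ (n + 1)) := by
  have hplus := santalo_half ih hK hf hg f0 hfi.integrableOn (fun i => (hfm i).integrableOn) hz1
    (fun s x t y _ _ => (H s x t y).trans_eq (by
      rw [mul_assoc, ← Real.exp_add]; congr 3; ring))
  set N : ℝ × (Fin n → ℝ) → ℝ × (Fin n → ℝ) := fun p => (-p.1, p.2) with hN
  have hNm : MeasurePreserving N volume volume :=
    (Measure.measurePreserving_neg volume).prod (MeasurePreserving.id volume)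
  have hNr : MeasurePreserving N (volume.restrict {p | p.1 ∈ Set.Ioi 0})
      (volume.restrict {p | p.1 ∈ Set.Iio 0}) := by
    have : {p : ℝ × (Fin n → ℝ) | p.1 ∈ Set.Ioi 0} = N ⁻¹' {p | p.1 ∈ Set.Iio 0} := by
      ext p; simp [hN]
    rw [this]
    exact hNm.restrict_preimage (measurable_fst measurableSet_Iio)
  have hNint : ∀ h : ℝ × (Fin n → ℝ) → ℝ, Measurable h →
      ∫ p in {p | p.1 ∈ Set.Ioi 0}, h (N p) = ∫ p in {p | p.1 ∈ Set.Iio 0}, h p := by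
    intro h hh
    rw [← hNr.map_eq, integral_map hNr.measurable.aemeasurable hh.aestronglyMeasurable]
  have hminus := santalo_half ih hK (f := f ∘ N) (g := g ∘ N) (hf.comp hNm.measurable)
    (hg.comp hNm.measurable) (fun p => f0 (N p))
    ((hNm.integrable_comp hf.aestronglyMeasurable).2 hfi).integrableOn
    (fun i => ((hNm.integrable_comp (hfm i).1).2 (hfm i)).integrableOn)
    (fun i => (hNint (fun p => p.2 i * f p) (by fun_prop)).trans (hz2 i))
    (fun s x t y _ _ => (H (-s) x (-t) y).trans_eq (by
      rw [mul_assoc, ← Real.exp_add]; congr 3; ring))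
  simp only [Function.comp_apply] at hminus
  rw [hNint f hf, hNr.lintegral_comp hg, h2] at hminus
  rw [h1] at hplus
  have hsplit : ∫⁻ p, g p = (∫⁻ p in {p | p.1 ∈ Set.Ioi 0}, g p)
      + ∫⁻ p in {p | p.1 ∈ Set.Iio 0}, g p := by
    rw [← lintegral_add_compl g (A := {p | p.1 ∈ Set.Ioi 0}) (measurable_fst measurableSet_Ioi)]
    congr 1
    have : {p : ℝ × (Fin n → ℝ) | p.1 ∈ Set.Ioi 0}ᶜ = {p | p.1 ∈ Set.Iic 0} := by
      ext; simp
    rw [this, restrict_fst_Iic_eq]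
  have hm2 : ENNReal.ofReal m = 2 * ENNReal.ofReal (m / 2) := by
    rw [show (2 : ℝ≥0∞) = ENNReal.ofReal 2 by simp, ← ENNReal.ofReal_mul (by norm_num)]
    congr 1; ring
  calc ENNReal.ofReal m * ∫⁻ p, g p = 2 * (ENNReal.ofReal (m / 2) *
        (∫⁻ p in {p | p.1 ∈ Set.Ioi 0}, g p) + ENNReal.ofReal (m / 2) *
        ∫⁻ p in {p | p.1 ∈ Set.Iio 0}, g p) := by rw [hsplit, hm2]; ring
    _ ≤ 2 * (ENNReal.ofReal (K * (π / 2) * (2 * π) ^ n) +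
        ENNReal.ofReal (K * (π / 2) * (2 * π) ^ n)) := by gcongr
    _ = _ := by
      rw [← ENNReal.ofReal_add (by positivity) (by positivity),
        show (2 : ℝ≥0∞) = ENNReal.ofReal 2 by simp, ← ENNReal.ofReal_mul (by norm_num)]
      congr 1; ring

theorem exists_median {h : ℝ → ℝ} (hi : Integrable h) (h0 : 0 ≤ h) :
    ∃ c, ∫ x in Set.Ioi c, h x = (∫ x, h x) / 2 := by
  have hsum : ∀ c, (∫ x in Set.Iic c, h x) + ∫ x in Set.Ioi c, h x = ∫ x, h x := fun c =>
    intervalIntegral.integral_Iic_add_Ioi hi.integrableOn hi.integrableOn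
  by_cases hpos : ∫ x, h x = 0
  · refine ⟨0, ?_⟩
    have h1 : 0 ≤ ∫ x in Set.Iic 0, h x := integral_nonneg h0
    have h2 : 0 ≤ ∫ x in Set.Ioi 0, h x := integral_nonneg h0
    have := hsum 0
    linarith
  have hpos : 0 < ∫ x, h x := lt_of_le_of_ne (integral_nonneg h0) (Ne.symm hpos)
  have hii : ∀ a b, IntervalIntegrable h volume a b := fun a b => hi.intervalIntegrable
  have ht := intervalIntegral_tendsto_integral_Ioi 0 hi.integrableOn tendsto_id
  have hb := intervalIntegral_tendsto_integral_Iic 0 hi.integrableOn tendsto_id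
  simp only [id] at ht hb
  obtain ⟨c, hc⟩ := mem_range_of_exists_le_of_exists_ge
    (intervalIntegral.continuous_primitive hii 0)
    (c := ((∫ x in Set.Ioi 0, h x) - ∫ x in Set.Iic 0, h x) / 2)
    (by
      obtain ⟨a, ha⟩ := (hb.eventually_const_le (u := ((∫ x in Set.Iic 0, h x) -
        ∫ x in Set.Ioi 0, h x) / 2) (by linarith [hsum 0])).exists
      refine ⟨a, ?_⟩
      rw [intervalIntegral.integral_symm]; linarith)
    (by
      obtain ⟨a, ha⟩ := (ht.eventually_const_le (u := ((∫ x in Set.Ioi 0, h x) -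
        ∫ x in Set.Iic 0, h x) / 2) (by linarith [hsum 0])).exists
      exact ⟨a, ha⟩)
  refine ⟨c, ?_⟩
  have := intervalIntegral.integral_Iic_sub_Iic (a := 0) (b := c) hi.integrableOn hi.integrableOn
  have h1 := hsum 0
  have h2 := hsum c
  simp only at hc
  linarith


theorem integral_eq_fst_Ioi_add_fst_Iio {V : Type*} [MeasureSpace V]
    [SFinite (volume : Measure V)] {f : ℝ × V → ℝ} (hf : Integrable f) (c : ℝ) :
    ∫ p, f p = (∫ p in {p | p.1 ∈ Set.Ioi c}, f p) + ∫ p in {p | p.1 ∈ Set.Iio c}, f p := by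
  rw [← integral_add_compl (s := {p : ℝ × V | p.1 ∈ Set.Ioi c})
    (measurable_fst measurableSet_Ioi) hf]
  have : {p : ℝ × V | p.1 ∈ Set.Ioi c}ᶜ = {p | p.1 ∈ Set.Iic c} := by
    ext; simp
  rw [this, restrict_fst_Iic_eq]

theorem measurePreserving_shear {n : ℕ} (c : ℝ) (z w : Fin n → ℝ) :
    MeasurePreserving (fun p : ℝ × (Fin n → ℝ) => (c + p.1, p.2 + (z + p.1 • w)))
      volume volume := by
  refine (measurePreserving_add_left volume c).skew_product
    (g := fun (s : ℝ) (x : Fin n → ℝ) => x + (z + s • w)) ?_ ?_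
  · unfold Function.uncurry; fun_prop
  · exact ae_of_all _ fun s => (measurePreserving_add_right volume (z + s • w)).map_eq

theorem lintegral_le_lintegral_mul_exp {V : Type*} [MeasureSpace V] {g : V → ℝ} {ℓ : V → ℝ}
    (hgi : Integrable g) (g0 : 0 ≤ g) (hm : Integrable fun v => ℓ v * g v)
    (hz : ∫ v, ℓ v * g v = 0) :
    ENNReal.ofReal (∫ v, g v) ≤ ∫⁻ v, ENNReal.ofReal (g v * exp (ℓ v)) := by
  have h1 : ∫ v, g v = ∫ v, (g v + ℓ v * g v) := by
    rw [integral_add hgi hm, hz, add_zero]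
  have h2 : Integrable fun v => max (g v + ℓ v * g v) 0 := (hgi.add hm).pos_part
  calc ENNReal.ofReal (∫ v, g v) ≤ ENNReal.ofReal (∫ v, max (g v + ℓ v * g v) 0) := by
        rw [h1]
        exact ENNReal.ofReal_le_ofReal
          (integral_mono (hgi.add hm) h2 fun v => le_max_left _ _)
    _ = ∫⁻ v, ENNReal.ofReal (max (g v + ℓ v * g v) 0) :=
        ofReal_integral_eq_lintegral_ofReal h2 (ae_of_all _ fun v => le_max_right _ _)
    _ ≤ _ := by
        refine lintegral_mono fun v => ENNReal.ofReal_le_ofReal (max_le ?_ ?_)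
        · nlinarith [Real.add_one_le_exp (ℓ v), g0 v, show (0 : ℝ) ≤ g v from g0 v]
        · exact mul_nonneg (g0 v) (exp_pos _).le

theorem santalo_prod {n : ℕ} (ih : SantaloHolds n) {K : ℝ} (hK : 0 ≤ K)
    {f g : ℝ × (Fin n → ℝ) → ℝ} (hf : Measurable f) (hg : Measurable g) (f0 : 0 ≤ f) (g0 : 0 ≤ g)
    (hfi : Integrable f) (hf1 : Integrable fun p => p.1 * f p)
    (hfm : ∀ i, Integrable (fun p => p.2 i * f p)) (hpos : 0 < ∫ p, f p)
    (hgi : Integrable g) (hg1 : Integrable fun p => p.1 * g p)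
    (hgm : ∀ i, Integrable (fun p => p.2 i * g p)) (hg1z : ∫ p, p.1 * g p = 0)
    (hgmz : ∀ i, ∫ p, p.2 i * g p = 0)
    (H : ∀ p q, f p * g q ≤ K * exp (-(p.1 * q.1 + p.2 ⬝ᵥ q.2))) :
    ENNReal.ofReal (∫ p, f p) * ENNReal.ofReal (∫ p, g p)
      ≤ ENNReal.ofReal (K * (2 * π) ^ (n + 1)) := by
  set m := ∫ p, f p with hm
  obtain ⟨c, hc⟩ := exists_median (h := fun x => ∫ y, f (x, y)) hfi.integral_prod_left
    fun x => integral_nonneg fun y => f0 _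
  have hAp : ∫ p in {p | p.1 ∈ Set.Ioi c}, f p = m / 2 := by
    rw [hm, Measure.volume_eq_prod, integral_prod _ hfi, ← hc, ← Measure.volume_eq_prod,
      restrict_fst_mem_eq, integral_prod]
    rw [← restrict_fst_mem_eq]; exact hfi.integrableOn
  have hAm : ∫ p in {p | p.1 ∈ Set.Iio c}, f p = m / 2 := by
    have := integral_eq_fst_Ioi_add_fst_Iio hfi c
    rw [hAp] at this; linarith
  set Bp : Fin n → ℝ := fun i => ∫ p in {p | p.1 ∈ Set.Ioi c}, p.2 i * f p with hBp
  set Bm : Fin n → ℝ := fun i => ∫ p in {p | p.1 ∈ Set.Iio c}, p.2 i * f p with hBm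
  set Pp : ℝ := ∫ p in {p | p.1 ∈ Set.Ioi c}, (p.1 - c) * f p with hPp
  set Pm : ℝ := ∫ p in {p | p.1 ∈ Set.Iio c}, (p.1 - c) * f p with hPm
  have hfc : Integrable fun p => (p.1 - c) * f p := by
    simp only [sub_mul]; exact hf1.sub (hfi.const_mul c)
  have hPp0 : 0 < Pp := by
    have h1 : 0 < ∫ p in {p | p.1 ∈ Set.Ioi c}, f p := by rw [hAp]; linarith
    have hms : MeasurableSet {p : ℝ × (Fin n → ℝ) | p.1 ∈ Set.Ioi c} :=
      measurable_fst measurableSet_Ioi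
    rw [setIntegral_pos_iff_support_of_nonneg_ae (ae_of_all _ f0) hfi.integrableOn] at h1
    rw [hPp, setIntegral_pos_iff_support_of_nonneg_ae _ hfc.integrableOn]
    · refine h1.trans_le (measure_mono ?_)
      rintro p ⟨hp, hpc⟩
      exact ⟨mul_ne_zero (sub_pos.2 hpc).ne' hp, hpc⟩
    · exact (ae_restrict_iff' hms).2 (ae_of_all _ fun p hp =>
        mul_nonneg (sub_nonneg.2 (le_of_lt hp)) (f0 p))
  have hPm0 : Pm ≤ 0 := by
    have hms : MeasurableSet {p : ℝ × (Fin n → ℝ) | p.1 ∈ Set.Iio c} :=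
      measurable_fst measurableSet_Iio
    refine setIntegral_nonpos hms fun p hp => ?_
    exact mul_nonpos_of_nonpos_of_nonneg (sub_nonpos.2 (le_of_lt hp)) (f0 p)
  set w : Fin n → ℝ := fun i => (Bp i - Bm i) / (Pp - Pm) with hw
  set z : Fin n → ℝ := fun i => (Bp i - Pp * w i) / (m / 2) with hz
  have hzp : ∀ i, Bp i - m / 2 * z i - Pp * w i = 0 := fun i => by
    simp only [hz]; field_simp; ring
  have hzm : ∀ i, Bm i - m / 2 * z i - Pm * w i = 0 := fun i => by
    have h1 := hzp i
    have h2 : (Pp - Pm) * w i = Bp i - Bm i := by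
      simp only [hw]; rw [mul_div_cancel₀]; linarith
    linarith
  set Φ : ℝ × (Fin n → ℝ) → ℝ × (Fin n → ℝ) := fun p => (c + p.1, p.2 + (z + p.1 • w)) with hΦ
  have hΦm : MeasurePreserving Φ volume volume := measurePreserving_shear c z w
  have hΦr : ∀ s t : Set ℝ, MeasurableSet t → (∀ x, x ∈ s ↔ c + x ∈ t) →
      ∀ h : ℝ × (Fin n → ℝ) → ℝ, Measurable h →
      ∫ p in {p | p.1 ∈ s}, h (Φ p) = ∫ p in {p | p.1 ∈ t}, h p := by
    intro s t ht hst h hh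
    have hp : MeasurePreserving Φ (volume.restrict {p | p.1 ∈ s})
        (volume.restrict {p | p.1 ∈ t}) := by
      have : {p : ℝ × (Fin n → ℝ) | p.1 ∈ s} = Φ ⁻¹' {p | p.1 ∈ t} := by
        ext p; exact hst p.1
      rw [this]
      exact hΦm.restrict_preimage (measurable_fst ht)
    rw [← hp.map_eq, integral_map hp.measurable.aemeasurable hh.aestronglyMeasurable]
  have hIoi := hΦr (Set.Ioi 0) (Set.Ioi c) measurableSet_Ioi (fun x => by simp)
  have hIio := hΦr (Set.Iio 0) (Set.Iio c) measurableSet_Iio (fun x => by simp)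
  set k : Fin n → ℝ × (Fin n → ℝ) → ℝ :=
    fun i p => p.2 i * f p - z i * f p - w i * ((p.1 - c) * f p) with hk
  have hkm : ∀ i, Measurable (k i) := fun i => by simp only [hk]; fun_prop
  have hki : ∀ i, Integrable (k i) := fun i =>
    ((hfm i).sub (hfi.const_mul _)).sub (hfc.const_mul _)
  have hkΦ : ∀ i p, p.2 i * f (Φ p) = k i (Φ p) := fun i p => by
    simp only [hk, hΦ, Pi.add_apply, Pi.smul_apply, smul_eq_mul]; ring
  have hkint : ∀ i (s : Set (ℝ × (Fin n → ℝ))), ∫ p in s, k i p =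
      (∫ p in s, p.2 i * f p) - z i * (∫ p in s, f p) - w i * ∫ p in s, (p.1 - c) * f p := by
    intro i s
    rw [← integral_const_mul, ← integral_const_mul, ← integral_sub, ← integral_sub]
    · exact ((hfm i).sub (hfi.const_mul _)).integrableOn
    · exact (hfc.const_mul _).integrableOn
    · exact (hfm i).integrableOn
    · exact (hfi.const_mul _).integrableOn
  have main := santalo_of_balanced ih hK (f := f ∘ Φ)
    (g := fun p => ENNReal.ofReal (g (p.1 - w ⬝ᵥ p.2, p.2) *
      exp (c * (p.1 - w ⬝ᵥ p.2) + z ⬝ᵥ p.2)))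
    (hf.comp hΦm.measurable) (by unfold dotProduct; fun_prop) (fun p => f0 (Φ p))
    ((hΦm.integrable_comp hf.aestronglyMeasurable).2 hfi)
    (fun i => by
      simp only [Function.comp_apply, hkΦ]
      exact (hΦm.integrable_comp (hki i).1).2 (hki i))
    (m := m)
    ((hIoi f hf).trans hAp) ((hIio f hf).trans hAm)
    (fun i => by
      simp only [Function.comp_apply, hkΦ]
      rw [hIoi _ (hkm i), hkint, hAp, ← hzp i]; ring)
    (fun i => by
      simp only [Function.comp_apply, hkΦ]
      rw [hIio _ (hkm i), hkint, hAm, ← hzm i]; ring)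
    (fun s x t y => by
      simp only [Function.comp_apply]
      rw [← ENNReal.ofReal_mul (f0 _)]
      refine ENNReal.ofReal_le_ofReal ?_
      have := H (Φ (s, x)) (t - w ⬝ᵥ y, y)
      rw [← mul_assoc]
      calc _ ≤ K * exp (-((Φ (s, x)).1 * (t - w ⬝ᵥ y) + (Φ (s, x)).2 ⬝ᵥ y)) *
            exp (c * (t - w ⬝ᵥ y) + z ⬝ᵥ y) := by gcongr
        _ = _ := by
          rw [mul_assoc, ← Real.exp_add]
          congr 2
          simp only [hΦ, add_dotProduct, smul_dotProduct, smul_eq_mul]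
          ring)
  refine le_trans ?_ main
  gcongr
  have hlin : Integrable fun p : ℝ × (Fin n → ℝ) => (c * p.1 + z ⬝ᵥ p.2) * g p := by
    simp only [add_mul, dotProduct, Finset.sum_mul, mul_assoc]
    exact (hg1.const_mul c).add (integrable_finsetSum _ fun i _ => (hgm i).const_mul _)
  have hlz : ∫ p : ℝ × (Fin n → ℝ), (c * p.1 + z ⬝ᵥ p.2) * g p = 0 := by
    simp only [add_mul, dotProduct, Finset.sum_mul, mul_assoc]
    rw [integral_add (hg1.const_mul c) (integrable_finsetSum _ fun i _ => (hgm i).const_mul _),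
      integral_finsetSum _ fun i _ => (hgm i).const_mul _]
    simp [integral_const_mul, hg1z, hgmz]
  refine (lintegral_le_lintegral_mul_exp hgi g0 hlin hlz).trans_eq ?_
  rw [Measure.volume_eq_prod, lintegral_prod_symm, lintegral_prod_symm]
  · refine lintegral_congr fun y => ?_
    exact (lintegral_sub_right_eq_self
      (fun t => ENNReal.ofReal (g (t, y) * exp (c * t + z ⬝ᵥ y))) (w ⬝ᵥ y)).symm
  · unfold dotProduct; fun_prop
  · unfold dotProduct; fun_prop


theorem integrable_of_bounded_of_support_closedBall {V : Type*} [NormedAddCommGroup V]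
    [ProperSpace V] [MeasureSpace V] [BorelSpace V] [IsFiniteMeasureOnCompacts (volume : Measure V)]
    {h : V → ℝ} (hh : Measurable h) {k C : ℝ}
    (hb : ∀ v, ‖v‖ ≤ k → ‖h v‖ ≤ C) (hs : ∀ v, ¬ ‖v‖ ≤ k → h v = 0) : Integrable h := by
  have hsup : Function.support h ⊆ Metric.closedBall 0 k := fun v hv => by
    by_contra h1
    exact hv (hs v (by simpa using h1))
  rw [← integrableOn_iff_integrable_of_support_subset hsup]
  exact Measure.integrableOn_of_bounded (isCompact_closedBall 0 k).measure_lt_top.ne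
    hh.aestronglyMeasurable ((ae_restrict_iff' Metric.isClosed_closedBall.measurableSet).2
      (ae_of_all _ fun v hv => hb v (by simpa using hv)))

theorem santalo_prod_lintegral {n : ℕ} (ih : SantaloHolds n) {K : ℝ} (hK : 0 ≤ K)
    {f : ℝ × (Fin n → ℝ) → ℝ≥0∞} {g : ℝ × (Fin n → ℝ) → ℝ} (hf : Measurable f)
    (hg : Measurable g) (g0 : 0 ≤ g)
    (hgi : Integrable g) (hg1 : Integrable fun p => p.1 * g p)
    (hgm : ∀ i, Integrable (fun p => p.2 i * g p)) (hg1z : ∫ p, p.1 * g p = 0)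
    (hgmz : ∀ i, ∫ p, p.2 i * g p = 0)
    (H : ∀ p q, f p * ENNReal.ofReal (g q) ≤
      ENNReal.ofReal (K * exp (-(p.1 * q.1 + p.2 ⬝ᵥ q.2)))) :
    (∫⁻ p, f p) * ENNReal.ofReal (∫ p, g p) ≤ ENNReal.ofReal (K * (2 * π) ^ (n + 1)) := by
  classical
  set F : ℕ → ℝ × (Fin n → ℝ) → ℝ≥0∞ :=
    fun k => (Metric.closedBall 0 (k : ℝ)).indicator (fun p => min (f p) k) with hF
  have hFm : ∀ k, Measurable (F k) := fun k =>
    (by fun_prop : Measurable fun p => min (f p) (k : ℝ≥0∞)).indicator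
      Metric.isClosed_closedBall.measurableSet
  have hFk : ∀ k p, F k p ≤ k := fun k p => by
    simp only [hF, Set.indicator_apply]; split_ifs
    · exact min_le_right _ _
    · exact zero_le
  have hFf : ∀ k p, F k p ≤ f p := fun k p => by
    simp only [hF, Set.indicator_apply]; split_ifs
    · exact min_le_left _ _
    · exact zero_le
  have hFt : ∀ k p, F k p ≠ ⊤ := fun k p => ((hFk k p).trans_lt (ENNReal.natCast_lt_top k)).ne
  have hmono : Monotone F := by
    intro k l hkl p
    have hkl' : (k : ℝ) ≤ l := by exact_mod_cast hkl
    simp only [hF, Set.indicator_apply]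
    split_ifs with h1 h2
    · exact min_le_min_left _ (by exact_mod_cast hkl)
    · exact absurd (Metric.closedBall_subset_closedBall hkl' h1) h2
    · exact zero_le
    · exact le_rfl
  have hsup : ∀ p, ⨆ k, F k p = f p := by
    intro p
    refine le_antisymm (iSup_le fun k => hFf k p) ?_
    obtain ⟨N, hN⟩ := exists_nat_ge ‖p‖
    calc f p = ⨆ k : ℕ, min (f p) k := by
          rw [← inf_iSup_eq, ENNReal.iSup_natCast, inf_top_eq]
      _ ≤ _ := iSup_le fun k => by
          refine le_iSup_of_le (max k N) ?_
          simp only [hF, Set.indicator_apply]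
          rw [if_pos]
          · exact min_le_min_left _ (by exact_mod_cast le_max_left k N)
          · rw [mem_closedBall_zero_iff]
            exact hN.trans (by exact_mod_cast le_max_right k N)
  have hlim : ∫⁻ p, f p = ⨆ k, ∫⁻ p, F k p := by
    rw [← lintegral_iSup hFm hmono]
    simp only [hsup]
  rw [hlim, ENNReal.iSup_mul]
  refine iSup_le fun k => ?_
  set φ : ℝ × (Fin n → ℝ) → ℝ := fun p => (F k p).toReal with hφ
  have hφm : Measurable φ := (hFm k).ennreal_toReal
  have hφ0 : 0 ≤ φ := fun p => ENNReal.toReal_nonneg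
  have hφk : ∀ p, φ p ≤ k := fun p =>
    ENNReal.toReal_le_of_le_ofReal (by positivity) (by simpa using hFk k p)
  have hφs : ∀ p, ¬ ‖p‖ ≤ k → φ p = 0 := fun p hp => by
    simp only [hφ, hF, Set.indicator_apply, mem_closedBall_zero_iff, if_neg hp]; simp
  have hφi : Integrable φ := integrable_of_bounded_of_support_closedBall hφm (k := k) (C := k)
    (fun p _ => by rw [Real.norm_of_nonneg (hφ0 p)]; exact hφk p) hφs
  have hmom : ∀ ℓ : ℝ × (Fin n → ℝ) → ℝ, Measurable ℓ → (∀ p, |ℓ p| ≤ ‖p‖) →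
      Integrable fun p => ℓ p * φ p := fun ℓ hℓ hℓp =>
    integrable_of_bounded_of_support_closedBall (hℓ.mul hφm) (k := k) (C := k * k)
      (fun p hp => by
        rw [norm_mul, Real.norm_of_nonneg (hφ0 p), Real.norm_eq_abs]
        exact mul_le_mul ((hℓp p).trans hp) (hφk p) (hφ0 p) (by positivity))
      (fun p hp => by simp [hφs p hp])
  have hFφ : ∫⁻ p, F k p = ENNReal.ofReal (∫ p, φ p) := by
    rw [ofReal_integral_eq_lintegral_ofReal hφi (ae_of_all _ hφ0)]
    simp only [hφ, ENNReal.ofReal_toReal (hFt k _)]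
  rw [hFφ]
  by_cases hpos : 0 < ∫ p, φ p
  · refine santalo_prod ih hK hφm hg hφ0 g0 hφi
      (hmom (fun p => p.1) (by fun_prop) fun p => norm_fst_le p)
      (fun i => hmom (fun p => p.2 i) (by fun_prop) fun p =>
        (norm_le_pi_norm p.2 i).trans (norm_snd_le p))
      hpos hgi hg1 hgm hg1z hgmz fun p q => ?_
    have := (mul_le_mul' (hFf k p) le_rfl).trans (H p q)
    rw [← ENNReal.ofReal_toReal (hFt k p), ← ENNReal.ofReal_mul (hφ0 p)] at this
    exact (ENNReal.ofReal_le_ofReal_iff (by positivity)).1 this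
  · rw [ENNReal.ofReal_of_nonpos (not_lt.1 hpos)]
    simp

/-- The functional Blaschke–Santaló inequality. -/
theorem santaloHolds (n : ℕ) : SantaloHolds n := by
  induction n with
  | zero =>
    intro K f g hK hf hg g0 hgi _ _ H
    have hv : (volume : Measure (Fin 0 → ℝ)) Set.univ = 1 := by
      simp [volume_pi]
    have := H (@default _ Unique.instInhabited) (@default _ Unique.instInhabited)
    rw [Matrix.dotProduct_of_isEmpty, neg_zero, Real.exp_zero] at this
    rw [lintegral_unique, lintegral_unique, hv, pow_zero, mul_one, mul_one]
    exact this
  | succ n ih =>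
    intro K f g hK hf hg g0 hgi hgm hgz H
    set e := MeasurableEquiv.piFinSuccAbove (fun _ : Fin (n + 1) => ℝ) 0 with he
    have hem : MeasurePreserving e.symm volume volume :=
      (volume_preserving_piFinSuccAbove (fun _ : Fin (n + 1) => ℝ) 0).symm e
    have hes : ∀ p, e.symm p = Fin.cons p.1 p.2 := fun p => by
      simp [he, MeasurableEquiv.piFinSuccAbove, Fin.insertNthEquiv]
    have hi : ∀ h : (Fin (n + 1) → ℝ) → ℝ, ∫ p, h (e.symm p) = ∫ x, h x := hem.integral_comp'
    have hInt : ∀ {h : (Fin (n + 1) → ℝ) → ℝ}, Integrable h → Integrable fun p => h (e.symm p) :=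
      fun hh => (hem.integrable_comp hh.1).2 hh
    have key := santalo_prod_lintegral ih hK (f := fun p => f (e.symm p))
      (g := fun p => g (e.symm p)) (hf.comp e.symm.measurable) (hg.comp e.symm.measurable)
      (fun p => g0 (e.symm p)) (hInt hgi)
      (by simpa [hes] using hInt (hgm 0))
      (fun i => by simpa [hes] using hInt (hgm i.succ))
      (by simpa [hes] using (hi fun x => x 0 * g x).trans (hgz 0))
      (fun i => by simpa [hes] using (hi fun x => x i.succ * g x).trans (hgz i.succ))
      (fun p q => by
        have := H (e.symm p) (e.symm q)
        have hd : e.symm p ⬝ᵥ e.symm q = p.1 * q.1 + p.2 ⬝ᵥ q.2 := by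
          simp [hes, dotProduct, Fin.sum_univ_succ]
        rwa [hd] at this)
    rwa [hi g, hem.lintegral_comp hf,
      ofReal_integral_eq_lintegral_ofReal hgi (ae_of_all _ g0)] at key

theorem charFun_eq_of_norm_eq {E : Type*} [NormedAddCommGroup E] [InnerProductSpace ℝ E]
    [FiniteDimensional ℝ E] [MeasurableSpace E] [BorelSpace E] {μ : Measure E}
    (hμ : ∀ φ : E ≃ₗᵢ[ℝ] E, μ.map φ = μ) {s t : E} (hst : ‖s‖ = ‖t‖) :
    charFun μ s = charFun μ t := by
  set φ : E ≃ₗᵢ[ℝ] E := (Submodule.span ℝ {s - t})ᗮ.reflection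
  have hφ : φ s = t := Submodule.reflection_sub hst
  rw [charFun_apply, charFun_apply]
  conv_rhs => rw [← hμ φ]
  rw [integral_map φ.continuous.aemeasurable (by fun_prop)]
  refine integral_congr_ae (ae_of_all _ fun x => ?_)
  simp only
  rw [← hφ, φ.inner_map_map]

theorem integral_charFun_smul_comm {E : Type*} [NormedAddCommGroup E] [InnerProductSpace ℝ E]
    [FiniteDimensional ℝ E] [MeasurableSpace E] [BorelSpace E] (μ ν : Measure E)
    [IsFiniteMeasure μ] [IsFiniteMeasure ν] (R : ℝ) :
    ∫ y, charFun μ (R • y) ∂ν = ∫ x, charFun ν (R • x) ∂μ := by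
  simp only [charFun_apply]
  rw [integral_integral_swap]
  · simp only [inner_smul_right, real_inner_comm]
  · refine Integrable.mono' (integrable_const (1:ℝ)) ?_ (ae_of_all _ fun p => ?_)
    · apply Continuous.aestronglyMeasurable
      unfold Function.uncurry
      fun_prop
    · simp only [Function.uncurry]
      rw [Complex.norm_exp_ofReal_mul_I]

/-- Rotation invariant finite measures on the unit sphere are unique up to scaling. -/
theorem measure_smul_eq_of_rotation_invariant {E : Type*} [NormedAddCommGroup E]
    [InnerProductSpace ℝ E] [FiniteDimensional ℝ E] [MeasurableSpace E] [BorelSpace E]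
    (μ ν : Measure E) [IsFiniteMeasure μ] [IsFiniteMeasure ν]
    (hμS : ∀ᵐ x ∂μ, ‖x‖ = 1) (hνS : ∀ᵐ x ∂ν, ‖x‖ = 1)
    (hμ : ∀ φ : E ≃ₗᵢ[ℝ] E, μ.map φ = μ) (hν : ∀ φ : E ≃ₗᵢ[ℝ] E, ν.map φ = ν) :
    ν Set.univ • μ = μ Set.univ • ν := by
  have key : ∀ (μ ν : Measure E) [IsFiniteMeasure μ] [IsFiniteMeasure ν],
      (∀ᵐ x ∂ν, ‖x‖ = 1) → (∀ φ : E ≃ₗᵢ[ℝ] E, μ.map φ = μ) → ∀ t : E,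
      ∫ y, charFun μ (‖t‖ • y) ∂ν = (ν Set.univ).toReal • charFun μ t := by
    intro μ ν _ _ hνS hμ t
    rw [integral_congr_ae (g := fun _ => charFun μ t), integral_const]
    · rfl
    · filter_upwards [hνS] with y hy
      exact charFun_eq_of_norm_eq hμ (by rw [norm_smul, hy]; simp)
  have e1 : ν Set.univ • μ = (ν Set.univ).toNNReal • μ := by
    rw [ENNReal.smul_def, ENNReal.coe_toNNReal (measure_ne_top _ _)]
  have e2 : μ Set.univ • ν = (μ Set.univ).toNNReal • ν := by
    rw [ENNReal.smul_def, ENNReal.coe_toNNReal (measure_ne_top _ _)]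
  rw [e1, e2]
  refine Measure.ext_of_charFun (funext fun t => ?_)
  have h := integral_charFun_smul_comm μ ν ‖t‖
  rw [key μ ν hνS hμ t, key ν μ hμS hν t] at h
  rw [charFun_apply, charFun_apply, integral_smul_nnreal_measure, integral_smul_nnreal_measure]
  exact h

/-- The spherical measure of the unit sphere of `E`, as a measure on `E`. -/
def sphereVol (E : Type*) [NormedAddCommGroup E] [InnerProductSpace ℝ E]
    [FiniteDimensional ℝ E] [MeasurableSpace E] [BorelSpace E] : Measure E :=
  (volume : Measure E).toSphere.map (↑)

section sphereVol
variable {E : Type*} [NormedAddCommGroup E] [InnerProductSpace ℝ E]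
    [FiniteDimensional ℝ E] [MeasurableSpace E] [BorelSpace E]

instance : IsFiniteMeasure (sphereVol E) := by
  unfold sphereVol; infer_instance

theorem ae_norm_sphereVol : ∀ᵐ x ∂(sphereVol E), ‖x‖ = 1 := by
  rw [sphereVol, ae_map_iff measurable_subtype_coe.aemeasurable
    (measurableSet_eq_fun measurable_norm measurable_const)]
  exact ae_of_all _ fun x => by simp

open scoped Pointwise in
theorem sphereVol_apply {s : Set E} (hs : MeasurableSet s) :
    sphereVol E s = Module.finrank ℝ E *
      volume {x : E | x ≠ 0 ∧ ‖x‖ < 1 ∧ ‖x‖⁻¹ • x ∈ s} := by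
  rw [sphereVol, Measure.map_apply measurable_subtype_coe hs,
    Measure.toSphere_apply' _ (measurable_subtype_coe hs)]
  congr 2
  ext x
  simp only [Set.mem_smul, Set.mem_image, Set.mem_preimage, Set.mem_ofPred_eq]
  constructor
  · rintro ⟨r, ⟨h0, h1⟩, _, ⟨u, hu, rfl⟩, rfl⟩
    have hn : ‖(u:E)‖ = 1 := by simp
    have hn' : ‖r • (u:E)‖ = r := by rw [norm_smul, hn, mul_one, Real.norm_of_nonneg h0.le]
    refine ⟨fun h => ?_, by rw [hn']; exact h1, ?_⟩
    · rw [h, norm_zero] at hn'; exact h0.ne hn'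
    · rw [hn', smul_smul, inv_mul_cancel₀ h0.ne', one_smul]; exact hu
  · rintro ⟨h0, h1, h2⟩
    have hn := norm_pos_iff.2 h0
    refine ⟨‖x‖, ⟨hn, h1⟩, ‖x‖⁻¹ • x, ⟨⟨‖x‖⁻¹ • x, ?_⟩, h2, rfl⟩, ?_⟩
    · simp [norm_smul, hn.ne']
    · rw [smul_smul, mul_inv_cancel₀ hn.ne', one_smul]

theorem sphereVol_map (φ : E ≃ₗᵢ[ℝ] E) : (sphereVol E).map φ = sphereVol E := by
  ext s hs
  have hm : MeasurableSet (φ ⁻¹' s) := φ.continuous.measurable hs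
  rw [Measure.map_apply φ.continuous.measurable hs, sphereVol_apply hs, sphereVol_apply hm]
  congr 1
  have hN : {x : E | x ≠ 0 ∧ ‖x‖ < 1 ∧ ‖x‖⁻¹ • x ∈ φ ⁻¹' s}
      = φ ⁻¹' {x : E | x ≠ 0 ∧ ‖x‖ < 1 ∧ ‖x‖⁻¹ • x ∈ s} := by
    ext x
    simp only [Set.mem_ofPred_eq, Set.mem_preimage, φ.norm_map, map_smul, ne_eq,
      EmbeddingLike.map_eq_zero_iff]
  rw [hN]
  exact φ.measurePreserving.measure_preimage_equiv (f := φ.toMeasurableEquiv) _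

theorem sphereVol_univ_pos [Nontrivial E] : sphereVol E Set.univ ≠ 0 := by
  rw [sphereVol, Measure.map_apply measurable_subtype_coe MeasurableSet.univ]
  simp [Measure.toSphere_apply_univ, Module.finrank_pos.ne', IsOpen.measure_ne_zero]

/-- Any rotation invariant finite measure on the unit sphere is a multiple of `sphereVol`. -/
theorem eq_smul_sphereVol [Nontrivial E] (μ : Measure E) [IsFiniteMeasure μ]
    (hμS : ∀ᵐ x ∂μ, ‖x‖ = 1) (hμ : ∀ φ : E ≃ₗᵢ[ℝ] E, μ.map φ = μ) :
    μ = (μ Set.univ / sphereVol E Set.univ) • sphereVol E := by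
  have h := measure_smul_eq_of_rotation_invariant μ (sphereVol E) hμS ae_norm_sphereVol hμ
    sphereVol_map
  rw [div_eq_mul_inv, mul_comm, mul_smul, ← h, smul_smul,
    ENNReal.inv_mul_cancel sphereVol_univ_pos (measure_ne_top _ _), one_smul]

end sphereVol

theorem map_hausdorff_restrict_sphere {E : Type*} [NormedAddCommGroup E] [InnerProductSpace ℝ E]
    [MeasurableSpace E] [BorelSpace E] (s : ℝ) (φ : E ≃ₗᵢ[ℝ] E) :
    (μH[s].restrict (Metric.sphere (0:E) 1)).map φ = μH[s].restrict (Metric.sphere (0:E) 1) := by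
  have h1 : (μH[s] : Measure E).map φ = μH[s] := φ.toIsometryEquiv.map_hausdorffMeasure s
  conv_rhs => rw [← h1]
  rw [Measure.restrict_map φ.continuous.measurable Metric.isClosed_sphere.measurableSet]
  congr 2
  ext x; simp

theorem ae_norm_hausdorff {E : Type*} [NormedAddCommGroup E] [MeasurableSpace E] [BorelSpace E]
    (s : ℝ) : ∀ᵐ x ∂(μH[s].restrict (Metric.sphere (0:E) 1)), ‖x‖ = 1 := by
  filter_upwards [ae_restrict_mem Metric.isClosed_sphere.measurableSet] with x hx
  simpa using hx

/-- The isometric embedding `v ↦ (0, v)` of `ℝ^n` into `ℝ^{n+1}`. -/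
def consZeroIsometry (n : ℕ) : EuclideanSpace ℝ (Fin n) →ₗᵢ[ℝ] Esp n where
  toFun v := WithLp.toLp 2 (Fin.cons 0 v.ofLp)
  map_add' v w := by
    ext i; refine Fin.cases ?_ (fun j => ?_) i <;> simp
  map_smul' c v := by
    ext i; refine Fin.cases ?_ (fun j => ?_) i <;> simp
  norm_map' v := by
    simp [EuclideanSpace.norm_eq, Fin.sum_univ_succ]

/-- Orthogonal coordinates adapted to a unit vector `e`. -/
theorem exists_frame {n : ℕ} {e : Esp n} (he : ‖e‖ = 1) :
    ∃ ι : EuclideanSpace ℝ (Fin n) →ₗᵢ[ℝ] Esp n, (∀ v, ⟪e, ι v⟫ = 0) ∧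
      (∀ x, ⟪e, x⟫ = 0 → ∃ v, ι v = x) ∧
      MeasurePreserving (fun p : ℝ × EuclideanSpace ℝ (Fin n) => p.1 • e + ι p.2)
        (volume.prod volume) volume := by
  obtain ⟨b, hb⟩ := Orthonormal.exists_orthonormalBasis_extension_of_card_eq (𝕜 := ℝ)
    (E := Esp n) (ι := Fin (n+1)) (by simp) (v := fun _ => e) (s := {0}) (by
      rw [orthonormal_iff_ite]
      rintro ⟨i, hi⟩ ⟨j, hj⟩
      obtain rfl : i = 0 := hi
      obtain rfl : j = 0 := hj
      simp [he])
  have hb0 : b 0 = e := hb 0 rfl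
  have hre : b.repr e = EuclideanSpace.single 0 1 := by rw [← hb0, b.repr_self]
  have hform : ∀ p : ℝ × EuclideanSpace ℝ (Fin n), p.1 • e + b.repr.symm (consZeroIsometry n p.2)
      = b.repr.symm (WithLp.toLp 2 (Fin.cons p.1 p.2.ofLp)) := by
    intro p
    apply b.repr.injective
    rw [map_add, map_smul, hre, LinearIsometryEquiv.apply_symm_apply,
      LinearIsometryEquiv.apply_symm_apply]
    ext i; refine Fin.cases ?_ (fun j => ?_) i <;> simp [consZeroIsometry]
  refine ⟨b.repr.symm.toLinearIsometry.comp (consZeroIsometry n), fun v => ?_, fun x hx => ?_, ?_⟩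
  · rw [← b.repr.inner_map_map, hre]
    simp [consZeroIsometry, EuclideanSpace.inner_single_left]
  · refine ⟨WithLp.toLp 2 (fun j => b.repr x j.succ), ?_⟩
    apply b.repr.injective
    rw [← b.repr.inner_map_map, hre] at hx
    simp only [EuclideanSpace.inner_single_left] at hx
    ext i; refine Fin.cases ?_ (fun j => ?_) i
    · simpa [consZeroIsometry] using hx.symm
    · simp [consZeroIsometry]
  · have h1 := (volume_preserving_piFinSuccAbove (fun _ : Fin (n+1) => ℝ) 0).symm
    have h2 : MeasurePreserving (Prod.map id (WithLp.ofLp : EuclideanSpace ℝ (Fin n) → (Fin n → ℝ)))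
        ((volume : Measure ℝ).prod volume) ((volume : Measure ℝ).prod volume) :=
      (MeasurePreserving.id _).prod (PiLp.volume_preserving_ofLp (Fin n))
    have h3 := (b.measurePreserving_repr_symm.comp (PiLp.volume_preserving_toLp (Fin (n+1)))).comp
      (h1.comp h2)
    convert h3 using 1
    ext1 p
    refine (hform p).trans ?_
    simp [MeasurableEquiv.piFinSuccAbove, Fin.insertNthEquiv]

theorem dist_normalize_le {E : Type*} [NormedAddCommGroup E] [NormedSpace ℝ E] {x y : E}
    (hx : 1 ≤ ‖x‖) (hy : 1 ≤ ‖y‖) : ‖‖x‖⁻¹ • x - ‖y‖⁻¹ • y‖ ≤ 2 * ‖x - y‖ := by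
  have hx0 : 0 < ‖x‖ := by linarith
  have hy0 : 0 < ‖y‖ := by linarith
  have e : ‖x‖⁻¹ • x - ‖y‖⁻¹ • y = ‖x‖⁻¹ • ((x - y) + (‖y‖ - ‖x‖) • (‖y‖⁻¹ • y)) := by
    rw [smul_add, smul_sub, sub_smul, smul_sub, smul_smul, smul_smul, smul_smul ‖x‖⁻¹ ‖x‖,
      mul_assoc, mul_inv_cancel₀ hy0.ne', inv_mul_cancel₀ hx0.ne', one_smul, mul_one]
    abel
  have h1 : ‖‖y‖⁻¹ • y‖ = 1 := by simp [norm_smul, hy0.ne']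
  rw [e, norm_smul, norm_inv, norm_norm]
  have h2 : ‖(x - y) + (‖y‖ - ‖x‖) • (‖y‖⁻¹ • y)‖ ≤ 2 * ‖x - y‖ := by
    refine (norm_add_le _ _).trans ?_
    rw [norm_smul, h1, mul_one, Real.norm_eq_abs]
    have := abs_norm_sub_norm_le y x
    rw [norm_sub_rev] at this
    linarith
  calc ‖x‖⁻¹ * _ ≤ 1 * (2 * ‖x - y‖) := by
        gcongr
        exact inv_le_one_of_one_le₀ hx
    _ = _ := one_mul _

/-- The `n`-dimensional Hausdorff measure of the unit sphere of `ℝ^{n+1}` is finite. -/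
theorem hausdorffMeasure_sphere_lt_top (n : ℕ) : μH[(n:ℝ)] (Metric.sphere (0 : Esp n) 1) < ∞ := by
  refine (isCompact_sphere (0 : Esp n) 1).measure_lt_top_of_nhdsWithin fun e he => ?_
  have he1 : ‖e‖ = 1 := by simpa using he
  obtain ⟨ι, h1, h2, -⟩ := exists_frame he1
  have hnorm : ∀ w, 1 ≤ ‖e + ι w‖ := fun w => by
    have := norm_add_sq_real e (ι w)
    rw [h1, he1] at this
    nlinarith [norm_nonneg (e + ι w), sq_nonneg ‖ι w‖]
  refine ⟨{x | 1/2 < ⟪e, x⟫} ∩ Metric.sphere 0 1, ?_, ?_⟩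
  · refine Filter.inter_mem ?_ self_mem_nhdsWithin
    refine mem_nhdsWithin_of_mem_nhds ((isOpen_lt (by fun_prop) (by fun_prop)).mem_nhds ?_)
    simp [he1]; norm_num
  · set g : EuclideanSpace ℝ (Fin n) → Esp n := fun w => ‖e + ι w‖⁻¹ • (e + ι w) with hg
    have hL : LipschitzOnWith 2 g (Metric.closedBall 0 2) := by
      refine LipschitzOnWith.of_dist_le_mul fun x _ y _ => ?_
      rw [dist_eq_norm, dist_eq_norm]
      refine (dist_normalize_le (hnorm x) (hnorm y)).trans_eq ?_
      rw [add_sub_add_left_eq_sub, ← map_sub, ι.norm_map]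
      rfl
    have hsub : {x | 1/2 < ⟪e, x⟫} ∩ Metric.sphere 0 1 ⊆ g '' Metric.closedBall 0 2 := by
      rintro x ⟨hx, hxS⟩
      have hx1 : ‖x‖ = 1 := by simpa using hxS
      simp only [Set.mem_ofPred_eq] at hx
      have hx0 : 0 < ⟪e, x⟫ := by linarith
      obtain ⟨v, hv⟩ := h2 (⟪e, x⟫⁻¹ • x - e) (by
        rw [inner_sub_right, inner_smul_right, real_inner_self_eq_norm_sq, he1,
          inv_mul_cancel₀ hx0.ne']; norm_num)
      have hev : e + ι v = ⟪e, x⟫⁻¹ • x := by rw [hv]; abel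
      have hn : ‖e + ι v‖ = ⟪e, x⟫⁻¹ := by
        rw [hev, norm_smul, hx1, mul_one, Real.norm_of_nonneg (by positivity)]
      refine ⟨v, ?_, ?_⟩
      · rw [mem_closedBall_zero_iff]
        have := norm_add_sq_real e (ι v)
        rw [h1, he1, hn, ι.norm_map] at this
        have h3 : ⟪e, x⟫⁻¹ ≤ 2 := by
          rw [inv_le_comm₀ hx0 (by norm_num)]; linarith
        have h4 : 0 < ⟪e, x⟫⁻¹ := by positivity
        nlinarith [norm_nonneg v]
      · simp only [hg]
        rw [hn, hev, inv_inv, smul_smul, mul_inv_cancel₀ hx0.ne', one_smul]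
    refine (measure_mono hsub).trans_lt ((hL.hausdorffMeasure_image_le n.cast_nonneg).trans_lt ?_)
    have h5 : (μH[(n:ℝ)] : Measure (EuclideanSpace ℝ (Fin n))) (Metric.closedBall 0 2) < ∞ := by
      have := (isAddHaarMeasure_hausdorffMeasure (E := EuclideanSpace ℝ (Fin n)))
      rw [finrank_euclideanSpace_fin] at this
      exact (isCompact_closedBall _ _).measure_lt_top
    exact ENNReal.mul_lt_top (ENNReal.rpow_lt_top_of_nonneg n.cast_nonneg (by simp)) h5

theorem lintegral_eq_mul_lintegral_smul {E : Type*} [NormedAddCommGroup E] [InnerProductSpace ℝ E]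
    [FiniteDimensional ℝ E] [MeasurableSpace E] [BorelSpace E] {g : E → ℝ≥0∞} (hg : Measurable g)
    {s : ℝ} (hs : 0 < s) :
    ∫⁻ v, g v = ENNReal.ofReal (s ^ Module.finrank ℝ E) * ∫⁻ w, g (s • w) := by
  have h := Measure.map_addHaar_smul (volume : Measure E) hs.ne'
  rw [← lintegral_map hg (measurable_const_smul s), h, lintegral_smul_measure, smul_eq_mul,
    ← mul_assoc, ← ENNReal.ofReal_mul (by positivity), abs_of_pos (by positivity),
    mul_inv_cancel₀ (by positivity), ENNReal.ofReal_one, one_mul]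

theorem lintegral_frame {n : ℕ} {e : Esp n} {ι : EuclideanSpace ℝ (Fin n) →ₗᵢ[ℝ] Esp n}
    (hmp : MeasurePreserving (fun p : ℝ × EuclideanSpace ℝ (Fin n) => p.1 • e + ι p.2)
        (volume.prod volume) volume) {g : Esp n → ℝ≥0∞} (hg : Measurable g) :
    ∫⁻ x, g x = ∫⁻ s : ℝ, ∫⁻ v, g (s • e + ι v) := by
  rw [← hmp.lintegral_comp hg]
  exact lintegral_prod _ (hg.comp hmp.measurable).aemeasurable

theorem norm_add_frame {n : ℕ} {e : Esp n} (he : ‖e‖ = 1)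
    {ι : EuclideanSpace ℝ (Fin n) →ₗᵢ[ℝ] Esp n} (h1 : ∀ v, ⟪e, ι v⟫ = 0)
    (w : EuclideanSpace ℝ (Fin n)) : ‖e + ι w‖ = √(1 + ‖w‖ ^ 2) := by
  rw [eq_comm, Real.sqrt_eq_iff_mul_self_eq (by positivity) (by positivity)]
  have := norm_add_sq_real e (ι w)
  rw [h1, he, ι.norm_map] at this
  linarith

theorem lintegral_Ioi_pow_lt (n : ℕ) {c : ℝ} (hc : 0 < c) :
    ∫⁻ s in Set.Ioo 0 c, ENNReal.ofReal (s ^ n) = ENNReal.ofReal (c ^ (n + 1) / (n + 1)) := by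
  rw [restrict_Ioo_eq_restrict_Ioc,
    ← ofReal_integral_eq_lintegral_ofReal (intervalIntegral.intervalIntegrable_pow _).1,
    ← intervalIntegral.integral_of_le hc.le]
  · simp
  · filter_upwards [ae_restrict_mem measurableSet_Ioc] with y hy
    exact pow_nonneg hy.1.le _

/-- Gnomonic projection: the spherical measure of a cone in an open half space. -/
theorem sphereVol_cone {n : ℕ} {e : Esp n} (he : ‖e‖ = 1)
    {ι : EuclideanSpace ℝ (Fin n) →ₗᵢ[ℝ] Esp n} (h1 : ∀ v, ⟪e, ι v⟫ = 0)
    (hmp : MeasurePreserving (fun p : ℝ × EuclideanSpace ℝ (Fin n) => p.1 • e + ι p.2)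
        (volume.prod volume) volume) {A : Set (Esp n)} (hA : MeasurableSet A)
    (hcone : ∀ x ∈ A, ∀ t : ℝ, 0 < t → t • x ∈ A) (hpos : ∀ x ∈ A, 0 < ⟪e, x⟫) :
    sphereVol (Esp n) A = ∫⁻ w in {w | e + ι w ∈ A},
      ENNReal.ofReal (√(1 + ‖w‖ ^ 2) ^ (n + 1))⁻¹ := by
  classical
  set g : Esp n → ℝ≥0∞ := (A ∩ Metric.ball 0 1).indicator 1 with hgdef
  have hAb : MeasurableSet (A ∩ Metric.ball 0 1) := hA.inter measurableSet_ball
  have hg : Measurable g := measurable_one.indicator hAb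
  have hL : MeasurableSet {w | e + ι w ∈ A} :=
    (show Measurable fun w => e + ι w from
      (continuous_const.add ι.continuous).measurable) hA
  have hset : {x : Esp n | x ≠ 0 ∧ ‖x‖ < 1 ∧ ‖x‖⁻¹ • x ∈ A} = A ∩ Metric.ball 0 1 := by
    ext x
    simp only [Set.mem_ofPred_eq, Set.mem_inter_iff, mem_ball_zero_iff]
    constructor
    · rintro ⟨h0, h2, h3⟩
      have hn := norm_pos_iff.2 h0
      refine ⟨?_, h2⟩
      have := hcone _ h3 ‖x‖ hn
      rwa [smul_smul, mul_inv_cancel₀ hn.ne', one_smul] at this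
    · rintro ⟨h2, h3⟩
      have h0 : x ≠ 0 := by
        rintro rfl
        simpa using hpos _ h2
      exact ⟨h0, h3, hcone _ h2 _ (inv_pos.2 (norm_pos_iff.2 h0))⟩
  have hinner : ∀ s : ℝ, ∀ v, ⟪e, s • e + ι v⟫ = s := fun s v => by
    rw [inner_add_right, h1, inner_smul_right, real_inner_self_eq_norm_sq, he]; simp
  have hlow : ∀ s : ℝ, s ≤ 0 → ∀ v, g (s • e + ι v) = 0 := fun s hs v => by
    rw [hgdef, Set.indicator_of_notMem]
    rintro ⟨h2, -⟩
    have := hpos _ h2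
    rw [hinner] at this
    linarith
  have hscale : ∀ s : ℝ, 0 < s → ∀ w, g (s • e + ι (s • w)) =
      {w | e + ι w ∈ A}.indicator
        (fun w => (Set.Ioo 0 (√(1 + ‖w‖ ^ 2))⁻¹).indicator (fun _ : ℝ => (1 : ℝ≥0∞)) s) w := by
    intro s hs w
    have hr : 0 < √(1 + ‖w‖ ^ 2) := Real.sqrt_pos.2 (by positivity)
    have heq : s • e + ι (s • w) = s • (e + ι w) := by rw [map_smul, smul_add]
    have hmA : s • (e + ι w) ∈ A ↔ e + ι w ∈ A := by
      refine ⟨fun h => ?_, fun h => hcone _ h s hs⟩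
      have := hcone _ h s⁻¹ (inv_pos.2 hs)
      rwa [smul_smul, inv_mul_cancel₀ hs.ne', one_smul] at this
    have hmb : ‖s • (e + ι w)‖ < 1 ↔ s < (√(1 + ‖w‖ ^ 2))⁻¹ := by
      rw [norm_smul, norm_add_frame he h1, Real.norm_of_nonneg hs.le, lt_inv_comm₀ hs hr,
        ← lt_inv_mul_iff₀ hs, mul_one]
    rw [heq, hgdef]
    simp only [Set.indicator_apply, Set.mem_inter_iff, mem_ball_zero_iff, hmA, hmb,
      Set.mem_ofPred_eq, Set.mem_Ioo, hs, true_and, Pi.one_apply]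
    split_ifs <;> simp_all
  rw [sphereVol_apply hA, hset, ← lintegral_indicator_one hAb, ← hgdef, lintegral_frame hmp hg]
  have hstep : ∫⁻ s : ℝ, ∫⁻ v, g (s • e + ι v) = ∫⁻ s in Set.Ioi (0:ℝ), ∫⁻ w,
      ENNReal.ofReal (s ^ n) * g (s • e + ι (s • w)) := by
    rw [← lintegral_indicator measurableSet_Ioi]
    refine lintegral_congr fun s => ?_
    by_cases hs : 0 < s
    · rw [Set.indicator_of_mem (by exact hs)]
      have hm : Measurable fun v => g (s • e + ι v) :=
        hg.comp (continuous_const.add ι.continuous).measurable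
      rw [lintegral_eq_mul_lintegral_smul hm hs, finrank_euclideanSpace_fin, lintegral_const_mul]
      exact hm.comp (measurable_const_smul s)
    · rw [Set.indicator_of_notMem (by exact hs)]
      simp [hlow s (not_lt.1 hs)]
  have hmeas : Measurable fun p : ℝ × EuclideanSpace ℝ (Fin n) =>
      ENNReal.ofReal (p.1 ^ n) * g (p.1 • e + ι (p.1 • p.2)) := by
    refine (measurable_fst.pow_const n).ennreal_ofReal.mul (hg.comp ?_)
    have : Continuous fun p : ℝ × EuclideanSpace ℝ (Fin n) => p.1 • e + ι (p.1 • p.2) :=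
      (continuous_fst.smul continuous_const).add
        (ι.continuous.comp (continuous_fst.smul continuous_snd))
    exact this.measurable
  rw [hstep, lintegral_lintegral_swap hmeas.aemeasurable, ← lintegral_indicator hL,
    ← lintegral_const_mul' _ _ (by simp)]
  refine lintegral_congr fun w => ?_
  have hr : 0 < √(1 + ‖w‖ ^ 2) := Real.sqrt_pos.2 (by positivity)
  rw [setLIntegral_congr_fun (g := fun s => {w | e + ι w ∈ A}.indicator
        (fun w => (Set.Ioo 0 (√(1 + ‖w‖ ^ 2))⁻¹).indicator
          (fun s : ℝ => ENNReal.ofReal (s ^ n)) s) w) measurableSet_Ioi (fun s hs => by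
      simp only
      rw [hscale s hs]
      simp only [Set.indicator_apply]
      split_ifs <;> simp)]
  by_cases hw : w ∈ {w | e + ι w ∈ A}
  · simp only [Set.indicator_of_mem hw]
    rw [setLIntegral_indicator measurableSet_Ioo,
      Set.inter_eq_left.2 (fun s hs => hs.1), lintegral_Ioi_pow_lt n (by positivity),
      finrank_euclideanSpace_fin, ← ENNReal.ofReal_natCast, ← ENNReal.ofReal_mul (by positivity)]
    congr 1
    rw [inv_pow]
    push_cast
    field_simp
  · simp only [Set.indicator_of_notMem hw]
    simp

/-- Integration in polar coordinates. -/
theorem lintegral_polar {E : Type*} [NormedAddCommGroup E] [InnerProductSpace ℝ E]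
    [FiniteDimensional ℝ E] [MeasurableSpace E] [BorelSpace E] [Nontrivial E] {h : E → ℝ≥0∞}
    (hh : Measurable h) :
    ∫⁻ x, h x = ∫⁻ u, (∫⁻ r in Set.Ioi (0:ℝ),
      ENNReal.ofReal (r ^ (Module.finrank ℝ E - 1)) * h (r • u)) ∂(sphereVol E) := by
  have hmp := Measure.measurePreserving_homeomorphUnitSphereProd (volume : Measure E)
  have hF : Measurable fun p : E × ℝ =>
      ENNReal.ofReal (p.2 ^ (Module.finrank ℝ E - 1)) * h (p.2 • p.1) :=
    (measurable_snd.pow_const _).ennreal_ofReal.mul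
      (hh.comp (continuous_snd.smul continuous_fst).measurable)
  rw [sphereVol, lintegral_map ?_ measurable_subtype_coe]
  swap
  · exact Measurable.lintegral_prod_right (f := fun u r => _) hF
  have hG : Measurable fun p : Metric.sphere (0:E) 1 × Set.Ioi (0:ℝ) => h (p.2.1 • p.1.1) :=
    hh.comp ((continuous_subtype_val.comp continuous_snd).smul
      (continuous_subtype_val.comp continuous_fst)).measurable
  calc ∫⁻ x, h x = ∫⁻ x in ({0}ᶜ : Set E), h x := by
        rw [restrict_compl_singleton]
    _ = ∫⁻ x : ({0}ᶜ : Set E), h x ∂((volume : Measure E).comap Subtype.val) :=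
        (lintegral_subtype_comap (measurableSet_singleton _).compl _).symm
    _ = ∫⁻ x : ({0}ᶜ : Set E), h ((homeomorphUnitSphereProd E x).2.1 •
          (homeomorphUnitSphereProd E x).1.1) ∂((volume : Measure E).comap Subtype.val) := by
        refine lintegral_congr fun x => ?_
        congr 1
        have hx : ‖(x:E)‖ ≠ 0 := norm_ne_zero_iff.2 x.2
        simp [smul_smul, hx]
    _ = ∫⁻ p, h (p.2.1 • p.1.1) ∂((volume : Measure E).toSphere.prod
          (Measure.volumeIoiPow (Module.finrank ℝ E - 1))) := hmp.lintegral_comp hG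
    _ = ∫⁻ u, ∫⁻ r, h (r.1 • u.1) ∂(Measure.volumeIoiPow (Module.finrank ℝ E - 1))
          ∂(volume : Measure E).toSphere := lintegral_prod _ hG.aemeasurable
    _ = _ := by
        refine lintegral_congr fun u => ?_
        have hgu : Measurable fun r : Set.Ioi (0:ℝ) => h (r.1 • u.1) :=
          hG.comp measurable_prodMk_left
        rw [Measure.volumeIoiPow, lintegral_withDensity_eq_lintegral_mul _
          (measurable_subtype_coe.pow_const _).ennreal_ofReal hgu]
        exact lintegral_subtype_comap measurableSet_Ioi
          (fun r : ℝ => ENNReal.ofReal (r ^ (Module.finrank ℝ E - 1)) * h (r • u.1))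

/-- `D ∘ arctan`, the spherical radial profile in gnomonic coordinates. -/
def Jfun (d : ℕ) (r : ℝ) : ℝ := Dfun d (arctan r)

theorem Dfun_hasDerivAt (d : ℕ) (x : ℝ) : HasDerivAt (Dfun d) (sin x ^ (d - 1)) x :=
  intervalIntegral.integral_hasDerivAt_right (Continuous.intervalIntegrable (by fun_prop) _ _)
    (Continuous.stronglyMeasurableAtFilter (by fun_prop) _ _) (by fun_prop)

theorem Dfun_zero (d : ℕ) : Dfun d 0 = 0 := by simp [Dfun]

theorem Dfun_sub (d : ℕ) (x y : ℝ) : Dfun d y - Dfun d x = ∫ t in x..y, sin t ^ (d - 1) := by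
  rw [Dfun, Dfun, intervalIntegral.integral_interval_sub_left] <;>
  exact Continuous.intervalIntegrable (by fun_prop) _ _

theorem Dfun_sub_le (d : ℕ) {x y : ℝ} (hx : 0 ≤ x) (hxy : x ≤ y) (hy : y ≤ π) :
    Dfun d y - Dfun d x ≤ y - x := by
  rw [Dfun_sub]
  calc ∫ t in x..y, sin t ^ (d - 1) ≤ ∫ t in x..y, (1:ℝ) := by
        refine intervalIntegral.integral_mono_on hxy
          (Continuous.intervalIntegrable (by fun_prop) _ _) (by simp) fun t ht => ?_
        exact pow_le_one₀ (sin_nonneg_of_nonneg_of_le_pi (hx.trans ht.1) (ht.2.trans hy))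
          (sin_le_one t)
    _ = y - x := by simp

theorem Dfun_mono (d : ℕ) {x y : ℝ} (hx : 0 ≤ x) (hxy : x ≤ y) (hy : y ≤ π) :
    Dfun d x ≤ Dfun d y := by
  rw [← sub_nonneg, Dfun_sub]
  exact intervalIntegral.integral_nonneg hxy fun t ht =>
    pow_nonneg (sin_nonneg_of_nonneg_of_le_pi (hx.trans ht.1) (ht.2.trans hy)) _

theorem Dfun_sub_le_cos {d : ℕ} (hd : 2 ≤ d) {x : ℝ} (hx : 0 ≤ x) (hx' : x ≤ π / 2) :
    Dfun d (π / 2) - Dfun d x ≤ cos x := by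
  rw [Dfun_sub]
  calc ∫ t in x..(π/2), sin t ^ (d - 1) ≤ ∫ t in x..(π/2), sin t := by
        refine intervalIntegral.integral_mono_on hx'
          (Continuous.intervalIntegrable (by fun_prop) _ _)
          (Continuous.intervalIntegrable (by fun_prop) _ _) fun t ht => ?_
        exact pow_le_of_le_one (sin_nonneg_of_nonneg_of_le_pi (hx.trans ht.1)
          (ht.2.trans (by linarith [pi_pos]))) (sin_le_one t) (by omega)
    _ = cos x := by simp

theorem Dfun_pi_div_two_le_one {d : ℕ} (hd : 2 ≤ d) : Dfun d (π / 2) ≤ 1 := by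
  simpa [Dfun_zero] using Dfun_sub_le_cos hd le_rfl (by positivity : (0:ℝ) ≤ π / 2)

theorem Dfun_pi_div_two_pos (d : ℕ) : 0 < Dfun d (π / 2) := by
  refine intervalIntegral.intervalIntegral_pos_of_pos_on
    (Continuous.intervalIntegrable (by fun_prop) _ _) (fun t ht => ?_) (by positivity)
  exact pow_pos (sin_pos_of_pos_of_lt_pi ht.1 (ht.2.trans (by linarith [pi_pos]))) _

theorem Jfun_zero (d : ℕ) : Jfun d 0 = 0 := by simp [Jfun, Dfun_zero]

theorem Jfun_hasDerivAt {d : ℕ} (hd : 1 ≤ d) (r : ℝ) :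
    HasDerivAt (Jfun d) (r ^ (d - 1) / √(1 + r ^ 2) ^ (d + 1)) r := by
  have h := (Dfun_hasDerivAt d (arctan r)).comp r (hasDerivAt_arctan r)
  refine h.congr_deriv ?_
  have hs : 0 < √(1 + r ^ 2) := Real.sqrt_pos.2 (by positivity)
  symm
  rw [sin_arctan, div_pow]
  have : (1 + r ^ 2) = √(1 + r ^ 2) ^ 2 := (Real.sq_sqrt (by positivity)).symm
  conv_rhs => rw [this, Real.sqrt_sq hs.le]
  rw [show d + 1 = (d - 1) + 2 by omega, pow_add]
  field_simp

theorem Jfun_continuous {d : ℕ} (hd : 1 ≤ d) : Continuous (Jfun d) :=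
  continuous_iff_continuousAt.2 fun r => (Jfun_hasDerivAt hd r).continuousAt

theorem Jfun_strictMonoOn {d : ℕ} (hd : 1 ≤ d) : StrictMonoOn (Jfun d) (Set.Ici 0) := by
  refine strictMonoOn_of_deriv_pos (convex_Ici 0) (Jfun_continuous hd).continuousOn fun r hr => ?_
  rw [interior_Ici] at hr
  rw [(Jfun_hasDerivAt hd r).deriv]
  have hr' : 0 < r := hr
  positivity

theorem Jfun_nonneg {d : ℕ} (hd : 1 ≤ d) {r : ℝ} (hr : 0 ≤ r) : 0 ≤ Jfun d r := by
  rw [← Jfun_zero d]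
  exact (Jfun_strictMonoOn hd).monotoneOn (Set.mem_Ici.2 le_rfl) hr hr

theorem Jfun_le (d : ℕ) {r : ℝ} (hr : 0 ≤ r) : Jfun d r ≤ Dfun d (π / 2) :=
  Dfun_mono d (arctan_nonneg.2 hr) (arctan_lt_pi_div_two r).le (by linarith [pi_pos])

theorem Jfun_ge (d : ℕ) {r : ℝ} (hr : 0 < r) : Dfun d (π / 2) - r⁻¹ ≤ Jfun d r := by
  have h := Dfun_sub_le d (arctan_nonneg.2 hr.le) (arctan_lt_pi_div_two r).le
    (by linarith [pi_pos])
  have h2 : π / 2 - arctan r = arctan r⁻¹ := (arctan_inv_of_pos hr).symm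
  have h3 : arctan r⁻¹ ≤ r⁻¹ := by
    have h4 := Real.le_tan (arctan_nonneg.2 (inv_pos.2 hr).le) (arctan_lt_pi_div_two r⁻¹)
    rwa [tan_arctan] at h4
  unfold Jfun
  linarith

/-- A function decreasing up to `m` and increasing afterwards is minimal at `m`. -/
theorem le_of_deriv_sign {G g : ℝ → ℝ} (hG : ∀ r, HasDerivAt G (g r) r) {m : ℝ} (hm : 0 ≤ m)
    (h1 : ∀ r, 0 < r → r < m → g r ≤ 0) (h2 : ∀ r, m < r → 0 ≤ g r) {r : ℝ} (hr : 0 ≤ r) :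
    G m ≤ G r := by
  have hc : Continuous G := continuous_iff_continuousAt.2 fun r => (hG r).continuousAt
  rcases le_total r m with h | h
  · have : AntitoneOn G (Set.Icc 0 m) := by
      refine antitoneOn_of_deriv_nonpos (convex_Icc 0 m) hc.continuousOn
        (fun x _ => (hG x).differentiableAt.differentiableWithinAt) fun x hx => ?_
      rw [interior_Icc] at hx
      rw [(hG x).deriv]
      exact h1 x hx.1 hx.2
    exact this ⟨hr, h⟩ ⟨hm, le_rfl⟩ h
  · have : MonotoneOn G (Set.Ici m) := by
      refine monotoneOn_of_deriv_nonneg (convex_Ici m) hc.continuousOn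
        (fun x _ => (hG x).differentiableAt.differentiableWithinAt) fun x hx => ?_
      rw [interior_Ici] at hx
      rw [(hG x).deriv]
      exact h2 x hx
    exact this (Set.mem_Ici.2 le_rfl) h h

theorem sqrt_one_add_sq_pow_le {r s : ℝ} (hr : 0 ≤ r) (hrs : r ≤ s) (n : ℕ) :
    √(1 + r ^ 2) ^ n ≤ √(1 + s ^ 2) ^ n := by
  gcongr

/-- `J` lies below its tangents when viewed as a function of `r ^ d`. -/
theorem Jfun_le_tangent {d : ℕ} (hd : 1 ≤ d) {r r0 : ℝ} (hr : 0 ≤ r) (hr0 : 0 ≤ r0) :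
    Jfun d r ≤ Jfun d r0 + (r ^ d - r0 ^ d) / (d * √(1 + r0 ^ 2) ^ (d + 1)) := by
  have hd0 : (d:ℝ) ≠ 0 := by positivity
  have hp : ∀ s : ℝ, 0 < √(1 + s ^ 2) ^ (d + 1) := fun s =>
    pow_pos (Real.sqrt_pos.2 (by positivity)) _
  have key := le_of_deriv_sign (m := r0) (r := r)
    (G := fun r => (r ^ d - r0 ^ d) / (d * √(1 + r0 ^ 2) ^ (d + 1)) - Jfun d r)
    (g := fun r => (d * r ^ (d - 1)) / (d * √(1 + r0 ^ 2) ^ (d + 1))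
      - r ^ (d - 1) / √(1 + r ^ 2) ^ (d + 1))
    (fun r => (((hasDerivAt_pow d r).sub_const _).div_const _).sub (Jfun_hasDerivAt hd r)) hr0
    (fun s hs hs0 => ?_) (fun s hs => ?_) hr
  · simp only [sub_self, zero_div, zero_sub] at key
    linarith
  · rw [mul_div_mul_left _ _ hd0, sub_nonpos]
    exact div_le_div_of_nonneg_left (by positivity) (hp _) (sqrt_one_add_sq_pow_le hs.le hs0.le _)
  · have hs0 : 0 ≤ s := hr0.trans hs.le
    rw [mul_div_mul_left _ _ hd0, sub_nonneg]
    exact div_le_div_of_nonneg_left (by positivity) (hp _) (sqrt_one_add_sq_pow_le hr0 hs.le _)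

theorem Jfun_star {d : ℕ} (hd : 1 ≤ d) {r m : ℝ} (hr : 0 ≤ r) (hrm : r ≤ m) :
    r ^ d * Jfun d m ≤ m ^ d * Jfun d r := by
  rcases hr.eq_or_lt with rfl | hr
  · simp [Jfun_zero, show d ≠ 0 by omega]
  have h0 := Jfun_le_tangent hd le_rfl hr.le
  have h1 := Jfun_le_tangent hd (hr.le.trans hrm) hr.le
  rw [Jfun_zero, zero_pow (by omega)] at h0
  set c := (d:ℝ) * √(1 + r ^ 2) ^ (d + 1)
  have hc : 0 < c := by positivity
  have h2 : r ^ d / c ≤ Jfun d r := by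
    rw [zero_sub, neg_div] at h0; linarith
  have hp : r ^ d ≤ m ^ d := pow_le_pow_left₀ hr.le hrm d
  have hrd : 0 < r ^ d := by positivity
  calc r ^ d * Jfun d m ≤ r ^ d * (Jfun d r + (m ^ d - r ^ d) / c) := by gcongr
    _ = r ^ d * Jfun d r + (m ^ d - r ^ d) * (r ^ d / c) := by ring
    _ ≤ r ^ d * Jfun d r + (m ^ d - r ^ d) * Jfun d r := by
        gcongr
    _ = _ := by ring

theorem hasDerivAt_sqrt_pow (d : ℕ) (r : ℝ) :
    HasDerivAt (fun r => √(1 + r ^ 2) ^ (d + 1)) ((d + 1) * r * √(1 + r ^ 2) ^ (d - 1) *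
      (if d = 0 then (√(1 + r ^ 2))⁻¹ else 1)) r := by
  have h1 : HasDerivAt (fun r : ℝ => 1 + r ^ 2) (2 * r) r := by
    simpa using (hasDerivAt_pow 2 r).const_add 1
  have hs : 0 < √(1 + r ^ 2) := Real.sqrt_pos.2 (by positivity)
  refine ((h1.sqrt (by positivity)).pow (d + 1)).congr_deriv ?_
  symm
  simp only [Nat.add_sub_cancel]
  push_cast
  split_ifs with h
  · subst h; field_simp; simp
  · obtain ⟨k, rfl⟩ := Nat.exists_eq_succ_of_ne_zero h
    simp only [Nat.succ_eq_add_one, Nat.add_sub_cancel, pow_succ]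
    push_cast
    field_simp

theorem monotoneOn_Ici_of_hasDerivAt {G g : ℝ → ℝ} (hG : ∀ r, HasDerivAt G (g r) r)
    (hg : ∀ r, 0 < r → 0 ≤ g r) : MonotoneOn G (Set.Ici 0) := by
  refine monotoneOn_of_deriv_nonneg (convex_Ici 0)
    (continuous_iff_continuousAt.2 fun r => (hG r).continuousAt).continuousOn
    (fun x _ => (hG x).differentiableAt.differentiableWithinAt) fun x hx => ?_
  rw [interior_Ici] at hx
  rw [(hG x).deriv]
  exact hg x hx

theorem le_sqrt_one_add_sq (r : ℝ) : r ≤ √(1 + r ^ 2) :=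
  Real.le_sqrt_of_sq_le (by linarith)

theorem one_le_sqrt_one_add_sq (r : ℝ) : 1 ≤ √(1 + r ^ 2) :=
  Real.le_sqrt_of_sq_le (by nlinarith [sq_nonneg r])

theorem Jfun_mul_le_sqrt_pow {d : ℕ} (hd : 2 ≤ d) :
    MonotoneOn (fun r => √(1 + r ^ 2) ^ (d + 1) - (d + 1) * Jfun d r) (Set.Ici 0) := by
  refine monotoneOn_Ici_of_hasDerivAt (fun r => (hasDerivAt_sqrt_pow d r).sub
    ((Jfun_hasDerivAt (by omega) r).const_mul ((d:ℝ) + 1))) fun r hr => ?_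
  rw [if_neg (by omega), mul_one, mul_assoc, ← mul_sub]
  refine mul_nonneg (by positivity) (sub_nonneg.2 ?_)
  have h1 := one_le_sqrt_one_add_sq r
  have h2 := le_sqrt_one_add_sq r
  have h3 : r ^ (d - 1) / √(1 + r ^ 2) ^ (d + 1) ≤ r := by
    rw [div_le_iff₀ (by positivity), show d - 1 = (d - 2) + 1 by omega, pow_succ, mul_comm]
    gcongr
    calc r ^ (d - 2) ≤ √(1 + r ^ 2) ^ (d - 2) := by gcongr
      _ ≤ _ := pow_le_pow_right₀ h1 (by omega)
  exact h3.trans (le_mul_of_one_le_right hr.le (one_le_pow₀ h1))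

theorem sqrt_pow_sub_pow_mono {d : ℕ} (hd : 2 ≤ d) :
    MonotoneOn (fun r : ℝ => √(1 + r ^ 2) ^ (d + 1) - r ^ (d + 1)) (Set.Ici 0) := by
  refine monotoneOn_Ici_of_hasDerivAt (fun r => (hasDerivAt_sqrt_pow d r).sub
    (hasDerivAt_pow (d + 1) r)) fun r hr => ?_
  rw [if_neg (by omega), mul_one, mul_assoc, Nat.add_sub_cancel]
  push_cast
  rw [← mul_sub]
  refine mul_nonneg (by positivity) (sub_nonneg.2 ?_)
  conv_lhs => rw [show d = (d - 1) + 1 by omega, pow_succ, mul_comm]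
  have h2 := le_sqrt_one_add_sq r
  gcongr

/-- A quantitative convexity estimate for `r ^ d` as a function of `J r`. -/
theorem pow_ge_quadratic {d : ℕ} (hd : 2 ≤ d) {r m : ℝ} (hr : 0 ≤ r) (hm : 0 ≤ m) :
    m ^ d + d * √(1 + m ^ 2) ^ (d + 1) * (Jfun d r - Jfun d m) +
      d * max (d + 1 : ℝ) (m ^ (d + 1) / Dfun d (π / 2)) / 2 * (Jfun d r - Jfun d m) ^ 2
      ≤ r ^ d := by
  have hD := Dfun_pi_div_two_pos d
  have hd1 : 1 ≤ d := by omega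
  have hJm := (Jfun_strictMonoOn hd1).monotoneOn
  -- monotone comparison with `κ = max ..`
  have hcmp : ∀ s t : ℝ, 0 ≤ s → s ≤ t → (s = m ∨ t = m) →
      max (d + 1 : ℝ) (m ^ (d + 1) / Dfun d (π / 2)) * (Jfun d t - Jfun d s) ≤
        √(1 + t ^ 2) ^ (d + 1) - √(1 + s ^ 2) ^ (d + 1) := by
    intro s t hs hst hm'
    have ht : 0 ≤ t := hs.trans hst
    have hJ : 0 ≤ Jfun d t - Jfun d s := sub_nonneg.2 (hJm hs ht hst)
    rw [max_mul_of_nonneg _ _ hJ]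
    refine max_le ?_ ?_
    · have := Jfun_mul_le_sqrt_pow hd hs ht hst
      simp only at this
      linarith
    · have h1 := sqrt_pow_sub_pow_mono hd hs ht hst
      simp only at h1
      have hmt : m ≤ t := by rcases hm' with h | h <;> linarith
      have h2 : m ^ (d + 1) / Dfun d (π / 2) * (Jfun d t - Jfun d s) ≤ t ^ (d+1) - s ^ (d+1) := by
        rcases ht.eq_or_lt with h0 | h0
        · have : s = t := by linarith
          simp [this]
        have h3 := Jfun_star hd1 hs hst
        have h4 := Jfun_le d ht
        have h5 : s ^ (d+1) ≤ t * s ^ d := by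
          rw [pow_succ, mul_comm]; gcongr
        have h6 : t ^ d * (Jfun d t - Jfun d s) ≤ (t ^ d - s ^ d) * Dfun d (π / 2) := by
          have h7 : s ^ d ≤ t ^ d := by gcongr
          calc t ^ d * (Jfun d t - Jfun d s) ≤ (t ^ d - s ^ d) * Jfun d t := by linarith
            _ ≤ _ := by gcongr
        calc m ^ (d + 1) / Dfun d (π / 2) * (Jfun d t - Jfun d s)
            ≤ t ^ (d + 1) / Dfun d (π / 2) * (Jfun d t - Jfun d s) := by gcongr
          _ = t * (t ^ d * (Jfun d t - Jfun d s)) / Dfun d (π / 2) := by rw [pow_succ]; ring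
          _ ≤ t * ((t ^ d - s ^ d) * Dfun d (π / 2)) / Dfun d (π / 2) := by gcongr
          _ = t ^ (d + 1) - t * s ^ d := by field_simp; ring
          _ ≤ _ := by linarith
      linarith
  set κ := max (d + 1 : ℝ) (m ^ (d + 1) / Dfun d (π / 2))
  set c := √(1 + m ^ 2) ^ (d + 1)
  have key := le_of_deriv_sign (m := m) (r := r)
    (G := fun r => r ^ d - d * c * (Jfun d r - Jfun d m) - d * κ / 2 * (Jfun d r - Jfun d m) ^ 2)
    (g := fun r => d * (r ^ (d - 1) / √(1 + r ^ 2) ^ (d + 1)) *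
      (√(1 + r ^ 2) ^ (d + 1) - c - κ * (Jfun d r - Jfun d m)))
    (fun r => ?_) hm (fun s hs hs0 => ?_) (fun s hs => ?_) hr
  · simp only [sub_self] at key
    have : m ^ d - d * c * 0 - d * κ / 2 * 0 ^ 2 = m ^ d := by ring
    linarith
  · have hJ := Jfun_hasDerivAt hd1 r
    have h := ((hasDerivAt_pow d r).sub ((hJ.sub_const (Jfun d m)).const_mul (d * c))).sub
      (((hJ.sub_const (Jfun d m)).pow 2).const_mul (d * κ / 2))
    refine h.congr_deriv ?_
    symm
    have hs : 0 < √(1 + r ^ 2) := Real.sqrt_pos.2 (by positivity)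
    simp only [Nat.add_one_sub_one, pow_one, Nat.cast_ofNat]
    field_simp
  · refine mul_nonpos_of_nonneg_of_nonpos (by positivity) ?_
    have := hcmp s m hs.le hs0.le (Or.inr rfl)
    linarith
  · have hs0 : 0 ≤ s := hm.trans hs.le
    refine mul_nonneg (by positivity) ?_
    have := hcmp m s hm hs.le (Or.inl rfl)
    linarith

theorem one_add_inv_pow_le {d : ℕ} (hd : 2 ≤ d) : (1 + (d:ℝ)⁻¹) ^ (d + 1) ≤ 27 / 8 := by
  induction d, hd using Nat.le_induction with
  | base => norm_num
  | succ n hn ih =>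
    refine le_trans ?_ ih
    have hn0 : (0:ℝ) < n := by positivity
    -- Bernoulli applied to the ratio
    have hb := one_add_mul_le_pow (R := ℝ) (a := ((n:ℝ) * (n + 2))⁻¹) (by
      have : (0:ℝ) < ((n:ℝ) * (n + 2))⁻¹ := by positivity
      linarith) (n + 1)
    have h2 : (1 + (n:ℝ)⁻¹) = (1 + ((n:ℝ) * (n + 2))⁻¹) * (1 + ((n:ℝ) + 1)⁻¹) := by
      field_simp; ring
    have h3 : 1 + ((n:ℝ) + 1)⁻¹ ≤ (1 + ((n:ℝ) * (n + 2))⁻¹) ^ (n + 1) := by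
      refine le_trans ?_ hb
      push_cast
      rw [add_le_add_iff_left, inv_eq_one_div, div_le_iff₀ (by positivity)]
      field_simp
      nlinarith
    rw [h2, mul_pow]
    push_cast
    rw [pow_succ _ (n + 1), mul_comm]
    gcongr

theorem one_add_pow_le_of_eq {d : ℕ} (hd : 1 ≤ d) {z : ℝ} (hz : 0 ≤ z) :
    (1 + z / (d * (1 + z))) ^ d ≤ 1 + z := by
  have hd0 : (0:ℝ) < d := by positivity
  have h1 : 1 + z / (d * (1 + z)) ≤ exp (z / (d * (1 + z))) := by
    rw [add_comm]; exact add_one_le_exp _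
  calc (1 + z / (d * (1 + z))) ^ d ≤ exp (z / (d * (1 + z))) ^ d := by gcongr
    _ = exp (z / (1 + z)) := by
        rw [← exp_nat_mul]; congr 1; field_simp
    _ ≤ 1 + z := by
        rw [← Real.le_log_iff_exp_le (by positivity)]
        have := Real.one_sub_inv_le_log_of_pos (by positivity : 0 < 1 + z)
        refine le_trans (le_of_eq ?_) this
        field_simp; ring

/-- Increment of the complementary profile. -/
theorem Jfun_inv_sub_ge {d : ℕ} (hd : 1 ≤ d) {T η : ℝ} (hT : 0 < T) (hη : 0 ≤ η) :
    η * T / ((1 + η) * √(1 + T ^ 2)) ^ (d + 1) ≤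
      Jfun d T⁻¹ - Jfun d ((1 + η) * T)⁻¹ := by
  set c := (((1 + η) * √(1 + T ^ 2)) ^ (d + 1))⁻¹ with hc
  have hle : T ≤ (1 + η) * T := by nlinarith
  have hderiv : ∀ t : ℝ, 0 < t → HasDerivAt (fun t => -Jfun d t⁻¹ - c * t)
      ((√(1 + t ^ 2) ^ (d + 1))⁻¹ - c) t := by
    intro t ht
    have h := (((Jfun_hasDerivAt hd t⁻¹).comp t (hasDerivAt_inv ht.ne')).neg).sub
      ((hasDerivAt_id t).const_mul c)
    refine h.congr_deriv ?_
    have h1 : √(1 + t⁻¹ ^ 2) = √(1 + t ^ 2) / t := by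
      rw [Real.sqrt_eq_iff_mul_self_eq (by positivity) (by positivity), div_mul_div_comm,
        Real.mul_self_sqrt (by positivity)]
      field_simp
      ring
    have hs : 0 < √(1 + t ^ 2) := Real.sqrt_pos.2 (by positivity)
    rw [h1, div_pow, mul_one, inv_pow, show d + 1 = (d - 1) + 2 by omega, pow_add t]
    field_simp
  have hmono : MonotoneOn (fun t => -Jfun d t⁻¹ - c * t) (Set.Icc T ((1 + η) * T)) := by
    refine monotoneOn_of_deriv_nonneg (convex_Icc _ _)
      (fun t ht => (hderiv t (hT.trans_le ht.1)).continuousAt.continuousWithinAt)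
      (fun t ht => (hderiv t ?_).differentiableAt.differentiableWithinAt) fun t ht => ?_
    · rw [interior_Icc] at ht
      exact hT.trans ht.1
    · rw [interior_Icc] at ht
      have ht0 := hT.trans ht.1
      rw [(hderiv t ht0).deriv, sub_nonneg, hc]
      have h1 : √(1 + t ^ 2) ≤ (1 + η) * √(1 + T ^ 2) := by
        rw [Real.sqrt_le_left (by positivity), mul_pow, Real.sq_sqrt (by positivity)]
        have : t ^ 2 ≤ ((1 + η) * T) ^ 2 := pow_le_pow_left₀ ht0.le ht.2.le 2
        nlinarith
      gcongr
  have := hmono ⟨le_rfl, hle⟩ ⟨hle, le_rfl⟩ hle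
  simp only at this
  have e : η * T / ((1 + η) * √(1 + T ^ 2)) ^ (d + 1) = c * ((1 + η) * T) - c * T := by
    rw [hc]; ring
  linarith

theorem scalar_case_large {d : ℕ} (hd : 2 ≤ d) {q : ℝ} (hq : q ^ d ≤ 0.42) :
    2 * q ^ d / (π ^ 2 * d) ≤ 16 / 135 / (1 + d * π / 4) := by
  have hd' : (2:ℝ) ≤ d := by exact_mod_cast hd
  have h1 := pi_gt_d2
  have h2 := pi_lt_d2
  rw [div_le_div_iff₀ (by positivity) (by positivity)]
  have hp : (9.85:ℝ) ≤ π ^ 2 := by nlinarith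
  calc 2 * q ^ d * (1 + d * π / 4) ≤ 2 * 0.42 * (1 + d * 3.15 / 4) := by gcongr
    _ ≤ 16 / 135 * (9.85 * d) := by nlinarith
    _ ≤ _ := by gcongr

theorem scalar_case_small {d : ℕ} (hd : 2 ≤ d) {q : ℝ} (hq : q ^ d ≤ 0.42) :
    2 * ((2 / π) ^ (d + 1) * q ^ d / d) * (1 / 2) ^ (2 * d) * √5 ^ (d + 1) ≤
      4 / 27 / (1 + d / 8) := by
  have hd' : (2:ℝ) ≤ d := by exact_mod_cast hd
  have h1 := pi_gt_d2
  have h5 : √5 ≤ 2.24 := by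
    rw [Real.sqrt_le_left (by norm_num)]; norm_num
  have hx : 2 / π * √5 ≤ 1.43 := by
    rw [div_mul_eq_mul_div, div_le_iff₀ pi_pos]
    nlinarith
  have hx0 : 0 ≤ 2 / π * √5 := by positivity
  have e : 2 * ((2 / π) ^ (d + 1) * q ^ d / d) * (1 / 2) ^ (2 * d) * √5 ^ (d + 1)
      = 2 * q ^ d / d * ((2 / π * √5) * (2 / π * √5 / 4) ^ d) := by
    rw [pow_mul, div_pow (2 / π * √5), mul_pow, pow_succ, pow_succ √5]
    have : ((1:ℝ) / 2) ^ 2 = 1 / 4 := by norm_num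
    rw [this, div_pow 1]
    ring
  have h6 : (2 / π * √5 / 4) ^ d ≤ (1.43 / 4) ^ 2 := by
    calc (2 / π * √5 / 4) ^ d ≤ (1.43 / 4) ^ d := by gcongr
      _ ≤ (1.43 / 4) ^ 2 := pow_le_pow_of_le_one (by norm_num) (by norm_num) hd
  rw [e]
  calc 2 * q ^ d / d * ((2 / π * √5) * (2 / π * √5 / 4) ^ d)
      ≤ 2 * 0.42 / d * (1.43 * (1.43 / 4) ^ 2) := by gcongr
    _ ≤ _ := by
      rw [div_mul_eq_mul_div, div_le_div_iff₀ (by positivity) (by positivity)]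
      nlinarith

/-- The quantitative gain for the complementary profile. -/
theorem scalar_gain {d : ℕ} (hd : 2 ≤ d) {T ε q M A B : ℝ} (hT : 0 < T) (hε : 0 < ε)
    (hε2 : ε ≤ Dfun d (π / 2) / 2) (hq0 : 0 ≤ q) (hq : q ^ d ≤ 0.42)
    (hJT : Jfun d T ≤ Dfun d (π / 2) * (1 - ε / π))
    (hM : T ^ d + d * max (d + 1 : ℝ) (T ^ (d + 1) / Dfun d (π / 2)) / 2 * ε ^ 2 ≤ M)
    (hB : M * B ≤ 1)
    (hA : ∀ r0, 0 < r0 → A ≤ Jfun d r0 + (B - r0 ^ d) / (d * √(1 + r0 ^ 2) ^ (d + 1))) :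
    (1 + 2 * ((2 / π) ^ (d + 1) * q ^ d / d) * ε ^ (2 * (d + 1))) *
      (Dfun d (π / 2) - Jfun d T⁻¹) ≤ Dfun d (π / 2) - A := by
  have hd1 : 1 ≤ d := by omega
  have hd' : (2:ℝ) ≤ d := by exact_mod_cast hd
  have hD := Dfun_pi_div_two_pos d
  have hD1 := Dfun_pi_div_two_le_one hd
  set D := Dfun d (π / 2) with hDdef
  set κ := max (d + 1 : ℝ) (T ^ (d + 1) / D) with hκ
  set H := D - Jfun d T⁻¹ with hH
  have hκ0 : 0 < κ := lt_of_lt_of_le (by positivity) (le_max_left _ _)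
  have hHT : H ≤ T := by
    have := Jfun_ge d (inv_pos.2 hT)
    rw [inv_inv] at this
    linarith
  have hHD : H ≤ D := by
    have := Jfun_nonneg hd1 (inv_pos.2 hT).le
    linarith
  have hH0 : 0 ≤ H := by
    have := Jfun_le d (inv_pos.2 hT).le
    linarith
  set S := √(1 + T ^ 2) with hS
  have hS0 : 0 < S := Real.sqrt_pos.2 (by positivity)
  have hS2 : S ^ 2 = 1 + T ^ 2 := Real.sq_sqrt (by positivity)
  have hcos : D * ε / π ≤ 1 / S := by
    have h := Dfun_sub_le_cos hd (arctan_nonneg.2 hT.le) (arctan_lt_pi_div_two T).le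
    rw [cos_arctan] at h
    have : Dfun d (arctan T) = Jfun d T := rfl
    rw [this, ← hDdef] at h
    have e : D * (1 - ε / π) = D - D * ε / π := by ring
    linarith
  -- the gain from any admissible `η`
  have hgain : ∀ z, 0 ≤ z → z ≤ d * κ / 2 * ε ^ 2 / T ^ d →
      8 / 27 * (z / (d * (1 + z))) * T / S ^ (d + 1) ≤ (D - A) - H := by
    intro z hz hzle
    set η := z / (d * (1 + z)) with hη
    have hη0 : 0 ≤ η := by positivity
    have hηd : η ≤ (d:ℝ)⁻¹ := by
      rw [hη, div_le_iff₀ (by positivity), ← mul_assoc, inv_mul_cancel₀ (by positivity)]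
      linarith
    set r0 := ((1 + η) * T)⁻¹ with hr0
    have hr0p : 0 < r0 := by positivity
    have hBr : B ≤ r0 ^ d := by
      have h1 : ((1 + η) * T) ^ d ≤ M := by
        rw [mul_pow]
        calc (1 + η) ^ d * T ^ d ≤ (1 + z) * T ^ d := by
              gcongr; exact one_add_pow_le_of_eq hd1 hz
          _ ≤ (1 + d * κ / 2 * ε ^ 2 / T ^ d) * T ^ d := by gcongr
          _ = T ^ d + d * κ / 2 * ε ^ 2 := by field_simp
          _ ≤ M := hM
      have h2 : 0 < ((1 + η) * T) ^ d := by positivity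
      rw [hr0, inv_pow, ← one_div, le_div_iff₀ h2]
      rcases le_or_gt B 0 with hB0 | hB0
      · exact (mul_nonpos_of_nonpos_of_nonneg hB0 h2.le).trans zero_le_one
      · refine le_trans ?_ hB
        rw [mul_comm]
        gcongr
    have h1 := hA r0 hr0p
    have h2 : (B - r0 ^ d) / (d * √(1 + r0 ^ 2) ^ (d + 1)) ≤ 0 :=
      div_nonpos_of_nonpos_of_nonneg (by linarith) (by positivity)
    have h3 := Jfun_inv_sub_ge hd1 hT hη0
    have h4 : 8 / 27 * η * T / S ^ (d + 1) ≤ η * T / ((1 + η) * S) ^ (d + 1) := by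
      have h5 : (1 + η) ^ (d + 1) ≤ 27 / 8 :=
        le_trans (by gcongr) (one_add_inv_pow_le hd)
      rw [mul_pow, div_le_div_iff₀ (by positivity) (by positivity)]
      calc 8 / 27 * η * T * ((1 + η) ^ (d + 1) * S ^ (d + 1))
          ≤ 8 / 27 * η * T * (27 / 8 * S ^ (d + 1)) := by gcongr
        _ = _ := by ring
    linarith
  suffices h : 2 * ((2 / π) ^ (d + 1) * q ^ d / d) * ε ^ (2 * (d + 1)) * H ≤ (D - A) - H by
    linarith
  have hεh : ε ≤ 1 / 2 := by linarith
  rcases le_or_gt 2 T with hT2 | hT2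
  · have hz := hgain (d * T * ε ^ 2 / (2 * D)) (by positivity) (by
      rw [div_le_div_iff₀ (by positivity) (by positivity)]
      have : T ^ (d + 1) ≤ κ * D := by
        rw [← div_le_iff₀ hD]; exact le_max_right _ _
      calc d * T * ε ^ 2 * T ^ d = d * ε ^ 2 * T ^ (d + 1) := by ring
        _ ≤ d * ε ^ 2 * (κ * D) := by gcongr
        _ = _ := by ring)
    refine le_trans ?_ hz
    have hTS : D * ε * T ≤ π := by
      have h1 : T ≤ S := le_sqrt_one_add_sq T
      rw [div_le_div_iff₀ pi_pos hS0] at hcos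
      calc D * ε * T ≤ D * ε * S := by gcongr
        _ ≤ _ := by linarith
    set z := d * T * ε ^ 2 / (2 * D) with hzdef
    have hη : T * ε ^ 2 / (2 * (1 + d * π / 4)) ≤ z / (d * (1 + z)) := by
      rw [hzdef, div_le_div_iff₀ (by positivity) (by positivity)]
      have e : d * T * ε ^ 2 / (2 * D) * (2 * (1 + d * π / 4)) - T * ε ^ 2 *
          (d * (1 + d * T * ε ^ 2 / (2 * D)))
          = d * T * ε ^ 2 / D * (1 - D + d * (π / 4 - T * ε ^ 2 / 2)) := by
        field_simp
        ring
      have h2 : T * ε ^ 2 ≤ π / 2 := by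
        calc T * ε ^ 2 = (ε * T) * ε := by ring
          _ ≤ (ε * T) * (D / 2) := by gcongr
          _ = D * ε * T / 2 := by ring
          _ ≤ π / 2 := by linarith
      have h3 : 0 ≤ d * T * ε ^ 2 / D * (1 - D + d * (π / 4 - T * ε ^ 2 / 2)) := by
        refine mul_nonneg (by positivity) (add_nonneg (by linarith)
          (mul_nonneg (by positivity) (by linarith)))
      linarith
    have hsin : 4 / 5 ≤ T ^ 2 / S ^ 2 := by
      rw [hS2, div_le_div_iff₀ (by norm_num) (by positivity)]
      nlinarith
    calc 2 * ((2 / π) ^ (d + 1) * q ^ d / d) * ε ^ (2 * (d + 1)) * H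
        ≤ 2 * ((2 / π) ^ (d + 1) * q ^ d / d) * (ε ^ (d + 1) * (D / 2) ^ (d + 1)) * 1 := by
          gcongr
          · rw [two_mul, pow_add]; gcongr
          · linarith
      _ = 2 * q ^ d / (π ^ 2 * d) * (ε ^ 2 * (D ^ 2 * (D * ε / π) ^ (d - 1))) := by
          obtain ⟨k, rfl⟩ : ∃ k, d = k + 1 := ⟨d - 1, by omega⟩
          simp only [Nat.add_sub_cancel, div_pow, mul_pow]
          field_simp
          ring
      _ ≤ 16 / 135 / (1 + d * π / 4) * (ε ^ 2 * (1 * (1 / S) ^ (d - 1))) := by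
          gcongr ?_ * (_ * (?_ * ?_ ^ _))
          · exact scalar_case_large hd hq
          · exact pow_le_one₀ hD.le hD1
      _ = 8 / 27 * (T * ε ^ 2 / (2 * (1 + d * π / 4))) * T / S ^ (d + 1) *
            ((4 / 5) / (T ^ 2 / S ^ 2)) := by
          obtain ⟨k, rfl⟩ : ∃ k, d = k + 1 := ⟨d - 1, by omega⟩
          simp only [Nat.add_sub_cancel, div_pow]
          field_simp
          ring
      _ ≤ 8 / 27 * (T * ε ^ 2 / (2 * (1 + d * π / 4))) * T / S ^ (d + 1) * 1 := by
          gcongr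
          exact div_le_one_of_le₀ hsin (by positivity)
      _ ≤ 8 / 27 * (z / (d * (1 + z))) * T / S ^ (d + 1) := by
          rw [mul_one]; gcongr
  · have hκT : T ^ d ≤ κ := by
      rcases le_or_gt T 1 with h1 | h1
      · exact (pow_le_one₀ hT.le h1).trans (le_trans (by linarith) (le_max_left _ _))
      · refine le_trans ?_ (le_max_right _ _)
        rw [le_div_iff₀ hD, pow_succ]
        have : 0 < T ^ d := by positivity
        nlinarith
    have hz := hgain (d / 2 * ε ^ 2) (by positivity) (by
      rw [le_div_iff₀ (by positivity)]
      calc d / 2 * ε ^ 2 * T ^ d ≤ d / 2 * ε ^ 2 * κ := by gcongr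
        _ = _ := by ring)
    refine le_trans ?_ hz
    set z := d / 2 * ε ^ 2 with hzdef
    have hz8 : z ≤ d / 8 := by
      have : ε ^ 2 ≤ (1 / 2) ^ 2 := by gcongr
      rw [hzdef]; nlinarith
    have hη : ε ^ 2 / (2 * (1 + d / 8)) ≤ z / (d * (1 + z)) := by
      have e : z / (d * (1 + z)) = ε ^ 2 / (2 * (1 + z)) := by
        have : 0 < 1 + z := by positivity
        rw [div_eq_div_iff (by positivity) (by positivity)]
        conv_lhs => rw [hzdef]
        ring
      rw [e]
      gcongr
    have hS5 : S ≤ √5 := Real.sqrt_le_sqrt (by nlinarith)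
    calc 2 * ((2 / π) ^ (d + 1) * q ^ d / d) * ε ^ (2 * (d + 1)) * H
        ≤ 2 * ((2 / π) ^ (d + 1) * q ^ d / d) * ((1 / 2) ^ (2 * d) * ε ^ 2) * T := by
          gcongr
          rw [show 2 * (d + 1) = 2 * d + 2 by ring, pow_add]
          gcongr
      _ = 2 * ((2 / π) ^ (d + 1) * q ^ d / d) * (1 / 2) ^ (2 * d) * √5 ^ (d + 1) *
            (ε ^ 2 * T / √5 ^ (d + 1)) := by
          field_simp
      _ ≤ 4 / 27 / (1 + d / 8) * (ε ^ 2 * T / S ^ (d + 1)) := by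
          gcongr ?_ * ?_
          · exact scalar_case_small hd hq
          · gcongr
      _ = 8 / 27 * (ε ^ 2 / (2 * (1 + d / 8))) * T / S ^ (d + 1) := by
          field_simp; ring
      _ ≤ _ := by gcongr

theorem Jfun_tendsto_atTop (d : ℕ) : Tendsto (Jfun d) atTop (𝓝 (Dfun d (π / 2))) := by
  have h1 : Tendsto (fun r : ℝ => Dfun d (π / 2) - r⁻¹) atTop (𝓝 (Dfun d (π / 2))) := by
    simpa using (tendsto_inv_atTop_zero (𝕜 := ℝ)).const_sub (Dfun d (π / 2))
  refine tendsto_of_tendsto_of_tendsto_of_le_of_le' h1 tendsto_const_nhds ?_ ?_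
  · filter_upwards [eventually_gt_atTop 0] with r hr using Jfun_ge d hr
  · filter_upwards [eventually_ge_atTop 0] with r hr using Jfun_le d hr

theorem lintegral_Ioc_Jfun_deriv {d : ℕ} (hd : 1 ≤ d) {ρ : ℝ} (hρ : 0 ≤ ρ) :
    ∫⁻ r in Set.Ioc 0 ρ, ENNReal.ofReal (r ^ (d - 1) / √(1 + r ^ 2) ^ (d + 1)) =
      ENNReal.ofReal (Jfun d ρ) := by
  have hc : Continuous fun r : ℝ => r ^ (d - 1) / √(1 + r ^ 2) ^ (d + 1) := by
    refine Continuous.div (by fun_prop) (by fun_prop) fun r => ?_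
    have : 0 < √(1 + r ^ 2) := Real.sqrt_pos.2 (by positivity)
    positivity
  rw [← ofReal_integral_eq_lintegral_ofReal (hc.intervalIntegrable 0 ρ).1,
    ← intervalIntegral.integral_of_le hρ, intervalIntegral.integral_eq_sub_of_hasDerivAt
      (fun r _ => Jfun_hasDerivAt hd r) (hc.intervalIntegrable _ _), Jfun_zero, sub_zero]
  filter_upwards [ae_restrict_mem measurableSet_Ioc] with r hr
  have := hr.1
  positivity

theorem lintegral_Ioi_Jfun_deriv {d : ℕ} (hd : 1 ≤ d) :
    ∫⁻ r in Set.Ioi 0, ENNReal.ofReal (r ^ (d - 1) / √(1 + r ^ 2) ^ (d + 1)) =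
      ENNReal.ofReal (Dfun d (π / 2)) := by
  have hnn : ∀ r ∈ Set.Ioi (0:ℝ), 0 ≤ r ^ (d - 1) / √(1 + r ^ 2) ^ (d + 1) := fun r hr => by
    have : 0 < r := hr
    positivity
  rw [← ofReal_integral_eq_lintegral_ofReal (integrableOn_Ioi_deriv_of_nonneg'
      (fun r _ => Jfun_hasDerivAt hd r) hnn (Jfun_tendsto_atTop d)),
    integral_Ioi_of_hasDerivAt_of_nonneg' (fun r _ => Jfun_hasDerivAt hd r) hnn
      (Jfun_tendsto_atTop d), Jfun_zero, sub_zero]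
  filter_upwards [ae_restrict_mem measurableSet_Ioi] with r hr using hnn r hr

/-- The gnomonic weight of a star body is the integral of `J` over its radial function. -/
theorem lintegral_weight_radial {d : ℕ} (hd : 1 ≤ d) {L : Set (EuclideanSpace ℝ (Fin d))}
    (hL : MeasurableSet L) {ρ : EuclideanSpace ℝ (Fin d) → ℝ} (hρ : ∀ u, ‖u‖ = 1 → 0 ≤ ρ u)
    (h1 : ∀ u, ‖u‖ = 1 → ∀ r, 0 < r → r < ρ u → r • u ∈ L)
    (h2 : ∀ u, ‖u‖ = 1 → ∀ r, 0 < r → r • u ∈ L → r ≤ ρ u) :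
    ∫⁻ w in L, ENNReal.ofReal (√(1 + ‖w‖ ^ 2) ^ (d + 1))⁻¹ =
      ∫⁻ u, ENNReal.ofReal (Jfun d (ρ u)) ∂(sphereVol (EuclideanSpace ℝ (Fin d))) := by
  classical
  have : Nontrivial (EuclideanSpace ℝ (Fin d)) :=
    Module.nontrivial_of_finrank_pos (R := ℝ) (by simp; omega)
  rw [← lintegral_indicator hL, lintegral_polar (Measurable.indicator (by fun_prop) hL)]
  refine lintegral_congr_ae ?_
  filter_upwards [ae_norm_sphereVol] with u hu
  rw [← lintegral_Ioc_Jfun_deriv hd (hρ u hu), ← lintegral_indicator measurableSet_Ioi,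
    ← lintegral_indicator measurableSet_Ioc]
  refine lintegral_congr_ae ?_
  have hne : ∀ᵐ r : ℝ, r ≠ ρ u := by simp [ae_iff]
  filter_upwards [hne] with r hr
  rw [finrank_euclideanSpace_fin]
  by_cases h0 : 0 < r
  · rw [Set.indicator_of_mem (by exact h0)]
    rcases lt_or_gt_of_ne hr with h | h
    · rw [Set.indicator_of_mem (h1 u hu r h0 h), Set.indicator_of_mem (Set.mem_Ioc.2 ⟨h0, h.le⟩),
        ← ENNReal.ofReal_mul (by positivity), norm_smul, hu, mul_one, Real.norm_of_nonneg h0.le,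
        div_eq_mul_inv]
    · rw [Set.indicator_of_notMem fun hm => absurd (h2 u hu r h0 hm) (not_le.2 h),
        Set.indicator_of_notMem (fun hm => absurd hm.2 (not_le.2 h)), mul_zero]
  · rw [Set.indicator_of_notMem (by exact h0), Set.indicator_of_notMem (fun hm => h0 hm.1)]

theorem lintegral_weight {d : ℕ} (hd : 1 ≤ d) :
    ∫⁻ w : EuclideanSpace ℝ (Fin d), ENNReal.ofReal (√(1 + ‖w‖ ^ 2) ^ (d + 1))⁻¹ =
      ENNReal.ofReal (Dfun d (π / 2)) * sphereVol (EuclideanSpace ℝ (Fin d)) Set.univ := by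
  have : Nontrivial (EuclideanSpace ℝ (Fin d)) :=
    Module.nontrivial_of_finrank_pos (R := ℝ) (by simp; omega)
  rw [lintegral_polar (by fun_prop), ← lintegral_const]
  refine lintegral_congr_ae ?_
  filter_upwards [ae_norm_sphereVol] with u hu
  rw [← lintegral_Ioi_Jfun_deriv hd]
  refine setLIntegral_congr_fun measurableSet_Ioi fun r hr => ?_
  have h0 : 0 < r := hr
  simp only [finrank_euclideanSpace_fin]
  rw [← ENNReal.ofReal_mul (by positivity), norm_smul, hu, mul_one, Real.norm_of_nonneg h0.le,
        div_eq_mul_inv]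

/-- The uniform probability measure on the unit sphere of `ℝ^d`. -/
def sphereProb (d : ℕ) : Measure (EuclideanSpace ℝ (Fin d)) :=
  (sphereVol (EuclideanSpace ℝ (Fin d)) Set.univ)⁻¹ • sphereVol (EuclideanSpace ℝ (Fin d))

theorem sphereVol_univ_ne_zero {d : ℕ} (hd : 1 ≤ d) :
    sphereVol (EuclideanSpace ℝ (Fin d)) Set.univ ≠ 0 := by
  have : Nontrivial (EuclideanSpace ℝ (Fin d)) :=
    Module.nontrivial_of_finrank_pos (R := ℝ) (by simp; omega)
  exact sphereVol_univ_pos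

theorem isProbabilityMeasure_sphereProb {d : ℕ} (hd : 1 ≤ d) :
    IsProbabilityMeasure (sphereProb d) := by
  constructor
  rw [sphereProb, Measure.smul_apply, smul_eq_mul,
    ENNReal.inv_mul_cancel (sphereVol_univ_ne_zero hd) (measure_ne_top _ _)]

theorem ae_norm_sphereProb (d : ℕ) : ∀ᵐ x ∂(sphereProb d), ‖x‖ = 1 :=
  Measure.ae_smul_measure ae_norm_sphereVol _

theorem sphereVol_eq_smul_sphereProb {d : ℕ} (hd : 1 ≤ d) :
    sphereVol (EuclideanSpace ℝ (Fin d)) =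
      sphereVol (EuclideanSpace ℝ (Fin d)) Set.univ • sphereProb d := by
  rw [sphereProb, smul_smul, ENNReal.mul_inv_cancel (sphereVol_univ_ne_zero hd)
    (measure_ne_top _ _), one_smul]

theorem sphereVol_hemisphere {d : ℕ} (hd : 1 ≤ d) {e : Esp d} (he : ‖e‖ = 1) :
    sphereVol (Esp d) {x | 0 < ⟪e, x⟫} =
      ENNReal.ofReal (Dfun d (π / 2)) * sphereVol (EuclideanSpace ℝ (Fin d)) Set.univ := by
  obtain ⟨ι, h1, -, hmp⟩ := exists_frame he
  have hm : MeasurableSet {x : Esp d | 0 < ⟪e, x⟫} :=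
    (isOpen_lt continuous_const (by fun_prop)).measurableSet
  rw [sphereVol_cone he h1 hmp hm (fun x hx t ht => ?_) (fun x hx => hx), ← lintegral_weight hd]
  · have : {w | e + ι w ∈ {x | 0 < ⟪e, x⟫}} = Set.univ := by
      ext w
      simp [inner_add_right, h1, he]
    rw [this, Measure.restrict_univ]
  · have hx' : 0 < ⟪e, x⟫ := hx
    simp only [Set.mem_ofPred_eq, inner_smul_right]
    positivity

theorem sphereVol_neg {E : Type*} [NormedAddCommGroup E] [InnerProductSpace ℝ E]
    [FiniteDimensional ℝ E] [MeasurableSpace E] [BorelSpace E] {s : Set E} (hs : MeasurableSet s) :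
    sphereVol E {x | -x ∈ s} = sphereVol E s := by
  conv_rhs => rw [← sphereVol_map (LinearIsometryEquiv.neg ℝ)]
  rw [Measure.map_apply (LinearIsometryEquiv.continuous _).measurable hs]
  rfl

theorem sphereVol_orthogonal {d : ℕ} {e : Esp d} (he : ‖e‖ = 1) :
    sphereVol (Esp d) {x | ⟪e, x⟫ = 0} = 0 := by
  rw [sphereVol_apply (isClosed_eq (by fun_prop) continuous_const).measurableSet]
  refine mul_eq_zero_of_right _ (measure_mono_null (t := ((innerSL ℝ e).ker : Set (Esp d)))
    (fun x hx => ?_) (Measure.addHaar_submodule _ _ fun h => ?_))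
  · obtain ⟨h0, -, h⟩ := hx
    simp only [Set.mem_ofPred_eq, inner_smul_right, mul_eq_zero, inv_eq_zero, norm_eq_zero, h0,
      false_or] at h
    simpa using h
  · have : e ∈ (innerSL ℝ e).ker := by rw [h]; trivial
    simp [he] at this

theorem sphereVol_univ_eq {d : ℕ} (hd : 1 ≤ d) :
    sphereVol (Esp d) Set.univ = 2 * (ENNReal.ofReal (Dfun d (π / 2)) *
      sphereVol (EuclideanSpace ℝ (Fin d)) Set.univ) := by
  obtain ⟨e, he⟩ := exists_norm_eq (Esp d) (zero_le_one' ℝ)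
  have hm : MeasurableSet {x : Esp d | 0 < ⟪e, x⟫} :=
    (isOpen_lt continuous_const (by fun_prop)).measurableSet
  have hu : (Set.univ : Set (Esp d)) = ({x | 0 < ⟪e, x⟫} ∪ {x | -x ∈ {x | 0 < ⟪e, x⟫}}) ∪
      {x | ⟪e, x⟫ = 0} := by
    ext x
    simp only [Set.mem_univ, Set.mem_union, Set.mem_ofPred_eq, inner_neg_right, Left.neg_pos_iff,
      true_iff]
    rcases lt_trichotomy 0 ⟪e, x⟫ with h | h | h
    · simp [h]
    · simp [h.symm]
    · simp [h]
  have h0 := sphereVol_orthogonal he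
  rw [hu, measure_congr (union_ae_eq_left_of_ae_eq_empty (ae_eq_empty.2 h0)), measure_union,
    sphereVol_neg hm,
    sphereVol_hemisphere hd he, two_mul]
  · rw [Set.disjoint_left]
    intro x hx hx'
    simp only [Set.mem_ofPred_eq, inner_neg_right] at hx hx'
    linarith
  · exact measurable_neg hm

/-- The spherical Hausdorff measure as a multiple of the cone measure. -/
theorem sigmaMeas_eq {d : ℕ} :
    sigmaMeas d = (sigmaMeas d (uSphere d) / sphereVol (Esp d) Set.univ) • sphereVol (Esp d) := by
  have : IsFiniteMeasure (sigmaMeas d) := ⟨by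
    rw [sigmaMeas, Measure.restrict_apply_univ]
    exact hausdorffMeasure_sphere_lt_top d⟩
  have hu : sigmaMeas d (uSphere d) = sigmaMeas d Set.univ := by
    rw [sigmaMeas, Measure.restrict_apply_univ, Measure.restrict_apply_self]
  rw [hu]
  exact eq_smul_sphereVol _ (ae_norm_hausdorff _) (map_hausdorff_restrict_sphere _)

instance (d : ℕ) : IsFiniteMeasure (sigmaMeas d) := ⟨by
  rw [sigmaMeas, Measure.restrict_apply_univ]
  exact hausdorffMeasure_sphere_lt_top d⟩

/-- The normalized spherical measure of a cone in terms of its radial function. -/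
theorem sigmaMeas_cone {d : ℕ} (hd : 1 ≤ d) {e : Esp d} (he : ‖e‖ = 1)
    {ι : EuclideanSpace ℝ (Fin d) →ₗᵢ[ℝ] Esp d} (h1 : ∀ v, ⟪e, ι v⟫ = 0)
    (hmp : MeasurePreserving (fun p : ℝ × EuclideanSpace ℝ (Fin d) => p.1 • e + ι p.2)
        (volume.prod volume) volume) {A : Set (Esp d)} (hA : MeasurableSet A)
    (hcone : ∀ x ∈ A, ∀ t : ℝ, 0 < t → t • x ∈ A) (hpos : ∀ x ∈ A, 0 < ⟪e, x⟫)
    {ρ : EuclideanSpace ℝ (Fin d) → ℝ} (hρm : Measurable ρ) (hρ : ∀ u, ‖u‖ = 1 → 0 ≤ ρ u)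
    (hin : ∀ u, ‖u‖ = 1 → ∀ r, 0 < r → r < ρ u → e + ι (r • u) ∈ A)
    (hout : ∀ u, ‖u‖ = 1 → ∀ r, 0 < r → e + ι (r • u) ∈ A → r ≤ ρ u) :
    (sigmaMeas d A).toReal =
      omegaTot d / 2 * ((∫ u, Jfun d (ρ u) ∂(sphereProb d)) / Dfun d (π / 2)) := by
  have hD := Dfun_pi_div_two_pos d
  have hL : MeasurableSet {w | e + ι w ∈ A} :=
    (show Measurable fun w => e + ι w from
      (continuous_const.add ι.continuous).measurable) hA
  have hInt : ∫ u, Jfun d (ρ u) ∂(sphereProb d) =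
      (∫⁻ u, ENNReal.ofReal (Jfun d (ρ u)) ∂(sphereProb d)).toReal := by
    refine integral_eq_lintegral_of_nonneg_ae ?_
      ((Jfun_continuous hd).measurable.comp hρm).aestronglyMeasurable
    filter_upwards [ae_norm_sphereProb d] with u hu using Jfun_nonneg hd (hρ u hu)
  rw [sigmaMeas_eq, Measure.smul_apply, smul_eq_mul, sphereVol_cone he h1 hmp hA hcone hpos,
    lintegral_weight_radial hd hL hρ hin hout, sphereVol_univ_eq hd,
    sphereVol_eq_smul_sphereProb hd, lintegral_smul_measure, hInt, omegaTot,
    ← sphereVol_eq_smul_sphereProb hd]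
  have hs0 : (sphereVol (EuclideanSpace ℝ (Fin d)) Set.univ).toReal ≠ 0 :=
    ENNReal.toReal_ne_zero.2 ⟨sphereVol_univ_ne_zero hd, measure_ne_top _ _⟩
  simp only [ENNReal.toReal_mul, ENNReal.toReal_div, smul_eq_mul, ENNReal.toReal_ofReal hD.le,
    ENNReal.toReal_ofNat]
  field_simp

theorem sigmaMeas_neg {d : ℕ} {s : Set (Esp d)} (hs : MeasurableSet s) :
    sigmaMeas d {x | -x ∈ s} = sigmaMeas d s := by
  rw [sigmaMeas_eq, Measure.smul_apply, Measure.smul_apply, sphereVol_neg hs]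

/-- The spherical measure of a cap, given through the cone over it. -/
theorem sigmaMeas_capCone {d : ℕ} (hd : 1 ≤ d) {e : Esp d} (he : ‖e‖ = 1) {s r : ℝ} (hs : 0 < s)
    (hr : 0 ≤ r) (hsr : s * √(1 + r ^ 2) = 1) {A : Set (Esp d)} (hA : MeasurableSet A)
    (hcone : ∀ x ∈ A, ∀ t : ℝ, 0 < t → t • x ∈ A) (hlo : ∀ x, s * ‖x‖ < ⟪e, x⟫ → x ∈ A)
    (hhi : ∀ x ∈ A, s * ‖x‖ ≤ ⟪e, x⟫ ∧ 0 < ⟪e, x⟫) :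
    (sigmaMeas d A).toReal = omegaTot d / 2 * (Jfun d r / Dfun d (π / 2)) := by
  obtain ⟨ι, h1, -, hmp⟩ := exists_frame he
  have hP := isProbabilityMeasure_sphereProb hd
  have hin : ∀ w, ⟪e, e + ι w⟫ = 1 := fun w => by
    rw [inner_add_right, h1, real_inner_self_eq_norm_sq, he]; simp
  have hnorm : ∀ u : EuclideanSpace ℝ (Fin d), ‖u‖ = 1 → ∀ t : ℝ, 0 < t →
      ‖e + ι (t • u)‖ = √(1 + t ^ 2) := fun u hu t ht => by
    rw [norm_add_frame he h1, norm_smul, hu, mul_one, Real.norm_of_nonneg ht.le]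
  have h := sigmaMeas_cone hd he h1 hmp hA hcone (fun x hx => (hhi x hx).2) (ρ := fun _ => r)
    measurable_const (fun _ _ => hr) (fun u hu t ht htr => hlo _ ?_) (fun u hu t ht hm => ?_)
  · rwa [integral_const, probReal_univ, one_smul] at h
  · rw [hnorm u hu t ht, hin]
    refine lt_of_lt_of_eq ?_ hsr
    have : √(1 + t ^ 2) < √(1 + r ^ 2) := Real.sqrt_lt_sqrt (by positivity) (by nlinarith)
    gcongr
  · have h2 := (hhi _ hm).1
    rw [hnorm u hu t ht, hin, ← hsr, mul_le_mul_iff_right₀ hs,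
      Real.sqrt_le_sqrt_iff (by positivity)] at h2
    nlinarith

theorem sigmaMeas_openCap {d : ℕ} (hd : 1 ≤ d) {e : Esp d} (he : ‖e‖ = 1) {α : ℝ} (hα : 0 < α)
    (hα' : α < π / 2) : (sigmaMeas d {x | sin α * ‖x‖ < ⟪e, x⟫}).toReal =
      omegaTot d / 2 * (Jfun d (tan α)⁻¹ / Dfun d (π / 2)) := by
  have hs := sin_pos_of_pos_of_lt_pi hα (by linarith [pi_pos])
  have hc := cos_pos_of_mem_Ioo ⟨by linarith, hα'⟩
  refine sigmaMeas_capCone hd he hs (by rw [tan_eq_sin_div_cos]; positivity) ?_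
    (isOpen_lt (by fun_prop) (by fun_prop)).measurableSet (fun x hx t ht => ?_) (fun x hx => hx)
    (fun x hx => ⟨le_of_lt hx, lt_of_le_of_lt (by positivity) hx⟩)
  · have : 1 + (tan α)⁻¹ ^ 2 = (sin α)⁻¹ ^ 2 := by
      rw [tan_eq_sin_div_cos, inv_div]
      field_simp
      exact sin_sq_add_cos_sq α
    rw [this, Real.sqrt_sq (by positivity), mul_inv_cancel₀ hs.ne']
  · simp only [Set.mem_ofPred_eq, norm_smul, inner_smul_right, Real.norm_of_nonneg ht.le] at hx ⊢
    nlinarith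

theorem sigmaMeas_cap {d : ℕ} (hd : 1 ≤ d) {e : Esp d} (he : e ∈ uSphere d) {α : ℝ} (hα : 0 < α)
    (hα' : α < π / 2) : (sigmaMeas d (cap e α)).toReal =
      omegaTot d / 2 * (Jfun d (tan α) / Dfun d (π / 2)) := by
  have he1 : ‖e‖ = 1 := by simpa [uSphere] using he
  have hs := sin_pos_of_pos_of_lt_pi hα (by linarith [pi_pos])
  have hc := cos_pos_of_mem_Ioo ⟨by linarith, hα'⟩
  have hSm : MeasurableSet (uSphere d) := Metric.isClosed_sphere.measurableSet
  have hcap : sigmaMeas d (cap e α) = sigmaMeas d {x | cos α * ‖x‖ ≤ ⟪e, x⟫ ∧ 0 < ⟪e, x⟫} := by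
    rw [sigmaMeas, Measure.restrict_apply' hSm, Measure.restrict_apply' hSm]
    congr 1
    ext x
    simp only [Set.mem_inter_iff, cap, Set.mem_ofPred_eq, and_assoc]
    refine ⟨fun ⟨hx, hg, _⟩ => ?_, fun ⟨h1, h2, hx⟩ => ⟨hx, ?_, hx⟩⟩
    · have hx1 : ‖x‖ = 1 := by simpa [uSphere] using hx
      have h6 := abs_real_inner_le_norm x e
      rw [hx1, he1, mul_one, abs_le] at h6
      have := cos_le_cos_of_nonneg_of_le_pi (arccos_nonneg _) (by linarith [pi_pos]) hg
      rw [cos_arccos h6.1 h6.2, real_inner_comm] at this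
      exact ⟨by rwa [hx1, mul_one], by linarith, hx⟩
    · have hx1 : ‖x‖ = 1 := by simpa [uSphere] using hx
      rw [hx1, mul_one, real_inner_comm] at h1
      have := arccos_le_arccos h1
      rwa [arccos_cos hα.le (by linarith [pi_pos])] at this
  have hm : MeasurableSet {x : Esp d | cos α * ‖x‖ ≤ ⟪e, x⟫ ∧ 0 < ⟪e, x⟫} :=
    (isClosed_le (f := fun x : Esp d => cos α * ‖x‖) (g := fun x => ⟪e, x⟫) (by fun_prop)
      (by fun_prop)).measurableSet.inter (isOpen_lt (f := fun _ : Esp d => (0:ℝ))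
        (g := fun x => ⟪e, x⟫) (by fun_prop) (by fun_prop)).measurableSet
  rw [hcap]
  refine sigmaMeas_capCone hd he1 hc (by rw [tan_eq_sin_div_cos]; positivity) ?_ hm
    (fun x hx t ht => ?_)
    (fun x hx => ⟨hx.le, lt_of_le_of_lt (by positivity) hx⟩) (fun x hx => hx)
  · have : 1 + tan α ^ 2 = (cos α)⁻¹ ^ 2 := by
      rw [tan_eq_sin_div_cos]
      field_simp
      rw [add_comm]
      exact sin_sq_add_cos_sq α
    rw [this, Real.sqrt_sq (by positivity), mul_inv_cancel₀ hc.ne']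
  · simp only [Set.mem_ofPred_eq, norm_smul, inner_smul_right, Real.norm_of_nonneg ht.le] at hx ⊢
    exact ⟨by nlinarith [hx.1], mul_pos ht hx.2⟩

theorem sigmaMeas_real_univ (d : ℕ) : (sigmaMeas d).real Set.univ = omegaTot d := by
  rw [omegaTot, measureReal_def, sigmaMeas, Measure.restrict_apply_univ,
    Measure.restrict_apply_self]

/-- The mean width functional of a cap is at most the measure of the corresponding belt. -/
theorem U1_cap_le {d : ℕ} (hd : 1 ≤ d) {e : Esp d} (he : e ∈ uSphere d) {α : ℝ} (hα : 0 < α)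
    (hα' : α < π / 2) (hω : 0 < omegaTot d) :
    U1 d (cap e α) ≤ (1 / 2) * (1 - Jfun d (tan α)⁻¹ / Dfun d (π / 2)) := by
  have he1 : ‖e‖ = 1 := by simpa [uSphere] using he
  have hD := Dfun_pi_div_two_pos d
  have hs := sin_pos_of_pos_of_lt_pi hα (by linarith [pi_pos])
  have hc := cos_pos_of_mem_Ioo ⟨by linarith, hα'⟩
  set A : Set (Esp d) := {x | sin α * ‖x‖ < ⟪e, x⟫} with hAdef
  have hA : MeasurableSet A := (isOpen_lt (by fun_prop) (by fun_prop)).measurableSet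
  have hpos : ∀ x ∈ A, 0 < ⟪e, x⟫ := fun x hx => lt_of_le_of_lt (by positivity) hx
  have hvol := sigmaMeas_openCap hd he1 hα hα'
  set H := {x | ∃ y ∈ cap e α, ⟪x, y⟫ = 0} with hH
  have hdisj : Disjoint A {x | -x ∈ A} := by
    rw [Set.disjoint_left]
    intro x hx hx'
    have h2 := hpos _ hx
    have h3 := hpos _ hx'
    rw [inner_neg_right] at h3
    linarith
  have hAU : MeasurableSet (A ∪ {x | -x ∈ A}) := hA.union (measurable_neg hA)
  have hsub : H ∩ uSphere d ⊆ uSphere d \ (A ∪ {x | -x ∈ A}) := by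
    rintro x ⟨⟨y, hy, hxy⟩, hxS⟩
    refine ⟨hxS, ?_⟩
    have hx1 : ‖x‖ = 1 := by simpa [uSphere] using hxS
    have hy1 : ‖y‖ = 1 := by simpa [uSphere] using hy.1
    have hcy : cos α ≤ ⟪y, e⟫ := by
      have h5 : geo y e ≤ α := hy.2
      have h6 := abs_real_inner_le_norm y e
      rw [hy1, he1, mul_one, abs_le] at h6
      have := cos_le_cos_of_nonneg_of_le_pi (arccos_nonneg _) (by linarith [pi_pos]) h5
      rwa [cos_arccos h6.1 h6.2] at this
    have hB : ⟪e, x⟫ ^ 2 + ⟪y, e⟫ ^ 2 ≤ 1 := by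
      have h7 : 0 ≤ ‖e - ⟪e, x⟫ • x - ⟪y, e⟫ • y‖ ^ 2 := by positivity
      rw [← real_inner_self_eq_norm_sq] at h7
      simp only [inner_sub_left, inner_sub_right, inner_smul_left, inner_smul_right,
        real_inner_self_eq_norm_sq, he1, hx1, hy1, real_inner_comm e x, real_inner_comm e y,
        hxy, real_inner_comm x y, RCLike.conj_to_real] at h7
      nlinarith [real_inner_comm y e]
    have hle : ⟪e, x⟫ ^ 2 ≤ sin α ^ 2 := by nlinarith [sin_sq_add_cos_sq α]
    have hab := abs_le_of_sq_le_sq' hle hs.le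
    simp only [hAdef, Set.mem_union, Set.mem_ofPred_eq, norm_neg, hx1, inner_neg_right, not_or,
      not_lt, mul_one]
    exact ⟨hab.2, by linarith [hab.1]⟩
  have hSm : MeasurableSet (uSphere d) := Metric.isClosed_sphere.measurableSet
  have hHS : sigmaMeas d H ≤ sigmaMeas d (uSphere d \ (A ∪ {x | -x ∈ A})) := by
    rw [sigmaMeas, Measure.restrict_apply' hSm, Measure.restrict_apply' hSm]
    exact measure_mono fun x hx => ⟨hsub hx, hx.2⟩
  have hfull : sigmaMeas d (uSphere d \ (A ∪ {x | -x ∈ A})) =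
      sigmaMeas d (A ∪ {x | -x ∈ A})ᶜ := by
    rw [sigmaMeas, Measure.restrict_apply' hSm, Measure.restrict_apply' hSm]
    congr 1
    ext x
    simp only [Set.mem_inter_iff, Set.mem_sdiff, Set.mem_compl_iff, uSphere]
    tauto
  have hreal : (sigmaMeas d H).toReal ≤ omegaTot d - 2 * (sigmaMeas d A).toReal := by
    refine (ENNReal.toReal_mono (measure_ne_top _ _) (hHS.trans_eq hfull)).trans_eq ?_
    have h8 := measureReal_compl (μ := sigmaMeas d) hAU
    have h9 := measureReal_union (μ := sigmaMeas d) hdisj (measurable_neg hA)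
    have h10 : (sigmaMeas d).real {x | -x ∈ A} = (sigmaMeas d).real A := by
      rw [measureReal_def, sigmaMeas_neg hA, measureReal_def]
    have h9' : (sigmaMeas d).real (A ∪ {x | -x ∈ A}) = 2 * (sigmaMeas d).real A := by
      rw [two_mul]; nth_rewrite 2 [← h10]; exact h9
    rw [sigmaMeas_real_univ, h9'] at h8
    exact h8
  rw [U1]
  calc 1 / (2 * omegaTot d) * (sigmaMeas d H).toReal
      ≤ 1 / (2 * omegaTot d) * (omegaTot d - 2 * (sigmaMeas d A).toReal) := by gcongr
    _ = _ := by rw [hvol]; field_simp; try ring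

theorem exists_cover_of_hausdorffMeasure {X : Type*} [MetricSpace X] [MeasurableSpace X]
    [BorelSpace X] {m : ℕ} (hm : 1 ≤ m) {S : Set X} (hS : μH[(m:ℝ)] S ≠ ∞) {r : ℝ} (hr : 0 < r) :
    ∃ (A : ℕ → Set X) (δ : ℕ → ℝ), S ⊆ ⋃ i, A i ∧ (∀ i, 0 < δ i ∧ δ i ≤ 2 * r ∧
      Metric.ediam (A i) ≤ ENNReal.ofReal (δ i)) ∧
      ∑' i, ENNReal.ofReal (δ i ^ m) ≤ μH[(m:ℝ)] S + ENNReal.ofReal (2 * r) := by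
  have hr' : 0 < ENNReal.ofReal r := ENNReal.ofReal_pos.2 hr
  have h1 := le_of_eq (Measure.hausdorffMeasure_apply (m:ℝ) S).symm
  have h2 := ((le_iSup₂ (f := fun (r : ℝ≥0∞) (_ : 0 < r) =>
    ⨅ (t : ℕ → Set X) (_ : S ⊆ ⋃ n, t n) (_ : ∀ n, Metric.ediam (t n) ≤ r),
      ∑' n, ⨆ _ : (t n).Nonempty, Metric.ediam (t n) ^ (m:ℝ)) (ENNReal.ofReal r) hr').trans
        h1).trans_lt (ENNReal.lt_add_right hS hr'.ne')
  simp only [iInf_lt_iff] at h2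
  obtain ⟨A, hcov, hdiam, hsum⟩ := h2
  obtain ⟨w, hw, hwsum⟩ := ENNReal.exists_pos_sum_of_countable hr'.ne' ℕ
  have hfin : ∀ i, Metric.ediam (A i) ≠ ∞ := fun i =>
    ((hdiam i).trans_lt ENNReal.ofReal_lt_top).ne
  have hη : ∀ i, ∃ η : ℝ, 0 < η ∧ η ≤ r ∧ ((Metric.ediam (A i)).toReal + η) ^ m ≤
      (Metric.ediam (A i)).toReal ^ m + w i := by
    intro i
    have hc : Tendsto (fun η : ℝ => ((Metric.ediam (A i)).toReal + η) ^ m) (𝓝[>] 0)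
        (𝓝 ((Metric.ediam (A i)).toReal ^ m)) := by
      have : Continuous fun η : ℝ => ((Metric.ediam (A i)).toReal + η) ^ m := by fun_prop
      have h3 := this.tendsto 0
      rw [add_zero] at h3
      exact h3.mono_left nhdsWithin_le_nhds
    have h4 : ∀ᶠ η in 𝓝[>] (0:ℝ), ((Metric.ediam (A i)).toReal + η) ^ m <
        (Metric.ediam (A i)).toReal ^ m + w i :=
      hc.eventually_lt_const (by have := hw i; simpa using this)
    obtain ⟨η, h5, h6⟩ := (h4.and (Ioc_mem_nhdsGT hr)).exists
    exact ⟨η, h6.1, h6.2, h5.le⟩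
  choose η hη0 hηr hηm using hη
  refine ⟨A, fun i => (Metric.ediam (A i)).toReal + η i, hcov, fun i => ⟨?_, ?_, ?_⟩, ?_⟩
  · have := hη0 i
    positivity
  · have := ENNReal.toReal_le_of_le_ofReal hr.le (hdiam i)
    linarith [hηr i]
  · rw [← ENNReal.toReal_le_toReal (hfin i) ENNReal.ofReal_ne_top, ENNReal.toReal_ofReal]
    · linarith [hη0 i]
    · have := hη0 i
      positivity
  · calc ∑' i, ENNReal.ofReal (((Metric.ediam (A i)).toReal + η i) ^ m)
        ≤ ∑' i, ((⨆ _ : (A i).Nonempty, Metric.ediam (A i) ^ (m:ℝ)) + w i) := by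
          refine ENNReal.tsum_le_tsum fun i => ?_
          refine (ENNReal.ofReal_le_ofReal (hηm i)).trans ?_
          rw [ENNReal.ofReal_add (by positivity) (by positivity), ENNReal.ofReal_coe_nnreal,
            ENNReal.ofReal_pow (by positivity), ENNReal.ofReal_toReal (hfin i)]
          gcongr
          rcases (A i).eq_empty_or_nonempty with h | h
          · simp [h, show m ≠ 0 by omega]
          · simp [h]
      _ ≤ (μH[(m:ℝ)] S + ENNReal.ofReal r) + ENNReal.ofReal r := by
          rw [ENNReal.tsum_add]
          gcongr
      _ = _ := by
          rw [add_assoc, ← ENNReal.ofReal_add hr.le hr.le, two_mul]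

theorem hausdorffMeasure_image_prod_Icc_le {X Z : Type*} [MetricSpace X] [MeasurableSpace X]
    [BorelSpace X] [MetricSpace Z] [MeasurableSpace Z] [BorelSpace Z] {m : ℕ} (hm : 1 ≤ m)
    {S : Set X} (hS : μH[(m:ℝ)] S ≠ ∞) {p : X × ℝ → Z}
    {Δ s : ℝ} (hΔ : 0 < Δ) (hs : 0 < s)
    (hp : ∀ x ∈ S, ∀ y ∈ S, ∀ φ ψ, dist (p (x, φ)) (p (y, ψ)) ^ 2 ≤ dist x y ^ 2 + (φ - ψ) ^ 2) :
    μH[((m + 1 : ℕ) : ℝ)] (p '' (S ×ˢ Set.Icc (-Δ) Δ)) ≤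
      ENNReal.ofReal (√(1 + s ^ 2) ^ (m + 1) * (2 * Δ / s)) * μH[(m:ℝ)] S := by
  set c := √(1 + s ^ 2) with hc
  have hc0 : 0 < c := Real.sqrt_pos.2 (by positivity)
  have hr : ∀ n : ℕ, (0:ℝ) < 1 / ((n:ℝ) + 1) := fun n => by positivity
  choose A δ hcov hδ hsum using fun n : ℕ => exists_cover_of_hausdorffMeasure hm hS (hr n)
  have hlim0 : Tendsto (fun n : ℕ => (1:ℝ) / ((n:ℝ) + 1)) atTop (𝓝 0) :=
    tendsto_one_div_add_atTop_nhds_zero_nat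
  set t : ℕ → ℕ × ℕ → Set Z := fun n ij =>
    if ij.2 < ⌈2 * Δ / (s * δ n ij.1)⌉₊ then
      p '' ((A n ij.1 ∩ S) ×ˢ Set.Icc (-Δ + ij.2 * (s * δ n ij.1))
        (-Δ + (ij.2 + 1) * (s * δ n ij.1)))
    else ∅ with ht
  have hdiam : ∀ n ij, Metric.ediam (t n ij) ≤ ENNReal.ofReal (c * δ n ij.1) := by
    intro n ij
    obtain ⟨hδ0, hδr, hδA⟩ := hδ n ij.1
    simp only [ht]
    split_ifs
    · refine Metric.ediam_le ?_
      rintro _ ⟨⟨x, φ⟩, ⟨⟨hxA, hxS⟩, hφ⟩, rfl⟩ _ ⟨⟨y, ψ⟩, ⟨⟨hyA, hyS⟩, hψ⟩, rfl⟩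
      rw [edist_dist]
      refine ENNReal.ofReal_le_ofReal (abs_le_of_sq_le_sq' ?_ (by positivity)).2
      have hxy : dist x y ≤ δ n ij.1 := by
        have := (Metric.edist_le_ediam_of_mem hxA hyA).trans hδA
        rwa [edist_dist, ENNReal.ofReal_le_ofReal_iff hδ0.le] at this
      have hφψ : |φ - ψ| ≤ s * δ n ij.1 := by
        have h1 := hφ.1
        have h2 := hφ.2
        have h3 := hψ.1
        have h4 := hψ.2
        simp only at h1 h2 h3 h4
        rw [abs_le]
        constructor <;> nlinarith
      calc _ ≤ dist x y ^ 2 + (φ - ψ) ^ 2 := hp x hxS y hyS φ ψ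
        _ ≤ δ n ij.1 ^ 2 + (s * δ n ij.1) ^ 2 := by
          rw [← sq_abs (φ - ψ)]
          gcongr
        _ = (c * δ n ij.1) ^ 2 := by
          rw [mul_pow c, hc, Real.sq_sqrt (by positivity)]; ring
    · simp
  have hcover : ∀ n, p '' (S ×ˢ Set.Icc (-Δ) Δ) ⊆ ⋃ ij, t n ij := by
    rintro n _ ⟨⟨x, φ⟩, ⟨hxS, hφ⟩, rfl⟩
    obtain ⟨i, hi⟩ := Set.mem_iUnion.1 (hcov n hxS)
    obtain ⟨hδ0, -, -⟩ := hδ n i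
    have hl : 0 < s * δ n i := by positivity
    simp only at hxS hφ
    have hφ0 : 0 ≤ φ + Δ := by linarith [hφ.1]
    have hN : 0 < 2 * Δ / (s * δ n i) := by positivity
    have hle : (φ + Δ) / (s * δ n i) ≤ ⌈2 * Δ / (s * δ n i)⌉₊ :=
      (by gcongr; linarith [hφ.2] : (φ + Δ) / (s * δ n i) ≤ 2 * Δ / (s * δ n i)).trans
        (Nat.le_ceil _)
    obtain ⟨j, hj1, hj2, hj3⟩ : ∃ j : ℕ, j < ⌈2 * Δ / (s * δ n i)⌉₊ ∧
        (j:ℝ) ≤ (φ + Δ) / (s * δ n i) ∧ (φ + Δ) / (s * δ n i) ≤ j + 1 := by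
      set N := ⌈2 * Δ / (s * δ n i)⌉₊ with hNdef
      have hNpos : 0 < N := Nat.ceil_pos.2 hN
      by_cases h : ⌊(φ + Δ) / (s * δ n i)⌋₊ < N
      · exact ⟨_, h, Nat.floor_le (by positivity), (Nat.lt_floor_add_one _).le⟩
      · have h5 : (N:ℝ) ≤ (φ + Δ) / (s * δ n i) :=
          (Nat.le_floor_iff (by positivity)).1 (not_lt.1 h)
        refine ⟨N - 1, by omega, ?_, ?_⟩ <;> rw [Nat.cast_sub hNpos] <;> push_cast <;> linarith
    refine Set.mem_iUnion.2 ⟨(i, j), ?_⟩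
    simp only [ht, hj1, if_true]
    rw [le_div_iff₀ hl] at hj2
    rw [div_le_iff₀ hl] at hj3
    exact ⟨(x, φ), ⟨⟨hi, hxS⟩, by simp only; linarith, by simp only; linarith⟩, rfl⟩
  have hbound : ∀ n : ℕ, ∑' ij, Metric.ediam (t n ij) ^ ((m + 1 : ℕ) : ℝ) ≤
      ENNReal.ofReal (c ^ (m + 1) * (2 * Δ / s + 2 * (1 / ((n:ℝ) + 1)))) *
        (μH[(m:ℝ)] S + ENNReal.ofReal (2 * (1 / ((n:ℝ) + 1)))) := by
    intro n
    rw [ENNReal.tsum_prod' (f := fun ij => Metric.ediam (t n ij) ^ ((m + 1 : ℕ) : ℝ))]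
    refine le_trans ?_ (mul_le_mul_right (hsum n) _)
    rw [← ENNReal.tsum_mul_left]
    refine ENNReal.tsum_le_tsum fun i => ?_
    obtain ⟨hδ0, hδr, -⟩ := hδ n i
    set N := ⌈2 * Δ / (s * δ n i)⌉₊ with hNdef
    rw [tsum_eq_sum (s := Finset.range N)]
    · calc ∑ j ∈ Finset.range N, Metric.ediam (t n (i, j)) ^ ((m + 1 : ℕ) : ℝ)
          ≤ ∑ j ∈ Finset.range N, ENNReal.ofReal ((c * δ n i) ^ (m + 1)) := by
            refine Finset.sum_le_sum fun j _ => ?_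
            rw [ENNReal.rpow_natCast, ENNReal.ofReal_pow (by positivity)]
            gcongr
            exact hdiam n (i, j)
        _ = ENNReal.ofReal (N * (c * δ n i) ^ (m + 1)) := by
            rw [Finset.sum_const, Finset.card_range, nsmul_eq_mul,
              ENNReal.ofReal_mul (by positivity),
              ENNReal.ofReal_natCast]
        _ ≤ _ := by
            rw [← ENNReal.ofReal_mul (by positivity)]
            refine ENNReal.ofReal_le_ofReal ?_
            have hN1 : (N:ℝ) ≤ 2 * Δ / (s * δ n i) + 1 := (Nat.ceil_lt_add_one (by positivity)).le
            calc (N:ℝ) * (c * δ n i) ^ (m + 1)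
                ≤ (2 * Δ / (s * δ n i) + 1) * (c * δ n i) ^ (m + 1) := by gcongr
              _ = c ^ (m + 1) * (2 * Δ / s + δ n i) * δ n i ^ m := by
                  field_simp
                  ring
              _ ≤ _ := by gcongr
    · intro j hj
      have : t n (i, j) = ∅ := by
        simp only [ht]
        rw [if_neg (by rwa [Finset.mem_range] at hj)]
      rw [this, ENNReal.rpow_natCast]
      simp
  have hr0 : Tendsto (fun n : ℕ => ENNReal.ofReal (c * (2 * (1 / ((n:ℝ) + 1))))) atTop (𝓝 0) := by
    have := ((hlim0.const_mul 2).const_mul c)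
    simp only [mul_zero] at this
    simpa using ENNReal.tendsto_ofReal this
  have hlim : Tendsto (fun n : ℕ =>
      ENNReal.ofReal (c ^ (m + 1) * (2 * Δ / s + 2 * (1 / ((n:ℝ) + 1)))) *
        (μH[(m:ℝ)] S + ENNReal.ofReal (2 * (1 / ((n:ℝ) + 1))))) atTop
      (𝓝 (ENNReal.ofReal (c ^ (m + 1) * (2 * Δ / s)) * μH[(m:ℝ)] S)) := by
    refine ENNReal.Tendsto.mul (ENNReal.tendsto_ofReal ?_) (Or.inr hS) ?_
      (Or.inr ENNReal.ofReal_ne_top)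
    · simpa using ((hlim0.const_mul 2).const_add (2 * Δ / s)).const_mul (c ^ (m + 1))
    · simpa using tendsto_const_nhds.add (ENNReal.tendsto_ofReal (hlim0.const_mul 2))
  refine (Measure.hausdorffMeasure_le_liminf_tsum _ _ _ hr0 t (Eventually.of_forall fun n ij => ?_)
    (Eventually.of_forall hcover)).trans ?_
  · refine (hdiam n ij).trans (ENNReal.ofReal_le_ofReal ?_)
    have := (hδ n ij.1).2.1
    gcongr
  · rw [← hlim.liminf_eq]
    exact liminf_le_liminf (Eventually.of_forall hbound)

theorem hausdorffMeasure_sphere_ne_top {d : ℕ} (hd : 1 ≤ d) :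
    μH[(d:ℝ) - 1] (Metric.sphere (0 : EuclideanSpace ℝ (Fin d)) 1) ≠ ∞ := by
  obtain ⟨m, rfl⟩ := Nat.exists_eq_add_of_le' hd
  have := (hausdorffMeasure_sphere_lt_top m).ne
  push_cast
  rwa [add_sub_cancel_right]

theorem hausdorffMeasure_belt_le {d : ℕ} (hd : 2 ≤ d) {e : Esp d} (he : ‖e‖ = 1) {Δ s : ℝ}
    (hΔ : 0 < Δ) (hΔ' : Δ < π / 2) (hs : 0 < s) :
    (sigmaMeas d {x | |⟪e, x⟫| ≤ sin Δ}).toReal ≤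
      √(1 + s ^ 2) ^ d * (2 * Δ / s) * omegaSm d := by
  obtain ⟨m, rfl⟩ := Nat.exists_eq_add_of_le' (show 1 ≤ d by omega)
  obtain ⟨ι, h1, h2, -⟩ := exists_frame he
  have hfin := hausdorffMeasure_sphere_ne_top (d := m + 1) (by omega)
  rw [omegaSm]
  rw [show ((m + 1 : ℕ) : ℝ) - 1 = m by push_cast; ring] at hfin ⊢
  set p : EuclideanSpace ℝ (Fin (m + 1)) × ℝ → Esp (m + 1) :=
    fun q => cos q.2 • ι q.1 + sin q.2 • e with hp
  have hdist : ∀ x ∈ Metric.sphere (0 : EuclideanSpace ℝ (Fin (m + 1))) 1,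
      ∀ y ∈ Metric.sphere (0 : EuclideanSpace ℝ (Fin (m + 1))) 1, ∀ φ ψ,
      dist (p (x, φ)) (p (y, ψ)) ^ 2 ≤ dist x y ^ 2 + (φ - ψ) ^ 2 := by
    intro x hx y hy φ ψ
    rw [mem_sphere_zero_iff_norm] at hx hy
    have hi1 : ∀ v, ⟪ι v, e⟫ = 0 := fun v => by rw [real_inner_comm, h1]
    have hd1 : dist (p (x, φ)) (p (y, ψ)) ^ 2 =
        2 - 2 * (cos φ * cos ψ * ⟪x, y⟫) - 2 * (sin φ * sin ψ) := by
      rw [dist_eq_norm, ← real_inner_self_eq_norm_sq]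
      simp only [hp, inner_sub_left, inner_sub_right, inner_add_left, inner_add_right,
        inner_smul_left, inner_smul_right, h1, hi1, real_inner_self_eq_norm_sq, he,
        ι.inner_map_map, hx, hy, RCLike.conj_to_real, real_inner_comm x y]
      nlinarith [sin_sq_add_cos_sq φ, sin_sq_add_cos_sq ψ]
    have hd2 : dist x y ^ 2 = 2 - 2 * ⟪x, y⟫ := by
      rw [dist_eq_norm, norm_sub_sq_real, hx, hy]; ring
    have hd3 : 0 ≤ dist x y ^ 2 := by positivity
    have h4 := one_sub_sq_div_two_le_cos (x := φ - ψ)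
    rw [cos_sub] at h4
    have h5 : cos φ * cos ψ ≤ 1 := by
      have := cos_sq_add_sin_sq φ
      have := cos_sq_add_sin_sq ψ
      nlinarith [sq_nonneg (cos φ - cos ψ), sq_nonneg (sin φ), sq_nonneg (sin ψ)]
    rw [hd2] at hd3
    rw [hd1, hd2]
    nlinarith
  have himg := hausdorffMeasure_image_prod_Icc_le (show 1 ≤ m by omega) hfin hΔ hs hdist
  have hsub : {x : Esp (m + 1) | |⟪e, x⟫| ≤ sin Δ} ∩ uSphere (m + 1) ⊆
      p '' (Metric.sphere (0 : EuclideanSpace ℝ (Fin (m + 1))) 1 ×ˢ Set.Icc (-Δ) Δ) := by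
    rintro x ⟨hx, hxS⟩
    have hx1 : ‖x‖ = 1 := by simpa [uSphere] using hxS
    rw [Set.mem_ofPred_eq, abs_le] at hx
    have hsin : sin Δ < 1 := by
      rw [← sin_pi_div_two]
      exact sin_lt_sin_of_lt_of_le_pi_div_two (by linarith) le_rfl hΔ'
    obtain ⟨v, hv⟩ := h2 (x - ⟪e, x⟫ • e) (by
      rw [inner_sub_right, inner_smul_right, real_inner_self_eq_norm_sq, he]; ring)
    have hvn : ‖v‖ ^ 2 = 1 - ⟪e, x⟫ ^ 2 := by
      rw [← ι.norm_map, hv, norm_sub_sq_real, norm_smul, he, hx1, inner_smul_right,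
        real_inner_comm]
      simp only [norm_eq_abs, mul_one, sq_abs]
      ring
    have hcv : cos (arcsin ⟪e, x⟫) = ‖v‖ := by
      rw [cos_arcsin, ← hvn, Real.sqrt_sq (norm_nonneg _)]
    have hv0 : 0 < ‖v‖ := by
      rw [norm_pos_iff]
      rintro rfl
      rw [norm_zero] at hvn
      nlinarith
    refine ⟨(‖v‖⁻¹ • v, arcsin ⟪e, x⟫), ⟨?_, ?_, ?_⟩, ?_⟩
    · rw [mem_sphere_zero_iff_norm, norm_smul, norm_inv, norm_norm, inv_mul_cancel₀ hv0.ne']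
    · rw [le_arcsin_iff_sin_le ⟨by linarith, by linarith⟩ ⟨by linarith, by linarith⟩, sin_neg]
      exact hx.1
    · rw [arcsin_le_iff_le_sin ⟨by linarith, by linarith⟩ ⟨by linarith, by linarith⟩]
      exact hx.2
    · simp only [hp]
      rw [hcv, map_smul, smul_smul, mul_inv_cancel₀ hv0.ne', one_smul, hv,
        sin_arcsin (by linarith) (by linarith)]
      abel
  have hSm : MeasurableSet (uSphere (m + 1)) := Metric.isClosed_sphere.measurableSet
  rw [sigmaMeas, Measure.restrict_apply' hSm]
  have hle := ENNReal.toReal_mono (ENNReal.mul_ne_top ENNReal.ofReal_ne_top hfin)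
    ((measure_mono hsub).trans himg)
  rwa [ENNReal.toReal_mul, ENNReal.toReal_ofReal (by positivity)] at hle

theorem omegaTot_le {d : ℕ} (hd : 2 ≤ d) {s : ℝ} (hs : 0 < s) :
    omegaTot d ≤ 2 * Dfun d (π / 2) * (√(1 + s ^ 2) ^ d / s) * omegaSm d := by
  obtain ⟨e, he⟩ := exists_norm_eq (Esp d) (zero_le_one' ℝ)
  have hD := Dfun_pi_div_two_pos d
  have key : ∀ Δ : ℝ, 0 < Δ → Δ < π / 2 → omegaTot d * cos Δ ^ (d - 1) ≤
      2 * Dfun d (π / 2) * (√(1 + s ^ 2) ^ d / s) * omegaSm d := by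
    intro Δ hΔ hΔ'
    set A : Set (Esp d) := {x | sin Δ * ‖x‖ < ⟪e, x⟫} with hAdef
    have hA : MeasurableSet A := (isOpen_lt (by fun_prop) (by fun_prop)).measurableSet
    have hvol := sigmaMeas_openCap (show 1 ≤ d by omega) he hΔ hΔ'
    have hbelt := hausdorffMeasure_belt_le hd he hΔ hΔ' hs
    have h1 : (sigmaMeas d).real Set.univ ≤ (sigmaMeas d).real A + (sigmaMeas d).real {x | -x ∈ A}
        + (sigmaMeas d).real {x | |⟪e, x⟫| ≤ sin Δ} := by
      have hnull : sigmaMeas d (uSphere d)ᶜ = 0 := by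
        have hSm : MeasurableSet (uSphere d) := Metric.isClosed_sphere.measurableSet
        rw [sigmaMeas, Measure.restrict_apply hSm.compl, Set.compl_inter_self, measure_empty]
      calc (sigmaMeas d).real Set.univ ≤ (sigmaMeas d).real
            ((((A ∪ {x | -x ∈ A}) ∪ {x | |⟪e, x⟫| ≤ sin Δ})) ∪ (uSphere d)ᶜ) := by
            refine measureReal_mono fun x _ => ?_
            by_cases hx : x ∈ uSphere d
            · left
              have hx1 : ‖x‖ = 1 := by simpa [uSphere] using hx
              simp only [hAdef, Set.mem_union, Set.mem_ofPred_eq, hx1, norm_neg, inner_neg_right,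
                mul_one, abs_le]
              by_contra! h
              obtain ⟨⟨h1, h2⟩, h3⟩ := h
              linarith [h3 (by linarith)]
            · exact Or.inr hx
        _ ≤ (sigmaMeas d).real ((A ∪ {x | -x ∈ A}) ∪ {x | |⟪e, x⟫| ≤ sin Δ}) +
            (sigmaMeas d).real (uSphere d)ᶜ := measureReal_union_le _ _
        _ ≤ _ := by
            rw [measureReal_def (s := (uSphere d)ᶜ), hnull, ENNReal.toReal_zero, add_zero]
            refine (measureReal_union_le _ _).trans ?_
            gcongr
            exact measureReal_union_le _ _
    have h10 : (sigmaMeas d).real {x | -x ∈ A} = (sigmaMeas d).real A := by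
      rw [measureReal_def, sigmaMeas_neg hA, measureReal_def]
    rw [sigmaMeas_real_univ, h10] at h1
    have hJ : Δ * cos Δ ^ (d - 1) ≤ Dfun d (π / 2) - Jfun d (tan Δ)⁻¹ := by
      have htan : 0 < tan Δ := tan_pos_of_pos_of_lt_pi_div_two hΔ hΔ'
      rw [Jfun, arctan_inv_of_pos htan, arctan_tan (by linarith) hΔ', Dfun_sub]
      calc Δ * cos Δ ^ (d - 1) = ∫ _ in (π / 2 - Δ)..(π / 2), cos Δ ^ (d - 1) := by
            rw [intervalIntegral.integral_const, smul_eq_mul]; ring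
        _ ≤ _ := by
            refine intervalIntegral.integral_mono_on (by linarith) (by simp)
              (Continuous.intervalIntegrable (by fun_prop) _ _) fun t ht => ?_
            have hc := cos_pos_of_mem_Ioo ⟨by linarith, hΔ'⟩
            gcongr
            rw [← sin_pi_div_two_sub]
            exact sin_le_sin_of_le_of_le_pi_div_two (by linarith [pi_pos]) ht.2 ht.1
    have hω : 0 ≤ omegaTot d := ENNReal.toReal_nonneg
    rw [measureReal_def, measureReal_def, hvol] at h1
    have h2 : omegaTot d * (Dfun d (π / 2) - Jfun d (tan Δ)⁻¹) ≤
        Dfun d (π / 2) * (√(1 + s ^ 2) ^ d * (2 * Δ / s) * omegaSm d) := by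
      have h3 := h1.trans (add_le_add_right hbelt _)
      have h4 := mul_le_mul_of_nonneg_left h3 hD.le
      field_simp at h4 ⊢
      linarith
    have h5 := (mul_le_mul_of_nonneg_left hJ hω).trans h2
    have h6 : Δ * (omegaTot d * cos Δ ^ (d - 1)) ≤
        Δ * (2 * Dfun d (π / 2) * (√(1 + s ^ 2) ^ d / s) * omegaSm d) := by
      refine le_trans (le_of_eq (by ring)) (h5.trans (le_of_eq ?_))
      field_simp
    exact le_of_mul_le_mul_left h6 hΔ
  have hlim : Tendsto (fun Δ => omegaTot d * cos Δ ^ (d - 1)) (𝓝[>] 0) (𝓝 (omegaTot d)) := by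
    have : Continuous fun Δ => omegaTot d * cos Δ ^ (d - 1) := by fun_prop
    have h3 := this.tendsto 0
    simp only [cos_zero, one_pow, mul_one] at h3
    exact h3.mono_left nhdsWithin_le_nhds
  refine le_of_tendsto hlim ?_
  filter_upwards [Ioo_mem_nhdsGT (show (0:ℝ) < π / 2 by positivity)] with Δ hΔ
  exact key Δ hΔ.1 hΔ.2

theorem omegaSm_pos {d : ℕ} (hd : 2 ≤ d) (hω : 0 < omegaTot d) : 0 < omegaSm d := by
  have h0 : 0 ≤ omegaSm d := ENNReal.toReal_nonneg
  rcases h0.lt_or_eq with h | h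
  · exact h
  · have := omegaTot_le hd one_pos
    rw [← h, mul_zero] at this
    linarith

theorem Dfun_pi_div_two_recurrence (n : ℕ) :
    (n + 2) * Dfun (n + 3) (π / 2) = (n + 1) * Dfun (n + 1) (π / 2) := by
  simp only [Dfun, show n + 3 - 1 = n + 2 by omega, Nat.add_sub_cancel]
  rw [integral_sin_pow]
  simp
  field_simp

theorem Dfun_mul_Dfun_succ (n : ℕ) :
    (n + 1) * (Dfun (n + 1) (π / 2) * Dfun (n + 2) (π / 2)) = π / 2 := by
  induction n with
  | zero => simp [Dfun]
  | succ n ih =>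
    have h := Dfun_pi_div_two_recurrence n
    push_cast
    calc _ = ((n:ℝ) + 2) * Dfun (n + 3) (π / 2) * Dfun (n + 2) (π / 2) := by ring
      _ = _ := by rw [h, mul_assoc]; exact ih

theorem Dfun_sq_le {d : ℕ} (hd : 2 ≤ d) : Dfun d (π / 2) ^ 2 ≤ π / (2 * (d - 1)) := by
  obtain ⟨n, rfl⟩ := Nat.exists_eq_add_of_le' hd
  have h1 := Dfun_mul_Dfun_succ n
  have h0 := Dfun_pi_div_two_pos (n + 2)
  have h2 : Dfun (n + 2) (π / 2) ≤ Dfun (n + 1) (π / 2) := by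
    refine intervalIntegral.integral_mono_on (by positivity)
      (Continuous.intervalIntegrable (by fun_prop) _ _)
      (Continuous.intervalIntegrable (by fun_prop) _ _) fun t ht => ?_
    exact pow_le_pow_of_le_one (sin_nonneg_of_nonneg_of_le_pi ht.1 (by linarith [ht.2, pi_pos]))
      (sin_le_one t) (by omega)
  push_cast
  rw [le_div_iff₀ (by linarith [(n.cast_nonneg : (0:ℝ) ≤ n)])]
  nlinarith [mul_le_mul_of_nonneg_right h2 h0.le, (n.cast_nonneg : (0:ℝ) ≤ n)]

/-- The ratio `ω_{d+1} / (2 π ω_d)` is bounded away from one. -/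
theorem omega_ratio_pow_le {d : ℕ} (hd : 2 ≤ d) (hω : 0 < omegaTot d) :
    (omegaTot d / (2 * π * omegaSm d)) ^ d ≤ 0.42 := by
  have hsm := omegaSm_pos hd hω
  have hD := Dfun_pi_div_two_pos d
  have hd1 : (0:ℝ) < d - 1 := by
    have : (2:ℝ) ≤ d := by exact_mod_cast hd
    linarith
  set q := omegaTot d / (2 * π * omegaSm d) with hqdef
  have hq0 : 0 ≤ q := by positivity
  have hq : ∀ s : ℝ, 0 < s → q ≤ Dfun d (π / 2) * (√(1 + s ^ 2) ^ d / s) / π := by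
    intro s hs
    have h := omegaTot_le hd hs
    rw [hqdef, div_le_div_iff₀ (by positivity) (by positivity)]
    nlinarith [pi_pos]
  rcases hd.lt_or_eq with h3 | rfl
  · have hs0 : 0 < (√((d:ℝ) - 1))⁻¹ := inv_pos.2 (Real.sqrt_pos.2 hd1)
    have hs2 : (√((d:ℝ) - 1))⁻¹ ^ 2 = ((d:ℝ) - 1)⁻¹ := by
      rw [inv_pow, Real.sq_sqrt hd1.le]
    have h4 := hq _ hs0
    have h5 : q ^ 2 ≤ 0.5375 := by
      have h6 := one_add_inv_pow_le (d := d - 1) (by omega)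
      rw [Nat.cast_sub (by omega), Nat.cast_one, Nat.sub_add_cancel (by omega)] at h6
      calc q ^ 2 ≤
          (Dfun d (π / 2) * (√(1 + (√((d:ℝ) - 1))⁻¹ ^ 2) ^ d / (√((d:ℝ) - 1))⁻¹) / π) ^ 2 := by
            gcongr
        _ = Dfun d (π / 2) ^ 2 * ((1 + ((d:ℝ) - 1)⁻¹) ^ d * (d - 1)) / π ^ 2 := by
            rw [div_pow, mul_pow, div_pow, hs2, ← pow_mul, mul_comm d 2, pow_mul,
              Real.sq_sqrt (by positivity), div_inv_eq_mul]
        _ ≤ π / (2 * (d - 1)) * (27 / 8 * (d - 1)) / π ^ 2 := by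
            gcongr
            exact Dfun_sq_le hd
        _ = 27 / (16 * π) := by field_simp; norm_num
        _ ≤ 0.5375 := by
            rw [div_le_iff₀ (by positivity)]
            linarith [pi_gt_d2]
    have h7 : q ≤ 0.734 := by nlinarith
    calc q ^ d ≤ q ^ 3 := pow_le_pow_of_le_one hq0 (by linarith) h3
      _ = q * q ^ 2 := by ring
      _ ≤ 0.734 * 0.5375 := by gcongr
      _ ≤ 0.42 := by norm_num
  · have h4 := hq 1 one_pos
    rw [one_pow, div_one, Real.sq_sqrt (by norm_num)] at h4
    have h5 : q ≤ 2 / π := h4.trans (by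
      have := Dfun_pi_div_two_le_one (le_refl 2)
      gcongr
      linarith)
    have h6 : (2:ℝ) / π ≤ 0.64 := by
      rw [div_le_iff₀ pi_pos]
      linarith [pi_gt_d2]
    nlinarith

theorem sigma0_eq_map {d : ℕ} (hd : 2 ≤ d) (hω : 0 < omegaTot d) {e : Esp d}
    {ι : EuclideanSpace ℝ (Fin d) →ₗᵢ[ℝ] Esp d} (h1 : ∀ v, ⟪e, ι v⟫ = 0)
    (h2 : ∀ x, ⟪e, x⟫ = 0 → ∃ v, ι v = x) : sigma0 d e = (sphereProb d).map ι := by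
  have : Nontrivial (EuclideanSpace ℝ (Fin d)) :=
    Module.nontrivial_of_finrank_pos (R := ℝ) (by simp; omega)
  have hfin := hausdorffMeasure_sphere_ne_top (d := d) (by omega)
  have hpos : μH[(d:ℝ) - 1] (Metric.sphere (0 : EuclideanSpace ℝ (Fin d)) 1) ≠ 0 := by
    have := omegaSm_pos hd hω
    rw [omegaSm, ENNReal.toReal_pos_iff] at this
    exact this.1.ne'
  have hpre : ι ⁻¹' (equator e) = Metric.sphere (0 : EuclideanSpace ℝ (Fin d)) 1 := by
    ext v
    simp [equator, uSphere, real_inner_comm, h1]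
  have hrange : equator e ⊆ Set.range ι := fun x hx => by
    obtain ⟨v, hv⟩ := h2 x (by rw [real_inner_comm]; exact hx.2)
    exact ⟨v, hv⟩
  have hd1 : (0:ℝ) ≤ d - 1 := by
    have : (2:ℝ) ≤ d := by exact_mod_cast hd
    linarith
  have hme : MeasurableSet (equator e) := Metric.isClosed_sphere.measurableSet.inter
    (isClosed_eq (by fun_prop) continuous_const).measurableSet
  have hmap : (μH[(d:ℝ) - 1].restrict
      (Metric.sphere (0 : EuclideanSpace ℝ (Fin d)) 1)).map ι =
      (μH[(d:ℝ) - 1]).restrict (equator e) := by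
    rw [← hpre, ← Measure.restrict_map ι.continuous.measurable hme,
      ι.isometry.map_hausdorffMeasure (Or.inl hd1), Measure.restrict_restrict hme,
      Set.inter_eq_left.2 hrange]
  have htot : μH[(d:ℝ) - 1] (equator e) =
      μH[(d:ℝ) - 1] (Metric.sphere (0 : EuclideanSpace ℝ (Fin d)) 1) := by
    rw [← Measure.restrict_apply_self, ← hmap, Measure.map_apply ι.continuous.measurable hme, hpre,
      Measure.restrict_apply_self]
  have hf : IsFiniteMeasure (μH[(d:ℝ) - 1].restrict
      (Metric.sphere (0 : EuclideanSpace ℝ (Fin d)) 1)) := ⟨by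
    rw [Measure.restrict_apply_univ]; exact hfin.lt_top⟩
  have hsv := eq_smul_sphereVol (μH[(d:ℝ) - 1].restrict
    (Metric.sphere (0 : EuclideanSpace ℝ (Fin d)) 1)) (ae_norm_hausdorff _)
    (map_hausdorff_restrict_sphere _)
  rw [sigma0, ← hmap, htot, hsv, sphereProb, ← Measure.map_smul, smul_smul,
    Measure.restrict_apply_univ, div_eq_mul_inv, ← mul_assoc, ENNReal.inv_mul_cancel hpos hfin,
    one_mul]

theorem integral_sigma0 {d : ℕ} (hd : 2 ≤ d) (hω : 0 < omegaTot d) {e : Esp d}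
    {ι : EuclideanSpace ℝ (Fin d) →ₗᵢ[ℝ] Esp d} (h1 : ∀ v, ⟪e, ι v⟫ = 0)
    (h2 : ∀ x, ⟪e, x⟫ = 0 → ∃ v, ι v = x) (f : Esp d → ℝ) :
    ∫ x, f x ∂(sigma0 d e) = ∫ u, f (ι u) ∂(sphereProb d) := by
  rw [sigma0_eq_map hd hω h1 h2]
  exact (ι.isometry.isClosedEmbedding.measurableEmbedding).integral_map f

section Centering

variable {E : Type*} [NormedAddCommGroup E] [InnerProductSpace ℝ E] [FiniteDimensional ℝ E]

theorem exists_mul_norm_le_inner {C : Set E} (hC : IsClosed C)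
    (hcone : ∀ x ∈ C, ∀ t : ℝ, 0 ≤ t → t • x ∈ C) {e : E} (he : ∀ x ∈ C, x ≠ 0 → 0 < ⟪e, x⟫) :
    ∃ δ > 0, ∀ x ∈ C, δ * ‖x‖ ≤ ⟪e, x⟫ := by
  have hK : IsCompact (C ∩ Metric.sphere (0 : E) 1) := (isCompact_sphere 0 1).inter_left hC
  rcases (C ∩ Metric.sphere (0 : E) 1).eq_empty_or_nonempty with hem | hne
  · refine ⟨1, one_pos, fun x hx => ?_⟩
    by_cases h0 : x = 0
    · simp [h0]
    · have : ‖x‖⁻¹ • x ∈ C ∩ Metric.sphere (0 : E) 1 := by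
        refine ⟨hcone x hx _ (by positivity), ?_⟩
        simp [norm_smul, h0]
      simp [hem] at this
  · obtain ⟨z, hz, hmin⟩ := hK.exists_isMinOn hne (f := fun x => ⟪e, x⟫) (by fun_prop)
    have hz0 : z ≠ 0 := by
      rintro rfl
      simpa using hz.2
    refine ⟨⟪e, z⟫, he z hz.1 hz0, fun x hx => ?_⟩
    by_cases h0 : x = 0
    · simp [h0]
    · have hm : ‖x‖⁻¹ • x ∈ C ∩ Metric.sphere (0 : E) 1 := by
        refine ⟨hcone x hx _ (by positivity), ?_⟩
        simp [norm_smul, h0]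
      have h := isMinOn_iff.1 hmin _ hm
      rw [inner_smul_right] at h
      have hp : 0 < ‖x‖ := norm_pos_iff.2 h0
      rw [inv_mul_eq_div, le_div_iff₀ hp] at h
      exact h

variable [MeasurableSpace E] [BorelSpace E]

theorem integrable_exp_neg_mul_sq_norm {b : ℝ} (hb : 0 < b) :
    Integrable (fun x : E => exp (-b * ‖x‖ ^ 2)) := by
  have h := (GaussianFourier.integrable_cexp_neg_mul_sq_norm_add (V := E) (b := (b : ℂ))
    (by simpa using hb) 0 0).norm
  refine h.congr (ae_of_all _ fun x => ?_)
  simp only [Complex.norm_exp]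
  norm_cast
  simp

theorem integrable_sq_norm_mul_exp {b : ℝ} (hb : 0 < b) :
    Integrable (fun x : E => ‖x‖ ^ 2 * exp (-b * ‖x‖ ^ 2)) := by
  refine ((integrable_exp_neg_mul_sq_norm (E := E) (half_pos hb)).const_mul (2 / b)).mono'
    (by fun_prop) (ae_of_all _ fun x => ?_)
  rw [norm_of_nonneg (by positivity)]
  have h1 : b / 2 * ‖x‖ ^ 2 ≤ exp (b / 2 * ‖x‖ ^ 2) := by
    linarith [add_one_le_exp (b / 2 * ‖x‖ ^ 2)]
  have h2 : ‖x‖ ^ 2 ≤ 2 / b * exp (b / 2 * ‖x‖ ^ 2) := by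
    rw [div_mul_eq_mul_div, le_div_iff₀ hb]
    linarith
  calc ‖x‖ ^ 2 * exp (-b * ‖x‖ ^ 2) ≤ 2 / b * exp (b / 2 * ‖x‖ ^ 2) * exp (-b * ‖x‖ ^ 2) := by
        gcongr
    _ = _ := by
        rw [mul_assoc, ← exp_add]
        congr 2
        ring

/-- The Gaussian-type mass of a cone in direction `v`. -/
def coneMass (C : Set E) (v : E) : ℝ≥0∞ := ∫⁻ x in C, ENNReal.ofReal (exp (-⟪v, x⟫ ^ 2 / 2))

theorem lowerSemicontinuous_coneMass (C : Set E) : LowerSemicontinuous (coneMass C) := by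
  intro v y hy
  have h := lintegral_liminf_le (μ := volume.restrict C) (u := 𝓝 v)
    (f := fun v x => ENNReal.ofReal (exp (-⟪v, x⟫ ^ 2 / 2))) (fun i => by fun_prop)
  have h2 : ∀ x : E, liminf (fun w : E => ENNReal.ofReal (exp (-⟪w, x⟫ ^ 2 / 2))) (𝓝 v)
      = ENNReal.ofReal (exp (-⟪v, x⟫ ^ 2 / 2)) := fun x => by
    apply Tendsto.liminf_eq
    have : Continuous (fun w : E => ENNReal.ofReal (exp (-⟪w, x⟫ ^ 2 / 2))) :=
      ENNReal.continuous_ofReal.comp (by fun_prop)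
    exact this.tendsto v
  simp only [h2] at h
  exact eventually_lt_of_lt_liminf (lt_of_lt_of_le hy h)

theorem coneMass_smul {C : Set E} (hC : IsClosed C)
    (hcone : ∀ x ∈ C, ∀ t : ℝ, 0 ≤ t → t • x ∈ C) (v : E) {c : ℝ} (hc : 0 < c) :
    coneMass C v = ENNReal.ofReal (c ^ Module.finrank ℝ E) * coneMass C (c • v) := by
  unfold coneMass
  rw [← lintegral_indicator hC.measurableSet, ← lintegral_indicator hC.measurableSet,
    lintegral_eq_mul_lintegral_smul (Measurable.indicator (by fun_prop) hC.measurableSet) hc]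
  congr 1
  refine lintegral_congr fun x => ?_
  classical
  have hiff : c • x ∈ C ↔ x ∈ C := by
    refine ⟨fun h => ?_, fun h => hcone x h c hc.le⟩
    have := hcone _ h c⁻¹ (by positivity)
    rwa [smul_smul, inv_mul_cancel₀ hc.ne', one_smul] at this
  simp only [Set.indicator_apply, hiff, inner_smul_left, inner_smul_right]
  simp

theorem coneMass_lt_top {C : Set E} (hC : IsClosed C)
    (hcone : ∀ x ∈ C, ∀ t : ℝ, 0 ≤ t → t • x ∈ C) {e : E} (he : ∀ x ∈ C, x ≠ 0 → 0 < ⟪e, x⟫) :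
    coneMass C e < ∞ := by
  obtain ⟨δ, hδ, h⟩ := exists_mul_norm_le_inner hC hcone he
  have hi := (integrable_exp_neg_mul_sq_norm (E := E) (b := δ ^ 2 / 2)
    (by positivity)).lintegral_lt_top
  refine lt_of_le_of_lt ?_ hi
  refine (setLIntegral_mono' hC.measurableSet fun x hx => ?_).trans (setLIntegral_le_lintegral C _)
  gcongr
  have := pow_le_pow_left₀ (by positivity) (h x hx) 2
  nlinarith

theorem coneMass_pos {C : Set E} (hvol : volume C ≠ 0) (e : E) :
    0 < coneMass C e := by
  unfold coneMass
  rw [lintegral_pos_iff_support (by fun_prop)]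
  have : Function.support (fun x => ENNReal.ofReal (exp (-⟪e, x⟫ ^ 2 / 2))) = Set.univ := by
    ext x
    simp [exp_pos]
  rw [this, Measure.restrict_apply_univ]
  exact pos_iff_ne_zero.2 hvol

theorem inner_pos_of_coneMass_lt_top {C : Set E} (hC : IsClosed C) (hconv : Convex ℝ C)
    (hcone : ∀ x ∈ C, ∀ t : ℝ, 0 ≤ t → t • x ∈ C) (hline : ∀ x ∈ C, x ≠ 0 → -x ∉ C)
    (hvol : volume C ≠ 0) {e : E} (hfin : coneMass C e < ∞) (he : ∀ x ∈ C, 0 ≤ ⟪e, x⟫) :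
    ∀ x ∈ C, x ≠ 0 → 0 < ⟪e, x⟫ := by
  intro x₀ hx₀ hne
  refine lt_of_le_of_ne (he x₀ hx₀) fun h0 => ?_
  have hadd : ∀ x ∈ C, ∀ y ∈ C, x + y ∈ C := fun x hx y hy => by
    have := hcone _ (hconv hx hy (by norm_num : (0:ℝ) ≤ 1/2) (by norm_num : (0:ℝ) ≤ 1/2)
      (by norm_num)) 2 (by norm_num)
    rwa [smul_add, smul_smul, smul_smul, show (2:ℝ) * (1/2) = 1 by norm_num, one_smul,
      one_smul] at this
  classical
  set w : E → ℝ≥0∞ := fun x => ENNReal.ofReal (exp (-⟪e, x⟫ ^ 2 / 2)) with hw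
  set f : ℕ → E → ℝ≥0∞ := fun n x => C.indicator w (x - (n : ℝ) • x₀) with hf
  have hwm : Measurable w := by fun_prop
  have hm : Measurable (C.indicator w) := hwm.indicator hC.measurableSet
  have hconst : ∀ n, ∫⁻ x, f n x = coneMass C e := fun n => by
    rw [hf]
    simp only
    rw [lintegral_sub_right_eq_self (μ := volume) (C.indicator w) ((n:ℝ) • x₀), coneMass,
      lintegral_indicator hC.measurableSet]
  have hshift : ∀ n x, f n x ≤ C.indicator w x := fun n x => by
    simp only [hf, Set.indicator_apply]
    split_ifs with h1 h2 h2
    · simp [hw, inner_sub_right, inner_smul_right, ← h0]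
    · refine absurd ?_ h2
      have := hadd _ h1 _ (hcone x₀ hx₀ n (by positivity))
      rwa [sub_add_cancel] at this
    · exact zero_le
    · exact le_rfl
  have hlim := tendsto_lintegral_of_dominated_convergence (μ := volume) (F := f) (f := fun _ => 0)
    (C.indicator w) (fun n => hm.comp (measurable_id.sub_const _))
    (fun n => ae_of_all _ (hshift n))
    (by rw [lintegral_indicator hC.measurableSet]; exact hfin.ne)
    (ae_of_all _ fun x => ?_)
  · simp only [hconst, lintegral_zero] at hlim
    have := tendsto_nhds_unique hlim tendsto_const_nhds
    exact (coneMass_pos hvol e).ne this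
  · have ht : Tendsto (fun n : ℕ => ((n:ℝ))⁻¹ • x - x₀) atTop (𝓝 (-x₀)) := by
      have h1 := (tendsto_inv_atTop_nhds_zero_nat (𝕜 := ℝ)).smul_const x
      simpa using h1.sub_const x₀
    have hev := ht.eventually (hC.isOpen_compl.mem_nhds (hline x₀ hx₀ hne))
    refine tendsto_const_nhds.congr' ?_
    filter_upwards [hev, eventually_gt_atTop 0] with n hn hn0
    have hn' : (0:ℝ) < n := by exact_mod_cast hn0
    simp only [hf]
    rw [Set.indicator_of_notMem]
    intro hmem
    apply hn
    have := hcone _ hmem (n:ℝ)⁻¹ (by positivity)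
    rwa [smul_sub, smul_smul, inv_mul_cancel₀ hn'.ne', one_smul] at this

end Centering

section Centering

variable {E : Type*} [NormedAddCommGroup E] [InnerProductSpace ℝ E] [FiniteDimensional ℝ E]
  [MeasurableSpace E] [BorelSpace E]

theorem coneMass_hasDerivAt {C : Set E} (hC : IsClosed C)
    (hcone : ∀ x ∈ C, ∀ t : ℝ, 0 ≤ t → t • x ∈ C) {e : E}
    (he : ∀ x ∈ C, x ≠ 0 → 0 < ⟪e, x⟫) (h : E) :
    Integrable (fun x => ⟪h, x⟫ * (⟪e, x⟫ * exp (-⟪e, x⟫ ^ 2 / 2))) (volume.restrict C) ∧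
    HasDerivAt (fun t : ℝ => ∫ x in C, exp (-⟪e + t • h, x⟫ ^ 2 / 2))
      (-∫ x in C, ⟪h, x⟫ * (⟪e, x⟫ * exp (-⟪e, x⟫ ^ 2 / 2))) 0 := by
  obtain ⟨δ, hδ, hδC⟩ := exists_mul_norm_le_inner hC hcone he
  set τ : ℝ := min 1 (δ / (2 * (‖h‖ + 1))) with hτ
  have hτ0 : 0 < τ := by positivity
  have hτ1 : τ ≤ 1 := min_le_left _ _
  have hτ2 : τ * ‖h‖ ≤ δ / 2 := by
    have h1 : τ ≤ δ / (2 * (‖h‖ + 1)) := min_le_right _ _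
    rw [le_div_iff₀ (by positivity)] at h1
    nlinarith [norm_nonneg h]
  set F' : ℝ → E → ℝ := fun t x =>
    -(⟪h, x⟫ * (⟪e + t • h, x⟫ * exp (-⟪e + t • h, x⟫ ^ 2 / 2))) with hF'
  set bound : E → ℝ := fun x =>
    ‖h‖ * (‖e‖ + ‖h‖) * (‖x‖ ^ 2 * exp (-(δ ^ 2 / 8) * ‖x‖ ^ 2)) with hbd
  have hlow : ∀ x ∈ C, ∀ t ∈ Metric.ball (0:ℝ) τ, δ / 2 * ‖x‖ ≤ ⟪e + t • h, x⟫ := by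
    intro x hx t ht
    rw [inner_add_left, inner_smul_left]
    have h1 := abs_real_inner_le_norm h x
    have h2 : |t| < τ := by simpa using ht
    have h3 : |t * ⟪h, x⟫| ≤ δ / 2 * ‖x‖ := by
      rw [abs_mul]
      calc |t| * |⟪h, x⟫| ≤ τ * (‖h‖ * ‖x‖) := by gcongr
        _ ≤ _ := by
          rw [← mul_assoc]
          gcongr
    have := abs_le.1 h3
    simp only [conj_trivial]
    nlinarith [hδC x hx]
  have key := hasDerivAt_integral_of_dominated_loc_of_deriv_le (μ := volume.restrict C)
    (F := fun (t : ℝ) x => exp (-⟪e + t • h, x⟫ ^ 2 / 2)) (F' := F') (x₀ := (0:ℝ)) (bound := bound)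
    (Metric.ball_mem_nhds 0 hτ0) (Eventually.of_forall fun t => by fun_prop) ?_ (by fun_prop) ?_
    (((integrable_sq_norm_mul_exp (E := E) (by positivity)).const_mul _).restrict) ?_
  · simp only [hF', zero_smul, add_zero] at key
    refine ⟨?_, ?_⟩
    · simpa using key.1.neg
    · rw [← integral_neg]
      exact key.2
  · refine ⟨by fun_prop, ?_⟩
    have := coneMass_lt_top hC hcone he
    rw [coneMass] at this
    rw [HasFiniteIntegral]
    convert this using 1
    refine lintegral_congr fun x => ?_
    rw [Real.enorm_eq_ofReal (exp_pos _).le]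
    simp
  · filter_upwards [ae_restrict_mem hC.measurableSet] with x hx t ht
    have hl := hlow x hx t ht
    have ht1 : |t| ≤ 1 := by
      have : |t| < τ := by simpa using ht
      linarith
    have hn : ‖e + t • h‖ ≤ ‖e‖ + ‖h‖ := by
      refine (norm_add_le _ _).trans ?_
      rw [norm_smul, norm_eq_abs]
      nlinarith [norm_nonneg h]
    rw [hF', hbd, norm_neg, norm_mul, norm_mul, norm_of_nonneg (exp_pos _).le]
    calc ‖⟪h, x⟫‖ * (‖⟪e + t • h, x⟫‖ * exp (-⟪e + t • h, x⟫ ^ 2 / 2))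
        ≤ (‖h‖ * ‖x‖) * (((‖e‖ + ‖h‖) * ‖x‖) * exp (-(δ ^ 2 / 8) * ‖x‖ ^ 2)) := by
          gcongr
          · exact norm_inner_le_norm h x
          · exact (norm_inner_le_norm _ x).trans (by gcongr)
          · have := pow_le_pow_left₀ (by positivity) hl 2
            nlinarith
      _ = _ := by ring
  · filter_upwards with x t _
    have h1 : HasDerivAt (fun t : ℝ => ⟪e + t • h, x⟫) ⟪h, x⟫ t := by
      have : (fun t : ℝ => ⟪e + t • h, x⟫) = fun t => ⟪e, x⟫ + t * ⟪h, x⟫ := by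
        ext t
        simp [inner_add_left, inner_smul_left]
      rw [this]
      simpa using ((hasDerivAt_id t).mul_const ⟪h, x⟫).const_add ⟪e, x⟫
    refine ((((h1.pow 2).neg).div_const 2).exp).congr_deriv ?_
    simp [hF']
    ring

/-- A line-free closed convex cone of positive volume, strictly contained in a half space, admits
a unit direction with respect to which it is centered. -/
theorem exists_centered_direction {C : Set E} (hC : IsClosed C) (hconv : Convex ℝ C)
    (hcone : ∀ x ∈ C, ∀ t : ℝ, 0 ≤ t → t • x ∈ C) (hline : ∀ x ∈ C, x ≠ 0 → -x ∉ C)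
    (hvol : volume C ≠ 0) {e₀ : E} (he₀ : ‖e₀‖ = 1) (hpos₀ : ∀ x ∈ C, x ≠ 0 → 0 < ⟪e₀, x⟫) :
    ∃ e : E, ‖e‖ = 1 ∧ (∀ x ∈ C, x ≠ 0 → 0 < ⟪e, x⟫) ∧ ∀ h, ⟪e, h⟫ = 0 →
      ∫ x in C, ⟪h, x⟫ * (⟪e, x⟫ * exp (-⟪e, x⟫ ^ 2 / 2)) = 0 := by
  set P : Set E := Metric.sphere (0:E) 1 ∩ {e | ∀ x ∈ C, 0 ≤ ⟪e, x⟫} with hP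
  have hnn : ∀ {v : E}, (∀ x ∈ C, x ≠ 0 → 0 < ⟪v, x⟫) → ∀ x ∈ C, 0 ≤ ⟪v, x⟫ := by
    intro v hv x hx
    by_cases h0 : x = 0
    · simp [h0]
    · exact (hv x hx h0).le
  have hPc : IsCompact P := by
    refine (isCompact_sphere 0 1).inter_right ?_
    have : {e : E | ∀ x ∈ C, 0 ≤ ⟪e, x⟫} = ⋂ x ∈ C, {e : E | 0 ≤ ⟪e, x⟫} := by
      ext; simp
    rw [this]
    exact isClosed_biInter fun x _ => isClosed_le (by fun_prop) (by fun_prop)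
  have heP : e₀ ∈ P := ⟨by simpa using he₀, hnn hpos₀⟩
  obtain ⟨e, heP', hmin⟩ := LowerSemicontinuousOn.exists_isMinOn ⟨e₀, heP⟩ hPc
    ((lowerSemicontinuous_coneMass C).lowerSemicontinuousOn P)
  have he1 : ‖e‖ = 1 := by simpa using heP'.1
  have hfin : coneMass C e < ∞ :=
    (isMinOn_iff.1 hmin e₀ heP).trans_lt (coneMass_lt_top hC hcone hpos₀)
  have hpos := inner_pos_of_coneMass_lt_top hC hconv hcone hline hvol hfin heP'.2
  refine ⟨e, he1, hpos, fun h hh => ?_⟩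
  obtain ⟨-, hder⟩ := coneMass_hasDerivAt hC hcone hpos h
  set n := Module.finrank ℝ E
  set I : ℝ → ℝ := fun t => ∫ x in C, exp (-⟪e + t • h, x⟫ ^ 2 / 2) with hI
  have hIeq : ∀ t, I t = (coneMass C (e + t • h)).toReal := fun t => by
    rw [hI, coneMass]
    simp only
    rw [integral_eq_lintegral_of_nonneg_ae (ae_of_all _ fun x => (exp_pos _).le) (by fun_prop)]
  obtain ⟨δ, hδ, hδC⟩ := exists_mul_norm_le_inner hC hcone hpos
  have hlocpos : ∀ᶠ t : ℝ in 𝓝 0, ∀ x ∈ C, x ≠ 0 → 0 < ⟪e + t • h, x⟫ := by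
    have h1 : ∀ᶠ t : ℝ in 𝓝 0, |t| * ‖h‖ < δ := by
      have : Continuous fun t : ℝ => |t| * ‖h‖ := by fun_prop
      have h2 := this.tendsto 0
      simp only [abs_zero, zero_mul] at h2
      exact h2.eventually_lt_const hδ
    filter_upwards [h1] with t ht x hx hx0
    have hx' : 0 < ‖x‖ := norm_pos_iff.2 hx0
    rw [inner_add_left, inner_smul_left, conj_trivial]
    have h3 : |t * ⟪h, x⟫| ≤ |t| * ‖h‖ * ‖x‖ := by
      rw [abs_mul, mul_assoc]
      gcongr
      exact abs_real_inner_le_norm h x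
    have h4 := (abs_le.1 h3).1
    nlinarith [hδC x hx]
  set G : ℝ → ℝ := fun t => I t * exp (n * (t ^ 2 * ‖h‖ ^ 2 / 2)) with hG
  have hGmin : IsLocalMin G 0 := by
    filter_upwards [hlocpos] with t ht
    have hns : ‖e + t • h‖ ^ 2 = 1 + t ^ 2 * ‖h‖ ^ 2 := by
      rw [norm_add_sq_real, inner_smul_right, hh, norm_smul, he1, norm_eq_abs, mul_pow, sq_abs]
      ring
    have hnpos : 0 < ‖e + t • h‖ := by
      have : 0 < ‖e + t • h‖ ^ 2 := by rw [hns]; positivity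
      exact (norm_nonneg _).lt_of_ne fun h0 => by simp [← h0] at this
    have hnle : ‖e + t • h‖ ^ n ≤ exp (n * (t ^ 2 * ‖h‖ ^ 2 / 2)) := by
      rw [exp_nat_mul]
      gcongr
      refine le_of_sq_le_sq ?_ (exp_pos _).le
      rw [hns, ← exp_nat_mul]
      have := add_one_le_exp (t ^ 2 * ‖h‖ ^ 2)
      refine le_trans (by linarith) (this.trans (le_of_eq ?_))
      congr 1
      push_cast
      ring
    set c := ‖e + t • h‖⁻¹ with hc
    have hcpos : 0 < c := by positivity
    have hPc' : c • (e + t • h) ∈ P := by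
      refine ⟨?_, hnn fun x hx hx0 => ?_⟩
      · rw [mem_sphere_zero_iff_norm, norm_smul, norm_of_nonneg hcpos.le, hc,
          inv_mul_cancel₀ hnpos.ne']
      · rw [inner_smul_left]
        exact mul_pos (by simpa using hcpos) (ht x hx hx0)
    have hm := isMinOn_iff.1 hmin _ hPc'
    have hs := coneMass_smul hC hcone (e + t • h) hcpos
    have hfin' := coneMass_lt_top hC hcone ht
    have hfin'' : coneMass C (c • (e + t • h)) < ∞ := by
      refine coneMass_lt_top hC hcone fun x hx hx0 => ?_
      rw [inner_smul_left]
      exact mul_pos (by simpa using hcpos) (ht x hx hx0)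
    have hs' := congrArg ENNReal.toReal hs
    rw [ENNReal.toReal_mul, ENNReal.toReal_ofReal (by positivity)] at hs'
    have hm' := ENNReal.toReal_mono hfin''.ne hm
    have hI0 : I 0 = (coneMass C e).toReal := by simpa using hIeq 0
    have h1 : I 0 ≤ I t * ‖e + t • h‖ ^ n := by
      have hcn : c ^ n * ‖e + t • h‖ ^ n = 1 := by
        rw [← mul_pow, hc, inv_mul_cancel₀ hnpos.ne', one_pow]
      rw [hIeq t, hs', hI0, mul_right_comm, hcn, one_mul]
      exact hm'
    have hIt : 0 ≤ I t := by rw [hIeq]; positivity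
    simp only [hG]
    simp only [ne_eq, OfNat.ofNat_ne_zero, not_false_eq_true, zero_pow, zero_mul, zero_div,
      mul_zero, exp_zero, mul_one]
    exact h1.trans (by gcongr)
  have hexp : HasDerivAt (fun t : ℝ => exp (n * (t ^ 2 * ‖h‖ ^ 2 / 2))) 0 0 := by
    refine (((((hasDerivAt_pow 2 (0:ℝ)).mul_const (‖h‖ ^ 2)).div_const 2).const_mul
      (n:ℝ)).exp).congr_deriv ?_
    simp
  have hGd := hder.mul hexp
  have h0 := hGmin.hasDerivAt_eq_zero hGd
  simpa using h0

end Centering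

section Bodies

variable {E : Type*} [NormedAddCommGroup E] [InnerProductSpace ℝ E]

/-- A closed bounded convex neighbourhood of the origin. -/
structure IsBodyAtZero (L : Set E) : Prop where
  isClosed : IsClosed L
  convex : Convex ℝ L
  mem_nhds : L ∈ 𝓝 0
  isBounded : Bornology.IsBounded L

/-- The radial function of a set, as the inverse of its gauge. -/
def radialFn (L : Set E) (u : E) : ℝ := (gauge L u)⁻¹

namespace IsBodyAtZero

variable {L : Set E}

theorem continuous_gauge (hL : IsBodyAtZero L) : Continuous (gauge L) :=
  _root_.continuous_gauge hL.convex hL.mem_nhds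

theorem gauge_pos (hL : IsBodyAtZero L) {u : E} (hu : u ≠ 0) : 0 < gauge L u :=
  (_root_.gauge_pos (absorbent_nhds_zero hL.mem_nhds)
    (NormedSpace.isVonNBounded_iff ℝ |>.2 hL.isBounded)).2 hu

theorem gauge_le_one_iff (hL : IsBodyAtZero L) {v : E} : gauge L v ≤ 1 ↔ v ∈ L := by
  rw [gauge_le_one_iff_mem_closure hL.convex hL.mem_nhds, hL.isClosed.closure_eq]

theorem gauge_le_iff (hL : IsBodyAtZero L) {v : E} {s : ℝ} (hs : 0 < s) :
    gauge L v ≤ s ↔ s⁻¹ • v ∈ L := by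
  rw [← hL.gauge_le_one_iff, gauge_smul_of_nonneg (by positivity), smul_eq_mul,
    inv_mul_le_one₀ hs]

theorem radialFn_pos (hL : IsBodyAtZero L) {u : E} (hu : ‖u‖ = 1) : 0 < radialFn L u :=
  inv_pos.2 (hL.gauge_pos fun h => by simp [h] at hu)

theorem smul_mem_iff (hL : IsBodyAtZero L) {u : E} (hu : ‖u‖ = 1) {r : ℝ} (hr : 0 < r) :
    r • u ∈ L ↔ r ≤ radialFn L u := by
  have hg := hL.gauge_pos (u := u) fun h => by simp [h] at hu
  rw [← hL.gauge_le_one_iff, gauge_smul_of_nonneg hr.le, smul_eq_mul, radialFn,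
    le_inv_comm₀ hr hg, inv_eq_one_div, le_div_iff₀ hr, mul_comm]

theorem exists_radialFn_le (hL : IsBodyAtZero L) : ∃ R > 0, ∀ u, ‖u‖ = 1 → radialFn L u ≤ R := by
  obtain ⟨R, hR0, hR⟩ := hL.isBounded.exists_pos_norm_le
  refine ⟨R, hR0, fun u hu => ?_⟩
  have h := hR _ ((hL.smul_mem_iff hu (hL.radialFn_pos hu)).2 le_rfl)
  rwa [norm_smul, hu, mul_one, norm_of_nonneg (hL.radialFn_pos hu).le] at h

theorem exists_mul_norm_le_gauge (hL : IsBodyAtZero L) : ∃ c > 0, ∀ v, c * ‖v‖ ≤ gauge L v := by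
  obtain ⟨R, hR0, hR⟩ := hL.exists_radialFn_le
  refine ⟨R⁻¹, by positivity, fun v => ?_⟩
  by_cases hv : v = 0
  · simp [hv]
  have hn : 0 < ‖v‖ := norm_pos_iff.2 hv
  have hu : ‖‖v‖⁻¹ • v‖ = 1 := by simp [norm_smul, hn.ne']
  have h := hR _ hu
  rw [radialFn, gauge_smul_of_nonneg (by positivity), smul_eq_mul] at h
  have hg := hL.gauge_pos hv
  rw [mul_inv, inv_inv] at h
  rw [inv_mul_le_iff₀ hR0]
  rwa [← div_eq_mul_inv, div_le_iff₀ hg] at h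

theorem measurable_radialFn [MeasurableSpace E] [BorelSpace E] (hL : IsBodyAtZero L) :
    Measurable (radialFn L) :=
  hL.continuous_gauge.measurable.inv

/-- The polar of a body with the origin in its interior is again such a body. -/
theorem polar (hL : IsBodyAtZero L) [FiniteDimensional ℝ E] :
    IsBodyAtZero {v : E | ∀ w ∈ L, ⟪v, w⟫ ≤ 1} where
  isClosed := by
    have : {v : E | ∀ w ∈ L, ⟪v, w⟫ ≤ 1} = ⋂ w ∈ L, {v : E | ⟪v, w⟫ ≤ 1} := by
      ext; simp
    rw [this]
    exact isClosed_biInter fun x _ => isClosed_le (by fun_prop) (by fun_prop)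
  convex := by
    intro x hx y hy a b ha hb hab w hw
    rw [inner_add_left, inner_smul_left, inner_smul_left]
    simp only [conj_trivial]
    nlinarith [hx w hw, hy w hw]
  mem_nhds := by
    obtain ⟨R, hR0, hR⟩ := hL.isBounded.exists_pos_norm_le
    refine Filter.mem_of_superset (Metric.ball_mem_nhds 0 (inv_pos.2 hR0)) fun v hv w hw => ?_
    have hv' : ‖v‖ < R⁻¹ := by simpa using hv
    calc ⟪v, w⟫ ≤ ‖v‖ * ‖w‖ := real_inner_le_norm _ _
      _ ≤ R⁻¹ * R := by
        have := hR w hw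
        gcongr
      _ = 1 := inv_mul_cancel₀ hR0.ne'
  isBounded := by
    obtain ⟨r, hr0, hr⟩ := Metric.nhds_basis_closedBall.mem_iff.1 hL.mem_nhds
    refine (Metric.isBounded_iff_subset_closedBall 0).2 ⟨r⁻¹, fun v hv => ?_⟩
    rw [mem_closedBall_zero_iff]
    by_cases h0 : v = 0
    · simpa [h0] using hr0.le
    have hn : 0 < ‖v‖ := norm_pos_iff.2 h0
    have hw : (r * ‖v‖⁻¹) • v ∈ L := hr (by
      rw [mem_closedBall_zero_iff, norm_smul, norm_of_nonneg (by positivity)]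
      field_simp
      exact le_rfl)
    have := hv _ hw
    rw [inner_smul_right, real_inner_self_eq_norm_sq] at this
    rw [le_inv_comm₀ hn hr0, inv_eq_one_div, le_div_iff₀ hn]
    calc r * ‖v‖ = r * ‖v‖⁻¹ * ‖v‖ ^ 2 := by field_simp
      _ ≤ 1 := this

theorem inner_le_gauge_mul_gauge_polar (hL : IsBodyAtZero L) [FiniteDimensional ℝ E] (v w : E) :
    ⟪v, w⟫ ≤ gauge {v : E | ∀ w ∈ L, ⟪v, w⟫ ≤ 1} v * gauge L w := by
  by_cases hv : v = 0
  · simp [hv]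
  by_cases hw : w = 0
  · simp [hw]
  have ha := hL.polar.gauge_pos hv
  have hb := hL.gauge_pos hw
  have h1 := (hL.polar.gauge_le_iff ha).1 le_rfl
  have h2 := (hL.gauge_le_iff hb).1 le_rfl
  have := h1 _ h2
  rw [inner_smul_left, inner_smul_right] at this
  simp only [conj_trivial] at this
  rw [← mul_assoc, ← mul_inv, inv_mul_le_one₀ (by positivity)] at this
  exact this

end IsBodyAtZero

end Bodies

theorem lintegral_Ioi_pow_mul_exp_scale {d : ℕ} (hd : 1 ≤ d) {g : ℝ} (hg : 0 < g) :
    ∫⁻ r in Set.Ioi (0:ℝ), ENNReal.ofReal (r ^ (d - 1)) * ENNReal.ofReal (exp (-(r * g) ^ 2 / 2)) =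
      ENNReal.ofReal (g⁻¹ ^ d) * ∫⁻ r in Set.Ioi (0:ℝ), ENNReal.ofReal (r ^ (d - 1)) *
        ENNReal.ofReal (exp (-r ^ 2 / 2)) := by
  have hm : Measurable fun r : ℝ => ENNReal.ofReal (r ^ (d - 1)) *
    ENNReal.ofReal (exp (-r ^ 2 / 2)) := by fun_prop
  rw [← lintegral_indicator measurableSet_Ioi, ← lintegral_indicator measurableSet_Ioi,
    lintegral_eq_mul_lintegral_smul (hm.indicator measurableSet_Ioi) hg, ← mul_assoc,
    ← ENNReal.ofReal_mul (by positivity)]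
  rw [← lintegral_const_mul _ (f := fun r => (Set.Ioi (0:ℝ)).indicator (fun r : ℝ =>
      ENNReal.ofReal (r ^ (d - 1)) * ENNReal.ofReal (exp (-r ^ 2 / 2))) (g • r))
      ((hm.indicator measurableSet_Ioi).comp (measurable_const_smul g))]
  refine lintegral_congr fun r => ?_
  classical
  simp only [Set.indicator_apply, Set.mem_Ioi, smul_eq_mul, mul_pos_iff_of_pos_left hg]
  split_ifs with h
  · have hpow : r ^ (d - 1) = g⁻¹ ^ d * g ^ Module.finrank ℝ ℝ * (g * r) ^ (d - 1) := by
      obtain ⟨k, rfl⟩ := Nat.exists_eq_add_of_le' hd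
      rw [Module.finrank_self, pow_one, mul_pow, Nat.add_sub_cancel, inv_pow, pow_succ]
      field_simp
    rw [← mul_assoc, ← ENNReal.ofReal_mul (p := g⁻¹ ^ d * _) (by positivity), mul_comm r g,
      ← hpow]
  · simp

theorem lintegral_exp_gauge_aux {d : ℕ} (hd : 1 ≤ d) {N : EuclideanSpace ℝ (Fin d) → ℝ}
    (hN : Continuous N) (hpos : ∀ u, ‖u‖ = 1 → 0 < N u)
    (hhom : ∀ r : ℝ, 0 ≤ r → ∀ u, N (r • u) = r * N u) :
    ∫⁻ v, ENNReal.ofReal (exp (-(N v) ^ 2 / 2)) =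
      (∫⁻ r in Set.Ioi (0:ℝ), ENNReal.ofReal (r ^ (d - 1)) * ENNReal.ofReal (exp (-r ^ 2 / 2))) *
      sphereVol (EuclideanSpace ℝ (Fin d)) Set.univ *
        ∫⁻ u, ENNReal.ofReal ((N u)⁻¹ ^ d) ∂(sphereProb d) := by
  have : Nontrivial (EuclideanSpace ℝ (Fin d)) :=
    Module.nontrivial_of_finrank_pos (R := ℝ) (by simp; omega)
  rw [lintegral_polar (by fun_prop), mul_assoc, ← smul_eq_mul (sphereVol _ _),
    ← lintegral_smul_measure, ← sphereVol_eq_smul_sphereProb hd,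
    ← lintegral_const_mul _ (by fun_prop)]
  refine lintegral_congr_ae ?_
  filter_upwards [ae_norm_sphereVol] with u hu
  rw [mul_comm, ← lintegral_Ioi_pow_mul_exp_scale hd (hpos u hu)]
  refine setLIntegral_congr_fun measurableSet_Ioi fun r hr => ?_
  simp only [finrank_euclideanSpace, Fintype.card_fin]
  rw [hhom r (le_of_lt hr)]

theorem gaussian_radial_const {d : ℕ} (hd : 1 ≤ d) :
    (∫⁻ r in Set.Ioi (0:ℝ), ENNReal.ofReal (r ^ (d - 1)) * ENNReal.ofReal (exp (-r ^ 2 / 2))) *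
      sphereVol (EuclideanSpace ℝ (Fin d)) Set.univ = ENNReal.ofReal ((2 * π) ^ ((d:ℝ) / 2)) := by
  have := isProbabilityMeasure_sphereProb hd
  have h := lintegral_exp_gauge_aux hd (N := fun v => ‖v‖) continuous_norm
    (fun u hu => by simp [hu]) (fun r hr u => by rw [norm_smul, norm_of_nonneg hr])
  have h1 : ∫⁻ u, ENNReal.ofReal (‖u‖⁻¹ ^ d) ∂(sphereProb d) = 1 := by
    rw [lintegral_congr_ae (g := fun _ => 1)]
    · simp
    · filter_upwards [ae_norm_sphereProb d] with u hu
      simp [hu]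
  rw [h1, mul_one] at h
  rw [← h, ← ofReal_integral_eq_lintegral_ofReal]
  · have := GaussianFourier.integral_rexp_neg_mul_sq_norm (V := EuclideanSpace ℝ (Fin d))
      (b := 1 / 2) (by norm_num)
    simp only [finrank_euclideanSpace, Fintype.card_fin] at this
    rw [show (2 * π : ℝ) = π / (1 / 2) by ring, ← this]
    congr 2
    ext v
    congr 1
    ring
  · refine (integrable_exp_neg_mul_sq_norm (b := 1 / 2) (by norm_num)).congr
      (ae_of_all _ fun v => ?_)
    simp only
    congr 1
    ring
  · exact ae_of_all _ fun _ => (exp_pos _).le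

theorem IsBodyAtZero.lintegral_exp_gauge {d : ℕ} (hd : 1 ≤ d) {L : Set (EuclideanSpace ℝ (Fin d))}
    (hL : IsBodyAtZero L) :
    ∫⁻ v, ENNReal.ofReal (exp (-(gauge L v) ^ 2 / 2)) = ENNReal.ofReal ((2 * π) ^ ((d:ℝ) / 2)) *
      ∫⁻ u, ENNReal.ofReal (radialFn L u ^ d) ∂(sphereProb d) := by
  rw [lintegral_exp_gauge_aux hd hL.continuous_gauge
    (fun u hu => hL.gauge_pos fun h => by simp [h] at hu)
    (fun r hr u => by rw [gauge_smul_of_nonneg hr, smul_eq_mul]), gaussian_radial_const hd]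
  rfl

theorem IsBodyAtZero.integrable_radialFn_pow {d : ℕ} (hd : 1 ≤ d)
    {L : Set (EuclideanSpace ℝ (Fin d))} (hL : IsBodyAtZero L) (k : ℕ) :
    Integrable (fun u => radialFn L u ^ k) (sphereProb d) := by
  have := isProbabilityMeasure_sphereProb hd
  obtain ⟨R, hR0, hR⟩ := hL.exists_radialFn_le
  refine (integrable_const (R ^ k)).mono'
    (hL.measurable_radialFn.pow_const k).aestronglyMeasurable ?_
  filter_upwards [ae_norm_sphereProb d] with u hu
  rw [norm_pow, norm_of_nonneg (hL.radialFn_pos hu).le]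
  have := (hL.radialFn_pos hu).le
  have := hR u hu
  gcongr

/-- The Blaschke–Santaló inequality for a body whose Gaussian-type density is centered. -/
theorem IsBodyAtZero.santalo {d : ℕ} (hd : 1 ≤ d) {L : Set (EuclideanSpace ℝ (Fin d))}
    (hL : IsBodyAtZero L)
    (hcent : ∀ h : EuclideanSpace ℝ (Fin d), ∫ v, ⟪h, v⟫ * exp (-(gauge L v) ^ 2 / 2) = 0) :
    (∫ u, radialFn L u ^ d ∂(sphereProb d)) *
      (∫ u, radialFn {v | ∀ w ∈ L, ⟪v, w⟫ ≤ 1} u ^ d ∂(sphereProb d)) ≤ 1 := by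
  set Q : Set (EuclideanSpace ℝ (Fin d)) := {v | ∀ w ∈ L, ⟪v, w⟫ ≤ 1} with hQ
  have hQb : IsBodyAtZero Q := hL.polar
  have hmp := PiLp.volume_preserving_toLp (Fin d)
  have hemb : MeasurableEmbedding (WithLp.toLp 2 : (Fin d → ℝ) → EuclideanSpace ℝ (Fin d)) :=
    (MeasurableEquiv.toLp 2 (Fin d → ℝ)).measurableEmbedding
  obtain ⟨c, hc0, hc⟩ := hL.exists_mul_norm_le_gauge
  have hgm : Measurable fun v => exp (-(gauge L v) ^ 2 / 2) := by
    have := hL.continuous_gauge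
    fun_prop
  have hgQm : Measurable fun v => ENNReal.ofReal (exp (-(gauge Q v) ^ 2 / 2)) := by
    have := hQb.continuous_gauge
    fun_prop
  have hexple : ∀ v, exp (-(gauge L v) ^ 2 / 2) ≤ exp (-(c ^ 2 / 2) * ‖v‖ ^ 2) := fun v => by
    gcongr
    have := pow_le_pow_left₀ (by positivity) (hc v) 2
    nlinarith
  have hgi : Integrable fun v => exp (-(gauge L v) ^ 2 / 2) :=
    (integrable_exp_neg_mul_sq_norm (b := c ^ 2 / 2) (by positivity)).mono'
      hgm.aestronglyMeasurable (ae_of_all _ fun v => by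
        rw [norm_of_nonneg (exp_pos _).le]; exact hexple v)
  have hgi' : ∀ i, Integrable fun v : EuclideanSpace ℝ (Fin d) =>
      v i * exp (-(gauge L v) ^ 2 / 2) := by
    intro i
    refine ((integrable_exp_neg_mul_sq_norm (b := c ^ 2 / 2) (by positivity)).add
      (integrable_sq_norm_mul_exp (b := c ^ 2 / 2) (by positivity))).mono' (by fun_prop)
      (ae_of_all _ fun v => ?_)
    rw [norm_mul, norm_of_nonneg (exp_pos _).le, Pi.add_apply]
    have h1 : ‖v i‖ ≤ 1 + ‖v‖ ^ 2 := by
      have := PiLp.norm_apply_le v i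
      nlinarith [sq_nonneg (‖v‖ - 1)]
    calc ‖v i‖ * exp (-(gauge L v) ^ 2 / 2) ≤ (1 + ‖v‖ ^ 2) * exp (-(c ^ 2 / 2) * ‖v‖ ^ 2) := by
          exact mul_le_mul h1 (hexple v) (exp_pos _).le (by positivity)
      _ = _ := by ring
  have key := santaloHolds d 1
    (fun x => ENNReal.ofReal (exp (-(gauge Q (WithLp.toLp 2 x)) ^ 2 / 2)))
    (fun x => exp (-(gauge L (WithLp.toLp 2 x)) ^ 2 / 2)) zero_le_one
    (hgQm.comp hmp.measurable) (hgm.comp hmp.measurable) (fun x => (exp_pos _).le)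
    ((hmp.integrable_comp_emb hemb).2 hgi) (fun i => (hmp.integrable_comp_emb hemb).2 (hgi' i))
    (fun i => ?_) (fun x y => ?_)
  · rw [hmp.lintegral_comp hgQm, hmp.lintegral_comp (f := fun v => ENNReal.ofReal
      (exp (-(gauge L v) ^ 2 / 2))) hgm.ennreal_ofReal, hQb.lintegral_exp_gauge hd,
      hL.lintegral_exp_gauge hd, mul_mul_mul_comm, ← ENNReal.ofReal_mul (by positivity),
      ← rpow_add (by positivity), add_halves, rpow_natCast, one_mul] at key
    have hC0 : ENNReal.ofReal ((2 * π) ^ d) ≠ 0 := by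
      simp only [ne_eq, ENNReal.ofReal_eq_zero, not_le]
      positivity
    have key' := (ENNReal.mul_le_iff_le_inv hC0 ENNReal.ofReal_ne_top).1 key
    rw [ENNReal.inv_mul_cancel hC0 ENNReal.ofReal_ne_top] at key'
    have hnn : ∀ {M : Set (EuclideanSpace ℝ (Fin d))}, IsBodyAtZero M →
        0 ≤ᵐ[sphereProb d] fun u => radialFn M u ^ d := fun hM => by
      filter_upwards [ae_norm_sphereProb d] with u hu
      exact pow_nonneg (hM.radialFn_pos hu).le _
    rw [← ofReal_integral_eq_lintegral_ofReal (hQb.integrable_radialFn_pow hd d) (hnn hQb),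
      ← ofReal_integral_eq_lintegral_ofReal (hL.integrable_radialFn_pow hd d) (hnn hL),
      ← ENNReal.ofReal_mul (integral_nonneg_of_ae (hnn hQb)), ENNReal.ofReal_le_one] at key'
    rwa [mul_comm]
  · have h := hcent (EuclideanSpace.single i 1)
    rw [← hmp.integral_comp hemb] at h
    simpa [EuclideanSpace.inner_single_left] using h
  · rw [← ENNReal.ofReal_mul (exp_pos _).le, ← exp_add, one_mul]
    gcongr
    have h := hL.inner_le_gauge_mul_gauge_polar (WithLp.toLp 2 x) (WithLp.toLp 2 y)
    have hdot : ⟪(WithLp.toLp 2 x : EuclideanSpace ℝ (Fin d)), WithLp.toLp 2 y⟫ = x ⬝ᵥ y := by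
      rw [EuclideanSpace.inner_toLp_toLp]
      simp [dotProduct_comm]
    rw [hdot] at h
    nlinarith [sq_nonneg (gauge Q (WithLp.toLp 2 x) - gauge L (WithLp.toLp 2 y))]

theorem mem_interior_of_centered {E : Type*} [NormedAddCommGroup E] [InnerProductSpace ℝ E]
    [FiniteDimensional ℝ E] [MeasurableSpace E] [BorelSpace E] {C : Set E} (hC : IsClosed C)
    (hconv : Convex ℝ C) (hcone : ∀ x ∈ C, ∀ t : ℝ, 0 ≤ t → t • x ∈ C) (hvol : volume C ≠ 0) {e : E}
    (he : ‖e‖ = 1) (hpos : ∀ x ∈ C, x ≠ 0 → 0 < ⟪e, x⟫)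
    (hcent : ∀ h, ⟪e, h⟫ = 0 → ∫ x in C, ⟪h, x⟫ * (⟪e, x⟫ * exp (-⟪e, x⟫ ^ 2 / 2)) = 0) :
    e ∈ interior C := by
  by_contra hne
  have hInt : (interior C).Nonempty := by
    by_contra hem
    rw [Set.not_nonempty_iff_eq_empty] at hem
    have h := hconv.addHaar_frontier (μ := volume)
    rw [frontier, hem, hC.closure_eq, Set.sdiff_empty] at h
    exact hvol h
  obtain ⟨f, hf⟩ := geometric_hahn_banach_open_point hconv.interior isOpen_interior hne
  set y := (InnerProductSpace.toDual ℝ E).symm f with hy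
  have hfy : ∀ x, f x = ⟪y, x⟫ := fun x => by rw [hy, InnerProductSpace.toDual_symm_apply]
  simp only [hfy] at hf
  have hle : ∀ a ∈ C, ⟪y, a⟫ ≤ ⟪y, e⟫ := by
    intro a ha
    have hcl : closure (interior C) = C := by
      rw [hconv.closure_interior_eq_closure_of_nonempty_interior hInt, hC.closure_eq]
    rw [← hcl] at ha
    have hsub : closure (interior C) ⊆ {a | ⟪y, a⟫ ≤ ⟪y, e⟫} :=
      closure_minimal (fun a ha => (hf a ha).le) (isClosed_le (by fun_prop) (by fun_prop))
    exact hsub ha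
  have hy0 : y ≠ 0 := by
    rintro h0
    obtain ⟨a, ha⟩ := hInt
    have := hf a ha
    simp [h0] at this
  have hCne : ∃ a, a ∈ C := ⟨_, interior_subset hInt.some_mem⟩
  have h0C : (0:E) ∈ C := by
    obtain ⟨a, ha⟩ := hCne
    simpa using hcone a ha 0 le_rfl
  have hye : 0 ≤ ⟪y, e⟫ := by simpa using hle 0 h0C
  have hnp : ∀ a ∈ C, ⟪y, a⟫ ≤ 0 := by
    intro a ha
    by_contra! hlt
    have h := hle _ (hcone a ha ((⟪y, e⟫ + 1) / ⟪y, a⟫) (by positivity))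
    rw [inner_smul_right, div_mul_cancel₀ _ hlt.ne'] at h
    linarith
  have hnn : ∀ x ∈ C, 0 ≤ ⟪e, x⟫ := fun x hx => by
    by_cases h0 : x = 0
    · simp [h0]
    · exact (hpos x hx h0).le
  set w : E → ℝ := fun x => ⟪e, x⟫ * exp (-⟪e, x⟫ ^ 2 / 2) with hw
  have hInt' : ∀ h : E, IntegrableOn (fun x => ⟪h, x⟫ * w x) C := fun h =>
    (coneMass_hasDerivAt hC hcone hpos h).1
  set h := y - ⟪y, e⟫ • e with hh
  have hhe : ⟪e, h⟫ = 0 := by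
    rw [hh, inner_sub_right, inner_smul_right, real_inner_self_eq_norm_sq, he, real_inner_comm]
    ring
  have hIy : 0 ≤ ∫ x in C, ⟪y, x⟫ * w x := by
    have hsplit : ∀ x, ⟪y, x⟫ * w x = ⟪h, x⟫ * w x + ⟪y, e⟫ * (⟪e, x⟫ * w x) := fun x => by
      rw [hh, inner_sub_left, inner_smul_left]
      simp only [conj_trivial]
      ring
    simp only [hsplit]
    rw [integral_add (hInt' h) ((hInt' e).const_mul _), hcent h hhe, zero_add,
      integral_const_mul]
    refine mul_nonneg hye (setIntegral_nonneg hC.measurableSet fun x hx => ?_)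
    have := hnn x hx
    positivity
  have hz : (fun x => -(⟪y, x⟫ * w x)) =ᵐ[volume.restrict C] 0 := by
    refine (integral_eq_zero_iff_of_nonneg_ae ?_ (hInt' y).neg).1 (le_antisymm ?_ ?_)
    · filter_upwards [ae_restrict_mem hC.measurableSet] with x hx
      have h1 := hnp x hx
      have h2 : 0 ≤ w x := mul_nonneg (hnn x hx) (exp_pos _).le
      exact neg_nonneg.2 (mul_nonpos_iff.2 (Or.inr ⟨h1, h2⟩))
    · change ∫ x in C, -(⟪y, x⟫ * w x) ≤ 0
      rw [integral_neg]
      linarith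
    · refine setIntegral_nonneg hC.measurableSet fun x hx => ?_
      have h1 := hnp x hx
      have h2 : 0 ≤ w x := mul_nonneg (hnn x hx) (exp_pos _).le
      exact neg_nonneg.2 (mul_nonpos_iff.2 (Or.inr ⟨h1, h2⟩))
  have hsub : ∀ᵐ x : E, x ∈ C → x ∈ ((ℝ ∙ y)ᗮ : Submodule ℝ E) := by
    filter_upwards [(ae_restrict_iff' hC.measurableSet).1 hz] with x hx hxC
    rw [Submodule.mem_orthogonal_singleton_iff_inner_right]
    by_cases hx0 : x = 0
    · simp [hx0]
    · have h1 := hx hxC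
      have h2 : 0 < w x := mul_pos (hpos x hxC hx0) (exp_pos _)
      simp only [Pi.zero_apply, neg_eq_zero, mul_eq_zero] at h1
      exact h1.resolve_right h2.ne'
  refine hvol (le_antisymm ((measure_mono_ae
    (t := (((ℝ ∙ y)ᗮ : Submodule ℝ E) : Set E)) hsub).trans (le_of_eq ?_)) zero_le)
  rw [Measure.addHaar_submodule]
  intro htop
  have hmem : y ∈ (ℝ ∙ y)ᗮ := by rw [htop]; trivial
  rw [Submodule.mem_orthogonal_singleton_iff_inner_right] at hmem
  exact hy0 (inner_self_eq_zero.1 hmem)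

section Frame

variable {d : ℕ} {C : Set (Esp d)} {e : Esp d} {ι : EuclideanSpace ℝ (Fin d) →ₗᵢ[ℝ] Esp d}

theorem isBodyAtZero_frame_section (hC : IsClosed C) (hconv : Convex ℝ C)
    (hcone : ∀ x ∈ C, ∀ t : ℝ, 0 ≤ t → t • x ∈ C) (he : ‖e‖ = 1)
    (hpos : ∀ x ∈ C, x ≠ 0 → 0 < ⟪e, x⟫) (hInt : e ∈ interior C) (h1 : ∀ v, ⟪e, ι v⟫ = 0) :
    IsBodyAtZero {v | e + ι v ∈ C} where
  isClosed := hC.preimage (continuous_const.add ι.continuous)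
  convex := by
    intro x hx y hy a b ha hb hab
    have h := hconv hx hy ha hb hab
    have h' : a • (e + ι x) + b • (e + ι y) = e + ι (a • x + b • y) := by
      rw [map_add, map_smul, map_smul, smul_add, smul_add, add_add_add_comm, ← add_smul, hab,
        one_smul]
    rwa [h'] at h
  mem_nhds := by
    have hc : Continuous fun v => e + ι v := continuous_const.add ι.continuous
    refine hc.continuousAt.preimage_mem_nhds ?_
    simpa using mem_interior_iff_mem_nhds.1 hInt
  isBounded := by
    obtain ⟨δ, hδ, h⟩ := exists_mul_norm_le_inner hC hcone hpos
    refine (Metric.isBounded_iff_subset_closedBall 0).2 ⟨δ⁻¹, fun v hv => ?_⟩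
    have h2 := h _ hv
    rw [inner_add_right, h1, real_inner_self_eq_norm_sq, he, norm_add_frame he h1] at h2
    rw [mem_closedBall_zero_iff, ← one_div, le_div_iff₀ hδ]
    have h3 : ‖v‖ ≤ √(1 + ‖v‖ ^ 2) := le_sqrt_of_sq_le (by linarith)
    nlinarith

theorem smul_add_frame_mem_iff (hcone : ∀ x ∈ C, ∀ t : ℝ, 0 ≤ t → t • x ∈ C)
    (hL : IsBodyAtZero {v | e + ι v ∈ C}) {s : ℝ} (hs : 0 < s) (v : EuclideanSpace ℝ (Fin d)) :
    s • e + ι v ∈ C ↔ gauge {v | e + ι v ∈ C} v ≤ s := by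
  rw [hL.gauge_le_iff hs]
  constructor
  · intro h
    have := hcone _ h s⁻¹ (by positivity)
    rwa [smul_add, smul_smul, inv_mul_cancel₀ hs.ne', one_smul, ← map_smul] at this
  · intro h
    have := hcone _ h s hs.le
    rwa [smul_add, map_smul, smul_smul, mul_inv_cancel₀ hs.ne', one_smul] at this

theorem integral_Ioi_mul_exp_neg_sq {g : ℝ} (hg : 0 ≤ g) :
    ∫ s in Set.Ioi g, s * exp (-s ^ 2 / 2) = exp (-g ^ 2 / 2) := by
  have h := integral_Ioi_of_hasDerivAt_of_nonneg' (g := fun s : ℝ => -exp (-s ^ 2 / 2))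
    (g' := fun s => s * exp (-s ^ 2 / 2)) (a := g) (l := -0) (fun s _ => ?_) (fun s hs => ?_) ?_
  · rw [h]
    ring
  · refine ((((hasDerivAt_pow 2 s).neg.div_const 2).exp).neg).congr_deriv ?_
    simp
    ring
  · have : 0 < s := hg.trans_lt hs
    positivity
  · refine Tendsto.neg (tendsto_exp_atBot.comp ?_)
    have h2 : Tendsto (fun s : ℝ => s ^ 2 / 2) atTop atTop :=
      (tendsto_pow_atTop two_ne_zero).atTop_div_const two_pos
    refine (tendsto_neg_atTop_atBot.comp h2).congr fun s => ?_
    simp only [Function.comp_apply]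
    ring

theorem integral_inner_mul_exp_gauge_eq_zero (hC : IsClosed C)
    (hcone : ∀ x ∈ C, ∀ t : ℝ, 0 ≤ t → t • x ∈ C) (he : ‖e‖ = 1)
    (hpos : ∀ x ∈ C, x ≠ 0 → 0 < ⟪e, x⟫)
    (hcent : ∀ h, ⟪e, h⟫ = 0 → ∫ x in C, ⟪h, x⟫ * (⟪e, x⟫ * exp (-⟪e, x⟫ ^ 2 / 2)) = 0)
    (h1 : ∀ v, ⟪e, ι v⟫ = 0)
    (hmp : MeasurePreserving (fun p : ℝ × EuclideanSpace ℝ (Fin d) => p.1 • e + ι p.2)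
        (volume.prod volume) volume)
    (hL : IsBodyAtZero {v | e + ι v ∈ C}) (h : EuclideanSpace ℝ (Fin d)) :
    ∫ v, ⟪h, v⟫ * exp (-(gauge {v | e + ι v ∈ C} v) ^ 2 / 2) = 0 := by
  classical
  set L := {v | e + ι v ∈ C} with hLdef
  have h0 := hcent (ι h) (h1 h)
  have hi := (coneMass_hasDerivAt hC hcone hpos (ι h)).1
  rw [← IntegrableOn, ← integrable_indicator_iff hC.measurableSet] at hi
  rw [← integral_indicator hC.measurableSet] at h0
  set F : Esp d → ℝ := C.indicator fun x => ⟪ι h, x⟫ * (⟪e, x⟫ * exp (-⟪e, x⟫ ^ 2 / 2)) with hF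
  have hiφ : Integrable (fun p : ℝ × EuclideanSpace ℝ (Fin d) => F (p.1 • e + ι p.2))
      (volume.prod volume) := hmp.integrable_comp_of_integrable hi
  rw [← hmp.map_eq] at h0 hi
  rw [integral_map hmp.measurable.aemeasurable hi.aestronglyMeasurable,
    integral_prod_symm _ hiφ] at h0
  rw [← h0]
  refine integral_congr_ae (ae_of_all _ fun v => ?_)
  have hg0 : 0 ≤ gauge L v := gauge_nonneg v
  have hnull : ∀ a : ℝ, ∀ᵐ s : ℝ, s ≠ a := fun a => by
    simp [ae_iff]
  have hcong : (fun s : ℝ => F (s • e + ι v)) =ᵐ[volume]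
      (Set.Ioi (gauge L v)).indicator fun s => ⟪h, v⟫ * (s * exp (-s ^ 2 / 2)) := by
    filter_upwards [hnull 0, hnull (gauge L v)] with s hs0 hsg
    have hes : ⟪e, s • e + ι v⟫ = s := by
      rw [inner_add_right, inner_smul_right, real_inner_self_eq_norm_sq, he, h1]
      ring
    have hhs : ⟪ι h, s • e + ι v⟫ = ⟪h, v⟫ := by
      rw [inner_add_right, inner_smul_right, real_inner_comm, h1, ι.inner_map_map]
      ring
    have hiff : s • e + ι v ∈ C ↔ gauge L v < s := by
      constructor
      · intro hmem
        have hs : 0 ≤ s := by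
          rw [← hes]
          by_cases hz : s • e + ι v = 0
          · simp [hz]
          · exact (hpos _ hmem hz).le
        have hs' := lt_of_le_of_ne hs hs0.symm
        exact lt_of_le_of_ne ((smul_add_frame_mem_iff hcone hL hs' v).1 hmem) hsg.symm
      · intro hlt
        exact (smul_add_frame_mem_iff hcone hL (hg0.trans_lt hlt) v).2 hlt.le
    simp only [hF, Set.indicator_apply, hiff, Set.mem_Ioi, hes, hhs]
  simp only
  rw [integral_congr_ae hcong, integral_indicator measurableSet_Ioi, integral_const_mul,
    integral_Ioi_mul_exp_neg_sq hg0]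

end Frame

theorem integral_sphereProb_neg (d : ℕ) (f : EuclideanSpace ℝ (Fin d) → ℝ) :
    ∫ u, f (-u) ∂(sphereProb d) = ∫ u, f u ∂(sphereProb d) := by
  have : (sphereProb d).IsNegInvariant := ⟨by
    rw [Measure.neg, sphereProb, Measure.map_smul]
    congr 1
    exact sphereVol_map (LinearIsometryEquiv.neg ℝ)⟩
  exact integral_neg_eq_self f _

theorem volume_ne_zero_of_sigmaMeas {d : ℕ} {C : Set (Esp d)} (hC : IsClosed C)
    (hcone : ∀ x ∈ C, ∀ t : ℝ, 0 ≤ t → t • x ∈ C) (h : sigmaMeas d (C ∩ uSphere d) ≠ 0) :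
    volume C ≠ 0 := by
  intro h0
  have hle : sigmaMeas d (C ∩ uSphere d) ≤ sigmaMeas d C := measure_mono Set.inter_subset_left
  refine h (le_antisymm (hle.trans (le_of_eq ?_)) zero_le)
  rw [sigmaMeas_eq, Measure.smul_apply, sphereVol_apply hC.measurableSet, measure_mono_null _ h0]
  · simp
  · rintro x ⟨hx0, -, hx⟩
    have := hcone _ hx ‖x‖ (norm_nonneg x)
    rwa [smul_smul, mul_inv_cancel₀ (norm_ne_zero_iff.2 hx0), one_smul] at this

section Frame

variable {d : ℕ} {C : Set (Esp d)} {e : Esp d} {ι : EuclideanSpace ℝ (Fin d) →ₗᵢ[ℝ] Esp d}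

theorem sigmaMeas_body_eq (hd : 1 ≤ d) (hC : IsClosed C)
    (hcone : ∀ x ∈ C, ∀ t : ℝ, 0 ≤ t → t • x ∈ C) (he : ‖e‖ = 1)
    (hpos : ∀ x ∈ C, x ≠ 0 → 0 < ⟪e, x⟫) (h1 : ∀ v, ⟪e, ι v⟫ = 0)
    (hmp : MeasurePreserving (fun p : ℝ × EuclideanSpace ℝ (Fin d) => p.1 • e + ι p.2)
        (volume.prod volume) volume) (hL : IsBodyAtZero {v | e + ι v ∈ C}) :
    (sigmaMeas d (C ∩ uSphere d)).toReal = omegaTot d / 2 *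
      ((∫ u, Jfun d (radialFn {v | e + ι v ∈ C} u) ∂(sphereProb d)) / Dfun d (π / 2)) := by
  have hSm : MeasurableSet (uSphere d) := Metric.isClosed_sphere.measurableSet
  have hK : sigmaMeas d (C ∩ uSphere d) = sigmaMeas d (C \ {0}) := by
    rw [sigmaMeas, Measure.restrict_apply' hSm, Measure.restrict_apply' hSm]
    congr 1
    ext x
    have : x ∈ uSphere d → x ≠ 0 := fun hx h0 => by simp [uSphere, h0] at hx
    simp only [Set.mem_inter_iff, Set.mem_sdiff, Set.mem_singleton_iff]
    tauto
  have hne : ∀ v, e + ι v ≠ 0 := fun v h0 => by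
    have := congrArg (fun x => ⟪e, x⟫) h0
    simp [inner_add_right, h1, he] at this
  rw [hK]
  refine sigmaMeas_cone hd he h1 hmp (hC.measurableSet.diff (measurableSet_singleton 0)) ?_
    (fun x hx => hpos x hx.1 hx.2) hL.measurable_radialFn (fun u hu => (hL.radialFn_pos hu).le)
    (fun u hu r hr hlt => ⟨(hL.smul_mem_iff hu hr).2 hlt.le, hne _⟩)
    (fun u hu r hr hmem => (hL.smul_mem_iff hu hr).1 hmem.1)
  rintro x ⟨hx, hx0⟩ t ht
  exact ⟨hcone x hx t ht.le, smul_ne_zero ht.ne' hx0⟩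

theorem sphRadial_frame (hcone : ∀ x ∈ C, ∀ t : ℝ, 0 ≤ t → t • x ∈ C) (he : ‖e‖ = 1)
    (heC : e ∈ C)
    (hpos : ∀ x ∈ C, x ≠ 0 → 0 < ⟪e, x⟫) (h1 : ∀ v, ⟪e, ι v⟫ = 0)
    (hL : IsBodyAtZero {v | e + ι v ∈ C}) {u : EuclideanSpace ℝ (Fin d)} (hu : ‖u‖ = 1) :
    sphRadial (C ∩ uSphere d) e (ι u) = arctan (radialFn {v | e + ι v ∈ C} u) := by
  have hρ := hL.radialFn_pos hu
  have hset : {t : ℝ | 0 ≤ t ∧ t ≤ π / 2 ∧ cos t • e + sin t • ι u ∈ C ∩ uSphere d} =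
      Set.Icc 0 (arctan (radialFn {v | e + ι v ∈ C} u)) := by
    ext t
    have hS : cos t • e + sin t • ι u ∈ uSphere d := by
      rw [uSphere, mem_sphere_zero_iff_norm, ← sq_eq_sq₀ (norm_nonneg _) zero_le_one,
        norm_add_sq_real, inner_smul_left, inner_smul_right, h1, norm_smul, norm_smul, he,
        ι.norm_map, hu]
      simp
    have hmain : ∀ (_ : 0 < t) (_ : t < π / 2), (cos t • e + sin t • ι u ∈ C ↔
        tan t ≤ radialFn {v | e + ι v ∈ C} u) := fun ht ht2 => by
      have hc := cos_pos_of_mem_Ioo ⟨by linarith, ht2⟩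
      rw [← hL.smul_mem_iff hu (tan_pos_of_pos_of_lt_pi_div_two ht ht2), ← map_smul,
        smul_add_frame_mem_iff hcone hL hc, hL.gauge_le_iff hc, smul_smul, tan_eq_sin_div_cos,
        div_eq_inv_mul]
    simp only [Set.mem_ofPred_eq, Set.mem_inter_iff, hS, and_true, Set.mem_Icc]
    constructor
    · rintro ⟨h0, h2, hm⟩
      refine ⟨h0, ?_⟩
      rcases h0.eq_or_lt with rfl | h0
      · exact arctan_nonneg.2 hρ.le
      have hlt : t < π / 2 := by
        refine lt_of_le_of_ne h2 ?_
        rintro rfl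
        rw [cos_pi_div_two, sin_pi_div_two, zero_smul, zero_add, one_smul] at hm
        have := hpos _ hm (by rw [← norm_ne_zero_iff, ι.norm_map, hu]; exact one_ne_zero)
        rw [h1] at this
        exact this.false
      rw [← arctan_tan (by linarith) hlt]
      exact arctan_strictMono.monotone ((hmain h0 hlt).1 hm)
    · rintro ⟨h0, h2⟩
      have hlt := h2.trans_lt (arctan_lt_pi_div_two _)
      refine ⟨h0, hlt.le, ?_⟩
      rcases h0.eq_or_lt with rfl | h0
      · simpa using heC
      refine (hmain h0 hlt).2 ?_
      rw [← tan_arctan (radialFn _ u)]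
      exact strictMonoOn_tan.monotoneOn ⟨by linarith, hlt⟩
        ⟨neg_pi_div_two_lt_arctan _, arctan_lt_pi_div_two _⟩ h2
  rw [sphRadial, hset, csSup_Icc (arctan_nonneg.2 hρ.le)]

theorem sigmaMeas_dual_eq (hd : 1 ≤ d)
    (hcone : ∀ x ∈ C, ∀ t : ℝ, 0 ≤ t → t • x ∈ C) (he : ‖e‖ = 1)
    (hpos : ∀ x ∈ C, x ≠ 0 → 0 < ⟪e, x⟫) (h1 : ∀ v, ⟪e, ι v⟫ = 0)
    (h2 : ∀ x, ⟪e, x⟫ = 0 → ∃ v, ι v = x)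
    (hmp : MeasurePreserving (fun p : ℝ × EuclideanSpace ℝ (Fin d) => p.1 • e + ι p.2)
        (volume.prod volume) volume) (hL : IsBodyAtZero {v | e + ι v ∈ C}) :
    MeasurableSet {x : Esp d | 0 < ⟪e, x⟫ ∧ ∀ y ∈ C, 0 ≤ ⟪x, y⟫} ∧
    (sigmaMeas d {x | 0 < ⟪e, x⟫ ∧ ∀ y ∈ C, 0 ≤ ⟪x, y⟫}).toReal = omegaTot d / 2 *
      ((∫ u, Jfun d (radialFn {v | ∀ w ∈ {v | e + ι v ∈ C}, ⟪v, w⟫ ≤ 1} u) ∂(sphereProb d)) /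
        Dfun d (π / 2)) := by
  set Q : Set (EuclideanSpace ℝ (Fin d)) := {v | ∀ w ∈ {v | e + ι v ∈ C}, ⟪v, w⟫ ≤ 1} with hQ
  have hQb : IsBodyAtZero Q := hL.polar
  have hA : MeasurableSet {x : Esp d | 0 < ⟪e, x⟫ ∧ ∀ y ∈ C, 0 ≤ ⟪x, y⟫} := by
    have hset : {x : Esp d | 0 < ⟪e, x⟫ ∧ ∀ y ∈ C, 0 ≤ ⟪x, y⟫} =
        {x | 0 < ⟪e, x⟫} ∩ ⋂ y ∈ C, {x | 0 ≤ ⟪x, y⟫} := by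
      ext; simp
    have hopen : IsOpen {x : Esp d | 0 < ⟪e, x⟫} := isOpen_lt (by fun_prop) (by fun_prop)
    rw [hset]
    exact hopen.measurableSet.inter (isClosed_biInter fun x _ =>
      isClosed_le (by fun_prop) (by fun_prop)).measurableSet
  have hin : ∀ v, ⟪e, e + ι v⟫ = 1 := fun v => by
    rw [inner_add_right, h1, real_inner_self_eq_norm_sq, he]
    norm_num
  have hinner : ∀ v w, ⟪e + ι v, e + ι w⟫ = 1 + ⟪v, w⟫ := fun v w => by
    rw [inner_add_left, hin, inner_add_right, real_inner_comm, h1, ι.inner_map_map, zero_add]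
  have hmem : ∀ v, e + ι v ∈ {x | 0 < ⟪e, x⟫ ∧ ∀ y ∈ C, 0 ≤ ⟪x, y⟫} ↔ -v ∈ Q := by
    intro v
    constructor
    · rintro ⟨-, h⟩ w hw
      have := h _ hw
      rw [hinner] at this
      rw [inner_neg_left]
      linarith
    · intro h
      refine ⟨by rw [hin]; exact one_pos, fun y hy => ?_⟩
      by_cases hy0 : y = 0
      · simp [hy0]
      have hs := hpos y hy hy0
      set s := ⟪e, y⟫ with hsdef
      obtain ⟨w, hw⟩ := h2 (s⁻¹ • y - e) (by
        rw [inner_sub_right, inner_smul_right, ← hsdef, inv_mul_cancel₀ hs.ne',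
          real_inner_self_eq_norm_sq, he]
        norm_num)
      have hyw : e + ι w = s⁻¹ • y := by rw [hw]; abel
      have hwL : w ∈ {v | e + ι v ∈ C} := by
        rw [Set.mem_ofPred_eq, hyw]
        exact hcone y hy _ (by positivity)
      have h3 := h w hwL
      have h4 : 0 ≤ ⟪e + ι v, s⁻¹ • y⟫ := by
        rw [← hyw, hinner]
        rw [inner_neg_left] at h3
        linarith
      rw [inner_smul_right] at h4
      exact nonneg_of_mul_nonneg_right h4 (by positivity)
  refine ⟨hA, ?_⟩
  rw [← integral_sphereProb_neg]
  refine sigmaMeas_cone hd he h1 hmp hA ?_ (fun x hx => hx.1)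
    (ρ := fun u => radialFn Q (-u)) (hQb.measurable_radialFn.comp measurable_neg)
    (fun u hu => (hQb.radialFn_pos (by simpa using hu)).le) (fun u hu r hr hlt => ?_)
    (fun u hu r hr h => ?_)
  · rintro x ⟨hx1, hx2⟩ t ht
    refine ⟨by rw [inner_smul_right]; positivity, fun y hy => ?_⟩
    rw [inner_smul_left]
    exact mul_nonneg (by simpa using ht.le) (hx2 y hy)
  · rw [hmem, ← smul_neg]
    exact (hQb.smul_mem_iff (by simpa using hu) hr).2 hlt.le
  · rw [hmem, ← smul_neg] at h
    exact (hQb.smul_mem_iff (by simpa using hu) hr).1 h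

theorem U1_body_ge (hd : 1 ≤ d) (hω : 0 < omegaTot d) (hconv : Convex ℝ C)
    (hcone : ∀ x ∈ C, ∀ t : ℝ, 0 ≤ t → t • x ∈ C) (he : ‖e‖ = 1) (heC : e ∈ C)
    (hpos : ∀ x ∈ C, x ≠ 0 → 0 < ⟪e, x⟫) (h1 : ∀ v, ⟪e, ι v⟫ = 0)
    (h2 : ∀ x, ⟪e, x⟫ = 0 → ∃ v, ι v = x)
    (hmp : MeasurePreserving (fun p : ℝ × EuclideanSpace ℝ (Fin d) => p.1 • e + ι p.2)
        (volume.prod volume) volume) (hL : IsBodyAtZero {v | e + ι v ∈ C}) :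
    1 / 2 * (1 - (∫ u, Jfun d (radialFn {v | ∀ w ∈ {v | e + ι v ∈ C}, ⟪v, w⟫ ≤ 1} u)
      ∂(sphereProb d)) / Dfun d (π / 2)) ≤ U1 d (C ∩ uSphere d) := by
  obtain ⟨hPm, hPv⟩ := sigmaMeas_dual_eq hd hcone he hpos h1 h2 hmp hL
  set A := (∫ u, Jfun d (radialFn {v | ∀ w ∈ {v | e + ι v ∈ C}, ⟪v, w⟫ ≤ 1} u)
      ∂(sphereProb d)) / Dfun d (π / 2) with hA
  set P : Set (Esp d) := {x | 0 < ⟪e, x⟫ ∧ ∀ y ∈ C, 0 ≤ ⟪x, y⟫} with hP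
  set H : Set (Esp d) := {x | ∃ y ∈ C ∩ uSphere d, ⟪x, y⟫ = 0} with hH
  have hadd : ∀ x ∈ C, ∀ y ∈ C, x + y ∈ C := fun x hx y hy => by
    have := hcone _ (hconv hx hy (by norm_num : (0:ℝ) ≤ 1/2) (by norm_num : (0:ℝ) ≤ 1/2)
      (by norm_num)) 2 (by norm_num)
    rwa [smul_add, smul_smul, smul_smul, show (2:ℝ) * (1/2) = 1 by norm_num, one_smul,
      one_smul] at this
  have hkey : ∀ x, x ∉ H → 0 < ⟪e, x⟫ → x ∈ P := by
    intro x hxH hex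
    refine ⟨hex, fun y hy => ?_⟩
    by_contra! hlt
    apply hxH
    have hy0 : y ≠ 0 := fun h0 => by simp [h0] at hlt
    have hey := hpos y hy hy0
    set z := ⟪e, x⟫ • y + (-⟪x, y⟫) • e with hz
    have hzC : z ∈ C := hadd _ (hcone y hy _ hex.le) _ (hcone e heC _ (by linarith))
    have hxz : ⟪x, z⟫ = 0 := by
      rw [hz, inner_add_right, inner_smul_right, inner_smul_right, real_inner_comm e x]
      ring
    have hez : 0 < ⟪e, z⟫ := by
      rw [hz, inner_add_right, inner_smul_right, inner_smul_right, real_inner_self_eq_norm_sq, he]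
      nlinarith [mul_pos hex hey]
    have hz0 : ‖z‖ ≠ 0 := fun h0 => by
      rw [norm_eq_zero.1 h0] at hez
      simp at hez
    refine ⟨‖z‖⁻¹ • z, ⟨hcone z hzC _ (by positivity), ?_⟩, by rw [inner_smul_right, hxz, mul_zero]⟩
    rw [uSphere, mem_sphere_zero_iff_norm, norm_smul, norm_inv, norm_norm, inv_mul_cancel₀ hz0]
  have hcover : uSphere d ⊆ H ∪ (P ∪ {x | -x ∈ P}) := by
    intro x hx
    by_cases hxH : x ∈ H
    · exact Or.inl hxH
    have hne : ⟪e, x⟫ ≠ 0 := fun h0 => hxH ⟨e, ⟨heC, by simpa [uSphere] using he⟩, by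
      rw [real_inner_comm]; exact h0⟩
    refine Or.inr ?_
    rcases hne.lt_or_gt with h | h
    · refine Or.inr (hkey (-x) ?_ (by rw [inner_neg_right]; linarith))
      rintro ⟨y, hy, hxy⟩
      exact hxH ⟨y, hy, by simpa [inner_neg_left] using hxy⟩
    · exact Or.inl (hkey x hxH h)
  have hsum : sigmaMeas d (uSphere d) ≤ sigmaMeas d H + (sigmaMeas d P + sigmaMeas d P) := by
    refine (measure_mono hcover).trans ((measure_union_le _ _).trans ?_)
    gcongr
    refine (measure_union_le _ _).trans (le_of_eq ?_)
    rw [sigmaMeas_neg hPm]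
  have hreal := ENNReal.toReal_mono (by finiteness) hsum
  rw [ENNReal.toReal_add (by finiteness) (by finiteness),
    ENNReal.toReal_add (by finiteness) (by finiteness), hPv] at hreal
  change omegaTot d ≤ _ at hreal
  rw [U1]
  rw [one_div (2 * omegaTot d), inv_mul_eq_div, le_div_iff₀ (by positivity)]
  nlinarith

end Frame

theorem exists_Jfun_eq {d : ℕ} (hd : 1 ≤ d) {T μ : ℝ} (hTμ : Jfun d T ≤ μ)
    (hμ : μ < Dfun d (π / 2)) : ∃ m, T ≤ m ∧ Jfun d m = μ := by
  obtain ⟨R, hR, hTR⟩ := (((Jfun_tendsto_atTop d).eventually_const_lt hμ).and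
    (eventually_ge_atTop T)).exists
  obtain ⟨m, hm, hmμ⟩ := intermediate_value_Icc hTR (Jfun_continuous hd).continuousOn ⟨hTμ, hR.le⟩
  exact ⟨m, hm.1, hmμ⟩

namespace IsBodyAtZero

variable {d : ℕ} {L : Set (EuclideanSpace ℝ (Fin d))}

theorem memLp_Jfun_radialFn (hd : 1 ≤ d) (hL : IsBodyAtZero L) :
    MemLp (fun u => Jfun d (radialFn L u)) 2 (sphereProb d) := by
  have := isProbabilityMeasure_sphereProb hd
  refine MemLp.of_bound ((Jfun_continuous hd).measurable.comp
    hL.measurable_radialFn).aestronglyMeasurable (Dfun d (π / 2)) ?_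
  filter_upwards [ae_norm_sphereProb d] with u hu
  have h := (hL.radialFn_pos hu).le
  rw [norm_of_nonneg (Jfun_nonneg hd h)]
  exact Jfun_le d h

theorem integrable_Jfun_radialFn (hd : 1 ≤ d) (hL : IsBodyAtZero L) :
    Integrable (fun u => Jfun d (radialFn L u)) (sphereProb d) := by
  have := isProbabilityMeasure_sphereProb hd
  exact (hL.memLp_Jfun_radialFn hd).integrable one_le_two

theorem integral_sq_Jfun_sub_le (hd : 1 ≤ d) (hL : IsBodyAtZero L) :
    ∫ u, (Jfun d (radialFn L u) - ∫ v, Jfun d (radialFn L v) ∂(sphereProb d)) ^ 2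
      ∂(sphereProb d) ≤ (Dfun d (π / 2) / 2) ^ 2 := by
  have := isProbabilityMeasure_sphereProb hd
  have h := ProbabilityTheory.variance_le_sq_of_bounded (μ := sphereProb d)
    (X := fun u => Jfun d (radialFn L u)) (a := 0) (b := Dfun d (π / 2)) ?_
    (hL.memLp_Jfun_radialFn hd).aestronglyMeasurable.aemeasurable
  · rwa [ProbabilityTheory.variance_eq_integral
      (hL.memLp_Jfun_radialFn hd).aestronglyMeasurable.aemeasurable, sub_zero] at h
  · filter_upwards [ae_norm_sphereProb d] with u hu
    have h := (hL.radialFn_pos hu).le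
    exact ⟨Jfun_nonneg hd h, Jfun_le d h⟩

/-- A quantitative Jensen inequality for the average of the `d`-th power of a radial function. -/
theorem integral_radialFn_pow_ge (hd : 2 ≤ d) (hL : IsBodyAtZero L) {m : ℝ} (hm : 0 ≤ m)
    (hmean : Jfun d m = ∫ u, Jfun d (radialFn L u) ∂(sphereProb d)) :
    m ^ d + d * max (d + 1 : ℝ) (m ^ (d + 1) / Dfun d (π / 2)) / 2 *
        ∫ u, (Jfun d (radialFn L u) - Jfun d m) ^ 2 ∂(sphereProb d) ≤
      ∫ u, radialFn L u ^ d ∂(sphereProb d) := by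
  have hd1 : 1 ≤ d := by omega
  have := isProbabilityMeasure_sphereProb hd1
  have hJ := hL.integrable_Jfun_radialFn hd1
  have hlin : Integrable (fun u => Jfun d (radialFn L u) - Jfun d m) (sphereProb d) :=
    hJ.sub (integrable_const _)
  have hsq : Integrable (fun u => (Jfun d (radialFn L u) - Jfun d m) ^ 2) (sphereProb d) :=
    ((hL.memLp_Jfun_radialFn hd1).sub (memLp_const _)).integrable_sq
  have hzero : ∫ u, (Jfun d (radialFn L u) - Jfun d m) ∂(sphereProb d) = 0 := by
    rw [integral_sub hJ (integrable_const _), ← hmean]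
    simp
  have hmono := integral_mono_ae
    (((integrable_const (m ^ d)).add (hlin.const_mul (d * √(1 + m ^ 2) ^ (d + 1)))).add
      (hsq.const_mul (d * max (d + 1 : ℝ) (m ^ (d + 1) / Dfun d (π / 2)) / 2)))
    (hL.integrable_radialFn_pow hd1 d)
    ((ae_norm_sphereProb d).mono fun u hu => pow_ge_quadratic hd (hL.radialFn_pos hu).le hm)
  rw [integral_add' ((integrable_const _).add (hlin.const_mul _)) (hsq.const_mul _),
    integral_add' (integrable_const _) (hlin.const_mul _), integral_const_mul, integral_const_mul,
    hzero] at hmono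
  simpa using hmono

theorem integral_Jfun_radialFn_le (hd : 1 ≤ d) (hL : IsBodyAtZero L) {r : ℝ} (hr : 0 ≤ r) :
    ∫ u, Jfun d (radialFn L u) ∂(sphereProb d) ≤
      Jfun d r + ((∫ u, radialFn L u ^ d ∂(sphereProb d)) - r ^ d) /
        (d * √(1 + r ^ 2) ^ (d + 1)) := by
  have := isProbabilityMeasure_sphereProb hd
  have hpow := hL.integrable_radialFn_pow hd d
  have hsub : Integrable (fun u => (radialFn L u ^ d - r ^ d) / (d * √(1 + r ^ 2) ^ (d + 1)))
    (sphereProb d) := (hpow.sub (integrable_const _)).div_const _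
  have hmono := integral_mono_ae (hL.integrable_Jfun_radialFn hd)
    ((integrable_const (Jfun d r)).add hsub)
    ((ae_norm_sphereProb d).mono fun u hu => Jfun_le_tangent hd (hL.radialFn_pos hu).le hr)
  rw [integral_add' (integrable_const _) hsub, integral_div,
    integral_sub hpow (integrable_const _)] at hmono
  simpa using hmono

end IsBodyAtZero

theorem L2dev_frame {d : ℕ} (hd : 2 ≤ d) (hω : 0 < omegaTot d) {C : Set (Esp d)} {e : Esp d}
    {ι : EuclideanSpace ℝ (Fin d) →ₗᵢ[ℝ] Esp d} (hcone : ∀ x ∈ C, ∀ t : ℝ, 0 ≤ t → t • x ∈ C)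
    (he : ‖e‖ = 1) (heC : e ∈ C) (hpos : ∀ x ∈ C, x ≠ 0 → 0 < ⟪e, x⟫)
    (h1 : ∀ v, ⟪e, ι v⟫ = 0) (h2 : ∀ x, ⟪e, x⟫ = 0 → ∃ v, ι v = x)
    (hL : IsBodyAtZero {v | e + ι v ∈ C}) :
    L2dev d (C ∩ uSphere d) e = √(∫ u, (Jfun d (radialFn {v | e + ι v ∈ C} u) -
      ∫ v, Jfun d (radialFn {v | e + ι v ∈ C} v) ∂(sphereProb d)) ^ 2 ∂(sphereProb d)) := by
  have hae : ∀ᵐ u ∂(sphereProb d), Dfun d (sphRadial (C ∩ uSphere d) e (ι u)) =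
      Jfun d (radialFn {v | e + ι v ∈ C} u) := by
    filter_upwards [ae_norm_sphereProb d] with u hu
    rw [sphRadial_frame hcone he heC hpos h1 hL hu, Jfun]
  have havg : avgD d (C ∩ uSphere d) e =
      ∫ v, Jfun d (radialFn {v | e + ι v ∈ C} v) ∂(sphereProb d) := by
    rw [avgD, integral_sigma0 hd hω h1 h2]
    exact integral_congr_ae hae
  rw [L2dev, integral_sigma0 hd hω h1 h2, havg]
  congr 1
  refine integral_congr_ae ?_
  filter_upwards [hae] with u hu
  rw [hu]

/-- The stability estimate with the constant coming from the second term of the minimum. -/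
theorem U1_ge_of_Delta2_ge {d : ℕ} (hd : 2 ≤ d) {ε α : ℝ} (hω : 0 < omegaTot d) (hε : 0 < ε)
    (hα : 0 < α) (hα' : α < π / 2) {K : Set (Esp d)} (hK : IsProperSphConvBody d K)
    {e' : Esp d} (he' : e' ∈ uSphere d)
    (hle : (sigmaMeas d (cap e' α)).toReal ≤ (sigmaMeas d K).toReal)
    (hge : (sigmaMeas d K).toReal ≤ (omegaTot d / 2) * (1 - ε / π)) (hΔ : ε ≤ Delta2 d K) :
    (1 + 2 * ((2 / π) ^ (d + 1) * (omegaTot d / (2 * π * omegaSm d)) ^ d / d) *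
      ε ^ (2 * (d + 1))) * U1 d (cap e' α) ≤ U1 d K := by
  have hd1 : 1 ≤ d := by omega
  have hD := Dfun_pi_div_two_pos d
  have hT : 0 < tan α := tan_pos_of_pos_of_lt_pi_div_two hα hα'
  have hcap := sigmaMeas_cap hd1 he' hα hα'
  rw [hcap] at hle
  have hJT : 0 < Jfun d (tan α) := by
    rw [← Jfun_zero d]
    exact Jfun_strictMonoOn hd1 (Set.mem_Ici.2 le_rfl) hT.le hT
  obtain ⟨C, hC, hconv, hcone, -, hline, rfl⟩ := hK
  obtain ⟨e₀, he₀, hpos₀⟩ : (negIntPolar d (C ∩ uSphere d)).Nonempty := by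
    rw [Set.nonempty_iff_ne_empty]
    intro h
    rw [Delta2, h, Set.image_empty, Real.sInf_empty] at hΔ
    linarith
  have hpos₀' : ∀ x ∈ C, x ≠ 0 → 0 < ⟪e₀, x⟫ := by
    intro x hx hx0
    have hn : 0 < ‖x‖ := norm_pos_iff.2 hx0
    have h := hpos₀ (‖x‖⁻¹ • x) ⟨hcone x hx _ (by positivity), by
      simp [uSphere, norm_smul, hn.ne']⟩
    rw [inner_smul_right] at h
    exact pos_of_mul_pos_right h (by positivity)
  have hvol : volume C ≠ 0 := by
    refine volume_ne_zero_of_sigmaMeas hC hcone fun h => ?_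
    rw [h, ENNReal.toReal_zero] at hle
    have : 0 < omegaTot d / 2 * (Jfun d (tan α) / Dfun d (π / 2)) := by positivity
    linarith
  obtain ⟨e, he, hpos, hcent⟩ := exists_centered_direction hC hconv hcone hline hvol
    (mem_sphere_zero_iff_norm.1 he₀) hpos₀'
  have hInt := mem_interior_of_centered hC hconv hcone hvol he hpos hcent
  have heC := interior_subset hInt
  obtain ⟨ι, h1, h2, hmp⟩ := exists_frame he
  have hL := isBodyAtZero_frame_section hC hconv hcone he hpos hInt h1
  have hsant := hL.santalo hd1
    (integral_inner_mul_exp_gauge_eq_zero hC hcone he hpos hcent h1 hmp hL)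
  have hdev : ε ≤ L2dev d (C ∩ uSphere d) e := by
    refine hΔ.trans (csInf_le ⟨0, ?_⟩ ⟨e, ⟨mem_sphere_zero_iff_norm.2 he, fun x hx => ?_⟩, rfl⟩)
    · rintro _ ⟨x, -, rfl⟩
      exact sqrt_nonneg _
    · refine hpos x hx.1 fun h0 => ?_
      simpa [uSphere, h0] using hx.2
  rw [L2dev_frame hd hω hcone he heC hpos h1 h2 hL] at hdev
  rw [sigmaMeas_body_eq hd1 hC hcone he hpos h1 hmp hL] at hle hge
  have hU := U1_body_ge hd1 hω hconv hcone he heC hpos h1 h2 hmp hL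
  have hLp := hL.polar
  set L := {v | e + ι v ∈ C} with hLdef
  set Q := {v | ∀ w ∈ L, ⟪v, w⟫ ≤ 1} with hQdef
  set μ := ∫ u, Jfun d (radialFn L u) ∂(sphereProb d) with hμ
  have hTμ : Jfun d (tan α) ≤ μ :=
    (div_le_div_iff_of_pos_right hD).1 (le_of_mul_le_mul_left hle (by positivity))
  have hμε : μ ≤ Dfun d (π / 2) * (1 - ε / π) := by
    have h := le_of_mul_le_mul_left hge (by positivity : 0 < omegaTot d / 2)
    rwa [div_le_iff₀' hD] at h
  have hμD : μ < Dfun d (π / 2) := by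
    refine hμε.trans_lt ?_
    have : 0 < Dfun d (π / 2) * (ε / π) := by positivity
    linarith
  obtain ⟨m, hTm, hm⟩ := exists_Jfun_eq hd1 hTμ hμD
  have hvar : ε ^ 2 ≤ ∫ u, (Jfun d (radialFn L u) - μ) ^ 2 ∂(sphereProb d) :=
    (Real.le_sqrt' hε).1 hdev
  have hεD : ε ≤ Dfun d (π / 2) / 2 :=
    le_of_sq_le_sq (hvar.trans (hL.integral_sq_Jfun_sub_le hd1)) (by positivity)
  have hM := hL.integral_radialFn_pow_ge hd (hT.le.trans hTm) hm
  rw [hm] at hM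
  have hMT : tan α ^ d + d * max (d + 1 : ℝ) (tan α ^ (d + 1) / Dfun d (π / 2)) / 2 * ε ^ 2 ≤
      ∫ u, radialFn L u ^ d ∂(sphereProb d) := by
    refine le_trans ?_ hM
    gcongr
  have hgain := scalar_gain hd hT hε hεD
    (by have := omegaSm_pos hd hω; positivity) (omega_ratio_pow_le hd hω) (hTμ.trans hμε) hMT hsant
    (fun r hr => hLp.integral_Jfun_radialFn_le hd1 hr.le)
  have hcapU := U1_cap_le hd1 he' hα hα' hω
  have hsm := omegaSm_pos hd hω
  refine (mul_le_mul_of_nonneg_left hcapU (by positivity)).trans (le_trans ?_ hU)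
  rw [one_sub_div hD.ne', one_sub_div hD.ne', mul_left_comm, ← mul_div_assoc]
  gcongr

/-- geometric core of Lemma 6.2. With the explicit constant `β̄`
depending only on `a` and `d`, every `K ∈ 𝒦_s^d` with `σ_d(K) ≥ a`,
`σ_d(K) ≤ (ω_{d+1}/2)(1 - ε/π)` and `Δ₂(K) ≥ ε` satisfies
`U₁(K) ≥ (1 + β̄ ε^{2(d+1)}) U₁(B_a)`, where `B_a` is any cap of volume `a`
(of radius `α₀`). -/
theorem statement19 (d : ℕ) (hd : 2 ≤ d) (a ε : ℝ) (ha : 0 < a)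
    (ha' : a < omegaTot d / 2) (hε : 0 < ε) (hε' : ε ≤ 1)
    (α0 : ℝ) (hα00 : 0 < α0) (hα0 : α0 < π / 2)
    (hvola : ∀ e ∈ uSphere d, (sigmaMeas d (cap e α0)).toReal = a) :
    ∃ β : ℝ,
      β = 2 * min
          ((((d + 1).choose 2 : ℝ) * Real.sin α0 ^ (d + 1) *
              (omegaTot d / (2 * π * omegaSm d)) ^ (2 * d)) /
            ((d : ℝ) + (d : ℝ) * ((d + 1).choose 2 : ℝ) * (π / 2) ^ 2 *
              (Real.tan α0 ^ d)⁻¹))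
          ((2 / π) ^ (d + 1) * omegaTot d ^ d / ((d : ℝ) * (2 * π * omegaSm d) ^ d)) ∧
      0 < β ∧
      ∀ K : Set (Esp d), IsProperSphConvBody d K →
        a ≤ (sigmaMeas d K).toReal →
        (sigmaMeas d K).toReal ≤ (omegaTot d / 2) * (1 - ε / π) →
        ε ≤ Delta2 d K →
        ∀ e ∈ uSphere d,
          U1 d K ≥ (1 + β * ε ^ (2 * (d + 1))) * U1 d (cap e α0) := by
  have hω : 0 < omegaTot d := by linarith
  have hsm := omegaSm_pos hd hω
  have hs : 0 < sin α0 := sin_pos_of_pos_of_lt_pi hα00 (by linarith [pi_pos])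
  have ht : 0 < tan α0 := tan_pos_of_pos_of_lt_pi_div_two hα00 hα0
  have hc : (0 : ℝ) < (d + 1).choose 2 := by exact_mod_cast Nat.choose_pos (by omega)
  have hd0 : (0 : ℝ) < d := by exact_mod_cast (by omega : 0 < d)
  refine ⟨_, rfl, by positivity, fun K hK hle hge hΔ e he => ?_⟩
  refine le_trans ?_ (U1_ge_of_Delta2_ge hd hω hε hα00 hα0 hK he ((hvola e he).le.trans hle) hge hΔ)
  have hU : 0 ≤ U1 d (cap e α0) := mul_nonneg (by positivity) ENNReal.toReal_nonneg
  gcongr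
  refine (min_le_right _ _).trans (le_of_eq ?_)
  rw [div_pow (omegaTot d)]
  field_simp

end
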